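/- Let n = 3, ν > 1/2 + 5/11, p = 4, and let q satisfy 2 ≤ q < (4/3 + 1/24)·q_ν, where q_ν = 2ν + 1. Then there exists C > 0 such that for every measurable F : T_{Λ₃} → ℂ with ‖F‖_{L^{4,q}_ν} < ∞, the integral defining T_ν F(z) converges absolutely for every z ∈ T_{Λ₃} and ‖T_ν F‖_{L^{4,q}_ν} ≤ C·‖F‖_{L^{4,q}_ν}. -/

import Mathlib

open MeasureTheory Complex Set
open scoped ENNReal NNReal

noncomputable section

def lorentzQ (n : ℕ) [NeZero n] (y : Fin n → ℝ) : ℝ :=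
  y 0 ^ 2 - ∑ k ∈ Finset.univ.filter (fun k => k ≠ 0), y k ^ 2

def lorentzQC (n : ℕ) [NeZero n] (z : Fin n → ℂ) : ℂ :=
  z 0 ^ 2 - ∑ k ∈ Finset.univ.filter (fun k => k ≠ 0), z k ^ 2

def lightCone (n : ℕ) [NeZero n] : Set (Fin n → ℝ) :=
  {y | 0 < y 0 ∧ 0 < lorentzQ n y}

def tubePt (n : ℕ) (x y : Fin n → ℝ) : Fin n → ℂ :=
  fun k => (x k : ℂ) + (y k : ℂ) * Complex.I

def inTube (n : ℕ) [NeZero n] (z : Fin n → ℂ) : Prop :=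
  (fun k => (z k).im) ∈ lightCone n

def eVec (n : ℕ) [NeZero n] : Fin n → ℝ := fun k => if k = 0 then 1 else 0

def mixedNorm (n : ℕ) [NeZero n] (p q ν : ℝ) (F : (Fin n → ℂ) → ℂ) : ℝ≥0∞ :=
  (∫⁻ y in lightCone n,
      (∫⁻ x : Fin n → ℝ, (‖F (tubePt n x y)‖₊ : ℝ≥0∞) ^ p) ^ (q / p)
        * ENNReal.ofReal (lorentzQ n y ^ (ν - (n : ℝ) / 2))) ^ (1 / q)

def bergmanIntegrand (n : ℕ) [NeZero n] (ν : ℝ) (F : (Fin n → ℂ) → ℂ) (z : Fin n → ℂ)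
    (uv : (Fin n → ℝ) × (Fin n → ℝ)) : ℂ :=
  lorentzQC n (fun k => (z k - ((uv.1 k : ℂ) - (uv.2 k : ℂ) * Complex.I)) / Complex.I)
      ^ (((-(ν + (n : ℝ) / 2) : ℝ)) : ℂ)
    * F (tubePt n uv.1 uv.2)
    * ((lorentzQ n uv.2 ^ (ν - (n : ℝ) / 2) : ℝ) : ℂ)

def bergmanOp (n : ℕ) [NeZero n] (ν : ℝ) (F : (Fin n → ℂ) → ℂ) (z : Fin n → ℂ) : ℂ :=
  ∫ uv in (univ ×ˢ lightCone n : Set ((Fin n → ℝ) × (Fin n → ℝ))),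
    bergmanIntegrand n ν F z uv

def qnu (n : ℕ) (ν : ℝ) : ℝ := (ν + (n : ℝ) / 2 - 1) / ((n : ℝ) / 2 - 1)

def pSharp (p : ℝ) : ℝ := if p ≤ 2 then p else p / (p - 1)

def qtilde (n : ℕ) (ν p : ℝ) : ℝ≥0∞ :=
  if 1 < (n : ℝ) / 2 * (1 - 1 / p) then
    ENNReal.ofReal ((ν + (n : ℝ) / 2 - 1) / ((n : ℝ) / 2 * (1 - 1 / p) - 1))
  else ∞

/-! ### Minkowski's integral inequality -/

namespace ConeBergman

/-- **Minkowski's integral inequality** for `ℝ≥0∞`-valued functions. -/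
theorem lintegral_lintegral_rpow_le {α β : Type*} [MeasurableSpace α] [MeasurableSpace β]
    {μ : Measure α} {ρ : Measure β} [SFinite μ] [SFinite ρ] {f : α → β → ℝ≥0∞}
    (hf : Measurable (Function.uncurry f)) {p : ℝ} (hp : 1 ≤ p) :
    ∫⁻ x, (∫⁻ y, f x y ∂ρ) ^ p ∂μ ≤ (∫⁻ y, (∫⁻ x, f x y ^ p ∂μ) ^ (1 / p) ∂ρ) ^ p := by
  have hp0 : 0 < p := by linarith
  rcases hp.eq_or_lt with rfl | hp1
  · simp only [ENNReal.rpow_one, div_one]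
    exact (lintegral_lintegral_swap hf.aemeasurable).le
  set g : β → ℝ≥0∞ := fun y => (∫⁻ x, f x y ^ p ∂μ) ^ (1 / p) with hg
  have hfp : Measurable (Function.uncurry fun x y => f x y ^ p) := hf.pow_const p
  have hgm : Measurable g := (hfp.lintegral_prod_left').pow_const _
  have hgp : ∀ y, ∫⁻ x, f x y ^ p ∂μ = g y ^ p := by
    intro y
    rw [hg]
    simp only
    rw [← ENNReal.rpow_mul, one_div_mul_cancel hp0.ne', ENNReal.rpow_one]
  set I : ℝ≥0∞ := ∫⁻ y, g y ∂ρ with hI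
  by_cases hItop : I = ∞
  · rw [hItop, ENNReal.top_rpow_of_pos hp0]; exact le_top
  have hgfin : ∀ᵐ y ∂ρ, g y < ∞ := ae_lt_top hgm hItop
  have hzero : ∀ᵐ x ∂μ, ∫⁻ y, {y | g y = 0}.indicator (f x) y ∂ρ = 0 := by
    have hm : Measurable (Function.uncurry fun x y => {y | g y = 0}.indicator (f x) y) := by
      have : (Function.uncurry fun x y => {y | g y = 0}.indicator (f x) y)
          = {z : α × β | g z.2 = 0}.indicator (Function.uncurry f) := by
        ext ⟨x, y⟩; simp [Set.indicator, Function.uncurry]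
      rw [this]
      exact hf.indicator ((hgm.comp measurable_snd) (measurableSet_singleton 0))
    refine (lintegral_eq_zero_iff (hm.lintegral_prod_right')).1 ?_
    refine (lintegral_lintegral_swap hm.aemeasurable).trans ?_
    refine (lintegral_eq_zero_iff (hm.lintegral_prod_left')).2 ?_
    refine Filter.Eventually.of_forall fun y => ?_
    by_cases hy : g y = 0
    · have h1 : ∫⁻ x, f x y ^ p ∂μ = 0 := by rw [hgp, hy, ENNReal.zero_rpow_of_pos hp0]
      rw [lintegral_eq_zero_iff (show Measurable (fun x => f x y ^ p) from
        hfp.comp measurable_prodMk_right)] at h1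
      refine (lintegral_eq_zero_iff (hm.comp measurable_prodMk_right)).2 ?_
      filter_upwards [h1] with x hx
      simp only [Pi.zero_apply, ENNReal.rpow_eq_zero_iff] at hx
      rcases hx with hx | hx
      · simp [hx.1]
      · linarith
    · simp [Set.indicator, hy]
  have hpq : p.HolderConjugate (p / (p - 1)) := Real.HolderConjugate.conjExponent hp1
  have hq0 : 0 < p / (p - 1) := hpq.symm.pos
  have hbound : ∀ᵐ x ∂μ, (∫⁻ y, f x y ∂ρ) ^ p
      ≤ (∫⁻ y, f x y ^ p * g y ^ (1 - p) ∂ρ) * I ^ (p - 1) := by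
    filter_upwards [hzero] with x hx
    have hfx : Measurable (f x) := hf.comp measurable_prodMk_left
    have h1 : ∫⁻ y, f x y ∂ρ ≤ ∫⁻ y, ((fun y => f x y * g y ^ ((1 - p) / p)) *
        (fun y => g y ^ ((p - 1) / p))) y ∂ρ := by
      have hs : MeasurableSet {y | g y = 0} := hgm (measurableSet_singleton 0)
      rw [← lintegral_add_compl _ hs]
      rw [lintegral_indicator hs] at hx
      rw [hx, zero_add, ← lintegral_indicator hs.compl]
      apply lintegral_mono_ae
      filter_upwards [hgfin] with y hy
      by_cases h0 : g y = 0
      · simp [h0]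
      · simp only [mem_compl_iff, mem_ofPred_eq, h0, not_false_eq_true, indicator_of_mem,
          Pi.mul_apply]
        rw [mul_assoc, ← ENNReal.rpow_add _ _ h0 hy.ne]
        rw [show (1 - p) / p + (p - 1) / p = 0 by ring, ENNReal.rpow_zero, mul_one]
    have h2 := ENNReal.lintegral_mul_le_Lp_mul_Lq ρ hpq
      (hfx.mul (hgm.pow_const ((1 - p) / p))).aemeasurable
      (hgm.pow_const ((p - 1) / p)).aemeasurable
    have h3 := ENNReal.rpow_le_rpow (h1.trans h2) hp0.le
    refine h3.trans (le_of_eq ?_)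
    rw [ENNReal.mul_rpow_of_nonneg _ _ hp0.le, ← ENNReal.rpow_mul, ← ENNReal.rpow_mul,
      one_div_mul_cancel hp0.ne', ENNReal.rpow_one]
    congr 1
    · apply lintegral_congr; intro y
      simp only [Pi.mul_apply]
      rw [ENNReal.mul_rpow_of_nonneg _ _ hp0.le, ← ENNReal.rpow_mul,
        div_mul_cancel₀ _ hp0.ne']
    · rw [show 1 / (p / (p - 1)) * p = p - 1 by field_simp]
      congr 1
      apply lintegral_congr; intro y
      rw [← ENNReal.rpow_mul, show (p - 1) / p * (p / (p - 1)) = 1 by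
        have : p - 1 ≠ 0 := by linarith
        field_simp, ENNReal.rpow_one]
  have hfg : Measurable (Function.uncurry fun x y => f x y ^ p * g y ^ (1 - p)) :=
    hfp.mul ((hgm.comp measurable_snd).pow_const _)
  calc ∫⁻ x, (∫⁻ y, f x y ∂ρ) ^ p ∂μ
      ≤ ∫⁻ x, (∫⁻ y, f x y ^ p * g y ^ (1 - p) ∂ρ) * I ^ (p - 1) ∂μ := lintegral_mono_ae hbound
    _ = (∫⁻ x, ∫⁻ y, f x y ^ p * g y ^ (1 - p) ∂ρ ∂μ) * I ^ (p - 1) := by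
        rw [lintegral_mul_const]
        exact hfg.lintegral_prod_right'
    _ = (∫⁻ y, ∫⁻ x, f x y ^ p * g y ^ (1 - p) ∂μ ∂ρ) * I ^ (p - 1) := by
        rw [lintegral_lintegral_swap hfg.aemeasurable]
    _ ≤ I * I ^ (p - 1) := by
        gcongr
        apply lintegral_mono_ae
        filter_upwards [hgfin] with y hy
        rw [lintegral_mul_const _ (show Measurable (fun x => f x y ^ p) from
          hfp.comp measurable_prodMk_right), hgp]
        by_cases h0 : g y = 0
        · simp [h0, hp0]
        · rw [← ENNReal.rpow_add _ _ h0 hy.ne, add_sub_cancel, ENNReal.rpow_one]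
    _ = I ^ p := by
        conv_lhs => rw [← ENNReal.rpow_one I]
        by_cases h0 : I = 0
        · simp [h0, hp0]
        · rw [ENNReal.rpow_one]
          nth_rw 1 [← ENNReal.rpow_one I]
          rw [← ENNReal.rpow_add _ _ h0 hItop, add_sub_cancel]

end ConeBergman

/-! ### The triangular group acting on the light cone -/

namespace ConeBergman

/-- The real vector space underlying the three-dimensional light cone. -/
abbrev V := Fin 3 → ℝ

/-- The standard pairing on `V`. -/
def pr (y ξ : V) : ℝ := y 0 * ξ 0 + y 1 * ξ 1 + y 2 * ξ 2

/-- The point `y - i x` of the complexification of `V`. -/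
def cpt (y x : V) : Fin 3 → ℂ := fun k => (y k : ℂ) - (x k : ℂ) * I

theorem lorentzQ_three (y : V) : lorentzQ 3 y = y 0 ^ 2 - y 1 ^ 2 - y 2 ^ 2 := by
  have : (Finset.univ.filter fun k : Fin 3 => k ≠ 0) = {1, 2} := by decide
  simp only [lorentzQ, this]
  rw [Finset.sum_pair (by decide)]
  ring

theorem lorentzQC_three (y : Fin 3 → ℂ) : lorentzQC 3 y = y 0 ^ 2 - y 1 ^ 2 - y 2 ^ 2 := by
  have : (Finset.univ.filter fun k : Fin 3 => k ≠ 0) = {1, 2} := by decide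
  simp only [lorentzQC, this]
  rw [Finset.sum_pair (by decide)]
  ring

theorem mem_cone {y : V} : y ∈ lightCone 3 ↔ 0 < y 0 ∧ 0 < y 0 ^ 2 - y 1 ^ 2 - y 2 ^ 2 := by
  rw [← lorentzQ_three]; rfl

theorem continuous_lorentzQ : Continuous (lorentzQ 3) := by
  have : lorentzQ 3 = fun y : V => y 0 ^ 2 - y 1 ^ 2 - y 2 ^ 2 := by
    ext y; exact lorentzQ_three y
  rw [this]; fun_prop

theorem isOpen_cone : IsOpen (lightCone 3) :=
  (isOpen_lt continuous_const (continuous_apply 0)).inter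
    (isOpen_lt continuous_const continuous_lorentzQ)

theorem measurableSet_cone : MeasurableSet (lightCone 3) := isOpen_cone.measurableSet

/-- Parameters `(α, τ, β)` of the triangular group acting simply transitively on the cone. -/
abbrev Par := ℝ × ℝ × ℝ

/-- The matrix on `V` of the action `X ↦ g X gᵀ` of the triangular matrix
`g = !![exp α, τ exp β; 0, exp β]` on symmetric matrices. -/
def gMat (g : Par) : Matrix (Fin 3) (Fin 3) ℝ :=
  let p := Real.exp g.1
  let r := Real.exp g.2.2
  let τ := g.2.1
  !![(p ^ 2 + τ ^ 2 * r ^ 2 + r ^ 2) / 2, (p ^ 2 - τ ^ 2 * r ^ 2 - r ^ 2) / 2, p * τ * r;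
     (p ^ 2 + τ ^ 2 * r ^ 2 - r ^ 2) / 2, (p ^ 2 - τ ^ 2 * r ^ 2 + r ^ 2) / 2, p * τ * r;
     τ * r ^ 2, - (τ * r ^ 2), p * r]

/-- The action of the triangular group on `V`. -/
def act (g : Par) (y : V) : V := (gMat g).mulVec y

/-- The transposed action. -/
def actT (g : Par) (ξ : V) : V := (gMat g).transpose.mulVec ξ

/-- The multiplier `exp (α + β)`. -/
def mult (g : Par) : ℝ := Real.exp g.1 * Real.exp g.2.2

theorem mult_pos (g : Par) : 0 < mult g := by unfold mult; positivity

/-- The product of the triangular group in coordinates. -/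
def gmul (g g' : Par) : Par :=
  (g.1 + g'.1, g.2.1 + g'.2.1 * Real.exp (g.1 - g.2.2), g.2.2 + g'.2.2)

/-- The inverse of the triangular group in coordinates. -/
def ginv (g : Par) : Par := (-g.1, - g.2.1 * Real.exp (g.2.2 - g.1), -g.2.2)

section formulas
variable (g : Par) (y : V)

theorem act_zero : act g y 0 =
    (Real.exp g.1 ^ 2 + g.2.1 ^ 2 * Real.exp g.2.2 ^ 2 + Real.exp g.2.2 ^ 2) / 2 * y 0 +
    (Real.exp g.1 ^ 2 - g.2.1 ^ 2 * Real.exp g.2.2 ^ 2 - Real.exp g.2.2 ^ 2) / 2 * y 1 +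
    Real.exp g.1 * g.2.1 * Real.exp g.2.2 * y 2 := by
  simp [act, gMat, Matrix.mulVec, dotProduct, Fin.sum_univ_three]

theorem act_one : act g y 1 =
    (Real.exp g.1 ^ 2 + g.2.1 ^ 2 * Real.exp g.2.2 ^ 2 - Real.exp g.2.2 ^ 2) / 2 * y 0 +
    (Real.exp g.1 ^ 2 - g.2.1 ^ 2 * Real.exp g.2.2 ^ 2 + Real.exp g.2.2 ^ 2) / 2 * y 1 +
    Real.exp g.1 * g.2.1 * Real.exp g.2.2 * y 2 := by
  simp [act, gMat, Matrix.mulVec, dotProduct, Fin.sum_univ_three]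

theorem act_two : act g y 2 =
    g.2.1 * Real.exp g.2.2 ^ 2 * y 0 - g.2.1 * Real.exp g.2.2 ^ 2 * y 1 +
    Real.exp g.1 * Real.exp g.2.2 * y 2 := by
  simp [act, gMat, Matrix.mulVec, dotProduct, Fin.sum_univ_three]
  ring

theorem actT_zero : actT g y 0 =
    (Real.exp g.1 ^ 2 + g.2.1 ^ 2 * Real.exp g.2.2 ^ 2 + Real.exp g.2.2 ^ 2) / 2 * y 0 +
    (Real.exp g.1 ^ 2 + g.2.1 ^ 2 * Real.exp g.2.2 ^ 2 - Real.exp g.2.2 ^ 2) / 2 * y 1 +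
    g.2.1 * Real.exp g.2.2 ^ 2 * y 2 := by
  simp [actT, gMat, Matrix.mulVec, dotProduct, Fin.sum_univ_three]

theorem actT_one : actT g y 1 =
    (Real.exp g.1 ^ 2 - g.2.1 ^ 2 * Real.exp g.2.2 ^ 2 - Real.exp g.2.2 ^ 2) / 2 * y 0 +
    (Real.exp g.1 ^ 2 - g.2.1 ^ 2 * Real.exp g.2.2 ^ 2 + Real.exp g.2.2 ^ 2) / 2 * y 1 -
    g.2.1 * Real.exp g.2.2 ^ 2 * y 2 := by
  simp [actT, gMat, Matrix.mulVec, dotProduct, Fin.sum_univ_three]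
  ring

theorem actT_two : actT g y 2 =
    Real.exp g.1 * g.2.1 * Real.exp g.2.2 * y 0 + Real.exp g.1 * g.2.1 * Real.exp g.2.2 * y 1 +
    Real.exp g.1 * Real.exp g.2.2 * y 2 := by
  simp [actT, gMat, Matrix.mulVec, dotProduct, Fin.sum_univ_three]

theorem pr_act (ξ : V) : pr (act g y) ξ = pr y (actT g ξ) := by
  simp only [pr, act_zero, act_one, act_two, actT_zero, actT_one, actT_two]
  ring

theorem lorentzQ_act : lorentzQ 3 (act g y) = mult g ^ 2 * lorentzQ 3 y := by
  simp only [lorentzQ_three, act_zero, act_one, act_two, mult]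
  ring

theorem lorentzQ_actT : lorentzQ 3 (actT g y) = mult g ^ 2 * lorentzQ 3 y := by
  simp only [lorentzQ_three, actT_zero, actT_one, actT_two, mult]
  ring

theorem lorentzQC_act (x : V) :
    lorentzQC 3 (cpt (act g y) (act g x)) = ((mult g ^ 2 : ℝ) : ℂ) * lorentzQC 3 (cpt y x) := by
  simp only [lorentzQC_three, cpt, act_zero, act_one, act_two, mult]
  push_cast
  ring

theorem exp_sub_mul (a b : ℝ) : Real.exp (a - b) * Real.exp b = Real.exp a := by
  rw [← Real.exp_add]; congr 1; ring

theorem act_gmul (g' : Par) : act (gmul g g') y = act g (act g' y) := by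
  have h := exp_sub_mul g.1 g.2.2
  set E := Real.exp (g.1 - g.2.2)
  ext k
  fin_cases k <;>
  simp only [Fin.zero_eta, Fin.mk_one, Fin.reduceFinMk, act_zero, act_one, act_two, gmul,
    Real.exp_add, ← h] <;> ring

theorem act_zero_par : act (0 : Par) y = y := by
  ext k
  fin_cases k <;> simp [act_zero, act_one, act_two]

theorem gmul_ginv : gmul g (ginv g) = 0 := by
  have h : Real.exp (g.2.2 - g.1) * Real.exp (g.1 - g.2.2) = 1 := by
    rw [← Real.exp_add]; simp
  simp only [gmul, ginv]
  rw [neg_mul, neg_mul, mul_assoc, h]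
  simp

theorem ginv_gmul : gmul (ginv g) g = 0 := by
  simp only [gmul, ginv]
  have : -g.1 - -g.2.2 = g.2.2 - g.1 := by ring
  simp [this]

theorem act_ginv_act : act (ginv g) (act g y) = y := by
  rw [← act_gmul, ginv_gmul, act_zero_par]

theorem act_act_ginv : act g (act (ginv g) y) = y := by
  rw [← act_gmul, gmul_ginv, act_zero_par]

theorem actT_gmul (g' : Par) : actT (gmul g g') y = actT g' (actT g y) := by
  have h := exp_sub_mul g.1 g.2.2
  set E := Real.exp (g.1 - g.2.2)
  ext k
  fin_cases k <;>
  simp only [Fin.zero_eta, Fin.mk_one, Fin.reduceFinMk, actT_zero, actT_one, actT_two, gmul,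
    Real.exp_add, ← h] <;> ring

theorem actT_zero_par : actT (0 : Par) y = y := by
  ext k
  fin_cases k <;> simp [actT_zero, actT_one, actT_two]

theorem actT_ginv_actT : actT (ginv g) (actT g y) = y := by
  rw [← actT_gmul, gmul_ginv, actT_zero_par]

theorem actT_actT_ginv : actT g (actT (ginv g) y) = y := by
  rw [← actT_gmul, ginv_gmul, actT_zero_par]

theorem det_gMat : (gMat g).det = mult g ^ 3 := by
  simp [gMat, Matrix.det_fin_three, mult]
  ring

end formulas

theorem continuous_act (g : Par) : Continuous (act g) := by
  unfold act; fun_prop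

theorem continuous_actT (g : Par) : Continuous (actT g) := by
  unfold actT; fun_prop

theorem act_add (g : Par) (x y : V) : act g (x + y) = act g x + act g y := Matrix.mulVec_add _ _ _
theorem act_sub (g : Par) (x y : V) : act g (x - y) = act g x - act g y := Matrix.mulVec_sub _ _ _

theorem continuous_act_uncurry : Continuous (Function.uncurry act) := by
  refine continuous_pi fun k => ?_
  fin_cases k <;> simp only [Function.uncurry, Fin.zero_eta, Fin.mk_one, Fin.reduceFinMk, act_zero,
    act_one, act_two] <;> fun_prop

theorem pr_comm (y ξ : V) : pr y ξ = pr ξ y := by unfold pr; ring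
theorem pr_add_left (y y' ξ : V) : pr (y + y') ξ = pr y ξ + pr y' ξ := by
  simp [pr]; ring
theorem pr_sub_left (y y' ξ : V) : pr (y - y') ξ = pr y ξ - pr y' ξ := by
  simp [pr]; ring

theorem cone_bounds {y : V} (hy : y ∈ lightCone 3) : |y 1| < y 0 ∧ |y 2| < y 0 := by
  obtain ⟨h0, hQ⟩ := mem_cone.1 hy
  constructor <;> refine abs_lt_of_sq_lt_sq ?_ h0.le <;> nlinarith [sq_nonneg (y 1), sq_nonneg (y 2)]

theorem pr_pos {y ξ : V} (hy : y ∈ lightCone 3) (hξ : ξ ∈ lightCone 3) : 0 < pr y ξ := by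
  obtain ⟨h0, hQ⟩ := mem_cone.1 hy
  obtain ⟨k0, kQ⟩ := mem_cone.1 hξ
  have : |y 1 * ξ 1 + y 2 * ξ 2| < y 0 * ξ 0 := by
    refine abs_lt_of_sq_lt_sq ?_ (by positivity)
    have h1 : (y 1 * ξ 1 + y 2 * ξ 2) ^ 2 ≤ (y 1 ^ 2 + y 2 ^ 2) * (ξ 1 ^ 2 + ξ 2 ^ 2) := by
      nlinarith [sq_nonneg (y 1 * ξ 2 - y 2 * ξ 1)]
    have h2 : (y 1 ^ 2 + y 2 ^ 2) * (ξ 1 ^ 2 + ξ 2 ^ 2) < y 0 ^ 2 * ξ 0 ^ 2 := by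
      apply mul_lt_mul'' <;> nlinarith [sq_nonneg (y 1), sq_nonneg (y 2), sq_nonneg (ξ 1),
        sq_nonneg (ξ 2)]
    nlinarith
  have := (abs_lt.1 this).1
  unfold pr; linarith

/-- The base point of the cone. -/
abbrev e₀ : V := ![1, 0, 0]

theorem e₀_mem : e₀ ∈ lightCone 3 := by
  rw [mem_cone]; simp

theorem pr_e₀ (ξ : V) : pr e₀ ξ = ξ 0 := by simp [pr]

theorem act_mem (g : Par) {y : V} (hy : y ∈ lightCone 3) : act g y ∈ lightCone 3 := by
  obtain ⟨h0, hQ⟩ := mem_cone.1 hy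
  have hb := abs_lt.1 (cone_bounds hy).1
  refine ⟨?_, ?_⟩
  · rw [act_zero]
    have hp := Real.exp_pos g.1
    have hr := Real.exp_pos g.2.2
    set p := Real.exp g.1
    set r := Real.exp g.2.2
    set τ := g.2.1
    have hA : 0 < y 0 + y 1 := by linarith
    have hD : 0 < y 0 - y 1 := by linarith
    have key : 0 < (y 0 + y 1) * (p ^ 2 * (y 0 + y 1) + 2 * p * τ * r * y 2
        + (τ ^ 2 * r ^ 2) * (y 0 - y 1) + r ^ 2 * (y 0 - y 1)) := by
      have h3 : 0 < r ^ 2 * ((y 0 + y 1) * (y 0 - y 1)) := by positivity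
      have h4 : 0 ≤ (τ * r) ^ 2 * (y 0 ^ 2 - y 1 ^ 2 - y 2 ^ 2) := by positivity
      nlinarith [sq_nonneg (p * (y 0 + y 1) + τ * r * y 2)]
    have := (pos_iff_pos_of_mul_pos key).1 hA
    linarith
  · rw [lorentzQ_act]
    have := mult_pos g
    exact mul_pos (by positivity) hy.2

theorem actT_mem (g : Par) {y : V} (hy : y ∈ lightCone 3) : actT g y ∈ lightCone 3 := by
  refine ⟨?_, ?_⟩
  · have h := pr_pos (act_mem g e₀_mem) hy
    rwa [pr_act, pr_e₀] at h
  · rw [lorentzQ_actT]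
    have := mult_pos g
    exact mul_pos (by positivity) hy.2

theorem act_mem_iff (g : Par) {y : V} : act g y ∈ lightCone 3 ↔ y ∈ lightCone 3 := by
  refine ⟨fun h => ?_, act_mem g⟩
  have := act_mem (ginv g) h
  rwa [act_ginv_act] at this

theorem actT_mem_iff (g : Par) {y : V} : actT g y ∈ lightCone 3 ↔ y ∈ lightCone 3 := by
  refine ⟨fun h => ?_, actT_mem g⟩
  have := actT_mem (ginv g) h
  rwa [actT_ginv_actT] at this

theorem act_e₀_zero (g : Par) : act g e₀ 0 =
    (Real.exp g.1 ^ 2 + g.2.1 ^ 2 * Real.exp g.2.2 ^ 2 + Real.exp g.2.2 ^ 2) / 2 := by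
  rw [act_zero]; simp

theorem exists_act_e₀ {y : V} (hy : y ∈ lightCone 3) : ∃ g : Par, act g e₀ = y := by
  obtain ⟨h0, hQ⟩ := mem_cone.1 hy
  have hb := abs_lt.1 (cone_bounds hy).1
  have hD : 0 < y 0 - y 1 := by linarith
  have hs : 0 < (y 0 ^ 2 - y 1 ^ 2 - y 2 ^ 2) / (y 0 - y 1) := by positivity
  have e1 : ∀ x : ℝ, 0 < x → Real.exp (Real.log x / 2) ^ 2 = x := by
    intro x hx
    rw [← Real.exp_nat_mul]
    push_cast
    rw [mul_div_cancel₀ _ two_ne_zero, Real.exp_log hx]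
  refine ⟨(Real.log ((y 0 ^ 2 - y 1 ^ 2 - y 2 ^ 2) / (y 0 - y 1)) / 2, y 2 / (y 0 - y 1),
    Real.log (y 0 - y 1) / 2), ?_⟩
  ext k
  fin_cases k <;> simp only [Fin.zero_eta, Fin.mk_one, Fin.reduceFinMk, act_zero, act_one, act_two,
    e1 _ hs, e1 _ hD] <;> simp <;> field_simp <;> ring

theorem map_actT (g : Par) :
    Measure.map (actT g) volume = ENNReal.ofReal ((mult g ^ 3)⁻¹) • (volume : Measure V) := by
  have hd : (gMat g).transpose.det ≠ 0 := by
    rw [Matrix.det_transpose, det_gMat]; exact (pow_pos (mult_pos g) 3).ne'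
  have h := Real.map_matrix_volume_pi_eq_smul_volume_pi hd
  rw [Matrix.det_transpose, det_gMat, abs_of_pos (inv_pos.2 (pow_pos (mult_pos g) 3))] at h
  exact h

theorem map_act (g : Par) :
    Measure.map (act g) volume = ENNReal.ofReal ((mult g ^ 3)⁻¹) • (volume : Measure V) := by
  have hd : (gMat g).det ≠ 0 := by rw [det_gMat]; exact (pow_pos (mult_pos g) 3).ne'
  have h := Real.map_matrix_volume_pi_eq_smul_volume_pi hd
  rw [det_gMat, abs_of_pos (inv_pos.2 (pow_pos (mult_pos g) 3))] at h
  exact h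

theorem lintegral_comp_act (g : Par) (f : V → ℝ≥0∞) (hf : Measurable f) :
    ∫⁻ x, f (act g x) = ENNReal.ofReal ((mult g ^ 3)⁻¹) * ∫⁻ x, f x := by
  rw [← lintegral_map hf (continuous_act g).measurable, map_act, lintegral_smul_measure, smul_eq_mul]

/-- The action as a homeomorphism. -/
def actHomeo (g : Par) : V ≃ₜ V where
  toFun := act g
  invFun := act (ginv g)
  left_inv := act_ginv_act g
  right_inv := act_act_ginv g
  continuous_toFun := continuous_act g
  continuous_invFun := continuous_act _

/-- The transposed action as a homeomorphism. -/
def actTHomeo (g : Par) : V ≃ₜ V where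
  toFun := actT g
  invFun := actT (ginv g)
  left_inv := actT_ginv_actT g
  right_inv := actT_actT_ginv g
  continuous_toFun := continuous_actT g
  continuous_invFun := continuous_actT _

theorem integral_comp_actT (g : Par) (f : V → ℂ) :
    ∫ x, f (actT g x) = ((mult g ^ 3)⁻¹ : ℝ) • ∫ x, f x := by
  have h := (actTHomeo g).measurableEmbedding.integral_map (μ := volume) f
  have h2 : Measure.map (actTHomeo g) volume = _ := map_actT g
  rw [h2, integral_smul_measure, ENNReal.toReal_ofReal
    (inv_pos.2 (pow_pos (mult_pos g) 3)).le] at h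
  exact h.symm

end ConeBergman

/-! ### Triangular coordinates on the cone -/

namespace ConeBergman

theorem act_e₀_injective : Function.Injective fun g : Par => act g e₀ := by
  rintro ⟨a, t, b⟩ ⟨a', t', b'⟩ h
  have h0 := congrFun h 0
  have h1 := congrFun h 1
  have h2 := congrFun h 2
  simp only [act_zero, act_one, act_two] at h0 h1 h2
  simp at h0 h1 h2
  have hb : Real.exp b ^ 2 = Real.exp b' ^ 2 := by linarith
  have hb' : b = b' := Real.exp_injective
    ((pow_left_inj₀ (Real.exp_pos _).le (Real.exp_pos _).le two_ne_zero).1 hb)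
  subst hb'
  have ht : t = t' := mul_right_cancel₀ (pow_pos (Real.exp_pos b) 2).ne' h2
  subst ht
  have ha : Real.exp a ^ 2 = Real.exp a' ^ 2 := by linarith
  have haa : a = a' := Real.exp_injective
    ((pow_left_inj₀ (Real.exp_pos _).le (Real.exp_pos _).le two_ne_zero).1 ha)
  rw [haa]

/-- The Jacobian matrix of the parametrization of the cone. -/
def jac (θ : V) : Matrix (Fin 3) (Fin 3) ℝ :=
  let p := Real.exp (θ 0)
  let r := Real.exp (θ 2)
  let τ := θ 1
  !![p ^ 2, τ * r ^ 2, (τ ^ 2 + 1) * r ^ 2;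
     p ^ 2, τ * r ^ 2, (τ ^ 2 - 1) * r ^ 2;
     0, r ^ 2, 2 * τ * r ^ 2]

theorem hasFDerivAt_par (θ : V) :
    HasFDerivAt (fun θ : V => act (θ 0, θ 1, θ 2) e₀)
      (LinearMap.toContinuousLinearMap (Matrix.toLin' (jac θ))) θ := by
  have d0 : HasFDerivAt (fun θ : V => θ 0) (ContinuousLinearMap.proj 0 : V →L[ℝ] ℝ) θ :=
    hasFDerivAt_apply 0 θ
  have d1 : HasFDerivAt (fun θ : V => θ 1) (ContinuousLinearMap.proj 1 : V →L[ℝ] ℝ) θ :=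
    hasFDerivAt_apply 1 θ
  have d2 : HasFDerivAt (fun θ : V => θ 2) (ContinuousLinearMap.proj 2 : V →L[ℝ] ℝ) θ :=
    hasFDerivAt_apply 2 θ
  have ep := d0.exp.pow 2
  have er := d2.exp.pow 2
  have et := d1.pow 2
  rw [hasFDerivAt_pi']
  intro k
  fin_cases k
  · simp only [act_zero, Fin.zero_eta]
    have h := (((ep.add (et.mul er)).add er).mul_const ((1 : ℝ) / 2))
    refine (h.congr_fderiv ?_).congr_of_eventuallyEq ?_
    · ext v
      simp [jac, dotProduct, Fin.sum_univ_three]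
      ring
    · refine Filter.Eventually.of_forall fun x => ?_
      simp
      ring
  · simp only [act_one, Fin.mk_one]
    have h := (((ep.add (et.mul er)).sub er).mul_const ((1 : ℝ) / 2))
    refine (h.congr_fderiv ?_).congr_of_eventuallyEq ?_
    · ext v
      simp [jac, dotProduct, Fin.sum_univ_three]
      ring
    · refine Filter.Eventually.of_forall fun x => ?_
      simp
      ring
  · simp only [act_two, Fin.reduceFinMk]
    have h := d1.mul er
    refine (h.congr_fderiv ?_).congr_of_eventuallyEq ?_
    · ext v
      simp [jac, dotProduct, Fin.sum_univ_three]
      ring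
    · refine Filter.Eventually.of_forall fun x => ?_
      simp

theorem abs_det_jac (θ : V) :
    |(LinearMap.toContinuousLinearMap (Matrix.toLin' (jac θ)) : V →L[ℝ] V).det|
      = 2 * Real.exp (2 * θ 0 + 4 * θ 2) := by
  have e1 : Real.exp (2 * θ 0 + 4 * θ 2) = Real.exp (θ 0) ^ 2 * Real.exp (θ 2) ^ 4 := by
    rw [Real.exp_add, ← Real.exp_nat_mul, ← Real.exp_nat_mul]; norm_num
  have : (LinearMap.toContinuousLinearMap (Matrix.toLin' (jac θ)) : V →L[ℝ] V).det
      = 2 * (Real.exp (θ 0) ^ 2 * Real.exp (θ 2) ^ 4) := by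
    rw [ContinuousLinearMap.det, LinearMap.coe_toContinuousLinearMap, LinearMap.det_toLin']
    simp [jac, Matrix.det_fin_three]
    ring
  rw [this, e1, abs_of_pos (by positivity)]

/-- The coordinates of a point of `V` as a triple. -/
def toPar : V ≃ᵐ Par :=
  (MeasurableEquiv.piFinSuccAbove (fun _ => ℝ) 0).trans
    ((MeasurableEquiv.refl ℝ).prodCongr MeasurableEquiv.finTwoArrow)

theorem toPar_apply (θ : V) : toPar θ = (θ 0, θ 1, θ 2) := rfl

theorem measurePreserving_toPar : MeasurePreserving toPar volume volume :=
  ((MeasurePreserving.id volume).prod (volume_preserving_finTwoArrow ℝ)).comp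
    (volume_preserving_piFinSuccAbove (fun _ : Fin 3 => ℝ) 0)

/-- Integration over the cone in triangular coordinates. -/
theorem lintegral_cone (f : V → ℝ≥0∞) :
    ∫⁻ y in lightCone 3, f y =
      ∫⁻ g : Par, ENNReal.ofReal (2 * Real.exp (2 * g.1 + 4 * g.2.2)) * f (act g e₀) := by
  have himg : (fun θ : V => act (θ 0, θ 1, θ 2) e₀) '' univ = lightCone 3 := by
    ext y
    constructor
    · rintro ⟨θ, -, rfl⟩
      exact act_mem _ e₀_mem
    · intro hy
      obtain ⟨⟨a, t, b⟩, rfl⟩ := exists_act_e₀ hy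
      exact ⟨![a, t, b], mem_univ _, by simp⟩
  have hinj : InjOn (fun θ : V => act (θ 0, θ 1, θ 2) e₀) univ := by
    intro θ _ θ' _ h
    have := act_e₀_injective h
    simp only [Prod.mk.injEq] at this
    ext k; fin_cases k <;> simp [this]
  have h := lintegral_image_eq_lintegral_abs_det_fderiv_mul volume MeasurableSet.univ
    (fun θ _ => (hasFDerivAt_par θ).hasFDerivWithinAt) hinj f
  rw [himg] at h
  rw [h, Measure.restrict_univ]
  rw [← (measurePreserving_toPar).lintegral_comp_emb toPar.measurableEmbedding]
  simp only [toPar_apply, abs_det_jac]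

end ConeBergman

/-! ### Integrals over the cone -/

namespace ConeBergman

theorem neg_mul_exp_le {c θ : ℝ} (hc : 0 < c) (hθ : 0 ≤ θ) :
    ∃ K : ℝ, ∀ x : ℝ, -(c * Real.exp (2 * x)) ≤ K - 2 * θ * x := by
  rcases hθ.eq_or_lt with rfl | hθ
  · refine ⟨0, fun x => ?_⟩
    have := Real.exp_pos (2 * x)
    have : 0 ≤ c * Real.exp (2 * x) := by positivity
    linarith
  · refine ⟨θ * Real.log θ - θ * Real.log c - θ, fun x => ?_⟩
    have hu : 0 < c * Real.exp (2 * x) := by positivity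
    have h := Real.log_le_sub_one_of_pos (div_pos hu hθ)
    rw [Real.log_div hu.ne' hθ.ne', Real.log_mul hc.ne' (Real.exp_pos _).ne', Real.log_exp] at h
    have h2 := mul_le_mul_of_nonneg_left h hθ.le
    have h3 : θ * (c * Real.exp (2 * x) / θ - 1) = c * Real.exp (2 * x) - θ := by field_simp
    rw [h3] at h2
    nlinarith

theorem mul_sub_mul_exp_le {c a : ℝ} (hc : 0 < c) (ha : 0 < a) :
    ∃ K : ℝ, ∀ x : ℝ, a * x - c * Real.exp (2 * x) ≤ K - a * |x| := by
  obtain ⟨K, hK⟩ := neg_mul_exp_le hc ha.le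
  refine ⟨max K 0, fun x => ?_⟩
  rcases le_total 0 x with hx | hx
  · rw [abs_of_nonneg hx]
    have := hK x
    have := le_max_left K 0
    linarith
  · rw [abs_of_nonpos hx]
    have : 0 ≤ c * Real.exp (2 * x) := by positivity
    have := le_max_right K 0
    linarith

theorem integrable_exp_neg_mul_abs {a : ℝ} (ha : 0 < a) :
    Integrable fun x : ℝ => Real.exp (-(a * |x|)) := by
  rw [← integrableOn_univ, ← Iic_union_Ioi (a := (0 : ℝ))]
  refine IntegrableOn.union ?_ ?_
  · refine (integrableOn_exp_mul_Iic ha 0).congr_fun (fun x hx => ?_) measurableSet_Iic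
    simp only [abs_of_nonpos (mem_Iic.1 hx)]
    congr 1; ring
  · refine (integrableOn_exp_mul_Ioi (neg_lt_zero.2 ha) 0).congr_fun (fun x hx => ?_)
      measurableSet_Ioi
    simp only [abs_of_pos (mem_Ioi.1 hx)]
    congr 1; ring

theorem lintegral_exp_neg_mul_abs_lt_top {a : ℝ} (ha : 0 < a) (K : ℝ) :
    ∫⁻ x : ℝ, ENNReal.ofReal (Real.exp (K - a * |x|)) < ∞ := by
  have h := ((integrable_exp_neg_mul_abs ha).const_mul (Real.exp K)).lintegral_lt_top
  simpa only [← Real.exp_add, ← sub_eq_add_neg] using h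

theorem lintegral_gaussian {b : ℝ} (hb : 0 < b) :
    ∫⁻ x : ℝ, ENNReal.ofReal (Real.exp (-b * x ^ 2)) = ENNReal.ofReal √(Real.pi / b) := by
  rw [← integral_gaussian b, ofReal_integral_eq_lintegral_ofReal (integrable_exp_neg_mul_sq hb)
    (Filter.Eventually.of_forall fun x => (Real.exp_pos _).le)]

/-- A Gamma type integral in triangular coordinates. -/
theorem lintegral_par_lt_top {c a b : ℝ} (hc : 0 < c) (ha : 0 < a) (hb : 1 < b) :
    ∫⁻ g : Par, ENNReal.ofReal (Real.exp (a * g.1 + b * g.2.2 - c * act g e₀ 0)) < ∞ := by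
  have hc2 : 0 < c / 2 := by positivity
  have hb1 : 0 < b - 1 := by linarith
  obtain ⟨K, hK⟩ := mul_sub_mul_exp_le hc2 ha
  obtain ⟨K', hK'⟩ := mul_sub_mul_exp_le hc2 hb1
  have hsq : ∀ x : ℝ, Real.exp x ^ 2 = Real.exp (2 * x) := fun x => by
    rw [← Real.exp_nat_mul]; norm_num
  have hle : ∀ g : Par, ENNReal.ofReal (Real.exp (a * g.1 + b * g.2.2 - c * act g e₀ 0)) ≤
      ENNReal.ofReal (Real.exp (K - a * |g.1|)) *
      (ENNReal.ofReal (Real.exp (K' - (b - 1) * |g.2.2|)) *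
        (ENNReal.ofReal (Real.exp g.2.2) *
        ENNReal.ofReal (Real.exp (-(c / 2 * Real.exp (2 * g.2.2)) * g.2.1 ^ 2)))) := by
    intro g
    rw [← ENNReal.ofReal_mul (Real.exp_pos _).le, ← ENNReal.ofReal_mul (Real.exp_pos _).le,
      ← ENNReal.ofReal_mul (Real.exp_pos _).le, ← Real.exp_add, ← Real.exp_add, ← Real.exp_add]
    apply ENNReal.ofReal_le_ofReal
    apply Real.exp_le_exp.2
    rw [act_e₀_zero, hsq, hsq]
    have := hK g.1
    have := hK' g.2.2
    linarith
  refine (lintegral_mono hle).trans_lt ?_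
  rw [show (volume : Measure Par) = (volume : Measure ℝ).prod (volume : Measure (ℝ × ℝ)) from rfl]
  rw [lintegral_prod_mul (f := fun x : ℝ => ENNReal.ofReal (Real.exp (K - a * |x|)))
    (g := fun y : ℝ × ℝ => ENNReal.ofReal (Real.exp (K' - (b - 1) * |y.2|)) *
        (ENNReal.ofReal (Real.exp y.2) *
        ENNReal.ofReal (Real.exp (-(c / 2 * Real.exp (2 * y.2)) * y.1 ^ 2))))
        (by fun_prop) (by fun_prop)]
  refine ENNReal.mul_lt_top (lintegral_exp_neg_mul_abs_lt_top ha K) ?_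
  rw [show (volume : Measure (ℝ × ℝ)) = (volume : Measure ℝ).prod (volume : Measure ℝ) from rfl]
  rw [lintegral_prod_symm _ (by fun_prop)]
  have hin : ∀ y : ℝ, ∫⁻ x : ℝ, ENNReal.ofReal (Real.exp (K' - (b - 1) * |y|)) *
        (ENNReal.ofReal (Real.exp y) *
        ENNReal.ofReal (Real.exp (-(c / 2 * Real.exp (2 * y)) * x ^ 2)))
      = ENNReal.ofReal (√(Real.pi / (c / 2))) *
        ENNReal.ofReal (Real.exp (K' - (b - 1) * |y|)) := by
    intro y
    rw [lintegral_const_mul _ (by fun_prop), lintegral_const_mul _ (by fun_prop),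
      lintegral_gaussian (by positivity), mul_comm]
    congr 1
    rw [← ENNReal.ofReal_mul (Real.exp_pos _).le]
    congr 1
    rw [← hsq, ← div_div, Real.sqrt_div (by positivity), Real.sqrt_sq (Real.exp_pos _).le]
    field_simp
  simp only [hin]
  rw [lintegral_const_mul _ (by fun_prop)]
  exact ENNReal.mul_lt_top ENNReal.ofReal_lt_top (lintegral_exp_neg_mul_abs_lt_top hb1 K')

theorem act_mult_e₀ (g : Par) : lorentzQ 3 (act g e₀) = mult g ^ 2 := by
  rw [lorentzQ_act, lorentzQ_three]; simp

theorem mult_rpow (g : Par) (s : ℝ) : (mult g ^ 2) ^ s = Real.exp (2 * s * g.1 + 2 * s * g.2.2) := by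
  rw [mult, ← Real.exp_add, ← Real.exp_nat_mul, ← Real.exp_mul]
  congr 1; push_cast; ring

/-- Integration over the cone against a power of the Lorentz form. -/
theorem lintegral_cone_rpow (f : V → ℝ≥0∞) (s : ℝ) :
    ∫⁻ y in lightCone 3, f y * ENNReal.ofReal (lorentzQ 3 y ^ s) =
      2 * ∫⁻ g : Par, f (act g e₀) *
        ENNReal.ofReal (Real.exp ((2 * s + 2) * g.1 + (2 * s + 4) * g.2.2)) := by
  rw [lintegral_cone, ← lintegral_const_mul' _ _ ENNReal.ofNat_ne_top]
  refine lintegral_congr fun g => ?_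
  rw [act_mult_e₀, mult_rpow, ENNReal.ofReal_mul (by norm_num), ENNReal.ofReal_ofNat]
  rw [show (2 * s + 2) * g.1 + (2 * s + 4) * g.2.2
    = (2 * g.1 + 4 * g.2.2) + (2 * s * g.1 + 2 * s * g.2.2) by ring, Real.exp_add (2 * g.1 + _),
    ENNReal.ofReal_mul (Real.exp_pos _).le]
  ring

theorem lintegral_cone_exp_lt_top {c s : ℝ} (hc : 0 < c) (hs : -1 < s) :
    ∫⁻ y in lightCone 3, ENNReal.ofReal (Real.exp (-(c * y 0))) *
      ENNReal.ofReal (lorentzQ 3 y ^ s) < ∞ := by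
  rw [lintegral_cone_rpow]
  refine ENNReal.mul_lt_top ENNReal.ofNat_lt_top ?_
  refine lt_of_eq_of_lt (lintegral_congr fun g => ?_) (lintegral_par_lt_top (a := 2 * s + 2)
    (b := 2 * s + 4) hc (by linarith) (by linarith))
  rw [← ENNReal.ofReal_mul (Real.exp_pos _).le, ← Real.exp_add]
  congr 2; ring

end ConeBergman

/-! ### The Laplace representation of powers of the Lorentz form -/

namespace ConeBergman

/-- The Laplace weight `1_Λ(ξ) Q(ξ)^s exp (-(y|ξ))`. -/
def lapW (s : ℝ) (y ξ : V) : ℝ :=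
  (lightCone 3).indicator (fun ξ => lorentzQ 3 ξ ^ s * Real.exp (-pr y ξ)) ξ

theorem lapW_nonneg (s : ℝ) (y ξ : V) : 0 ≤ lapW s y ξ := by
  unfold lapW
  refine indicator_nonneg (fun x hx => ?_) _
  exact mul_nonneg (Real.rpow_nonneg hx.2.le _) (Real.exp_pos _).le

theorem measurable_lapW (s : ℝ) (y : V) : Measurable (lapW s y) := by
  refine Measurable.indicator ?_ measurableSet_cone
  have := continuous_lorentzQ.measurable
  unfold pr
  fun_prop

theorem lapW_act (s : ℝ) (g : Par) (ξ : V) :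
    lapW s (act g e₀) ξ = (mult g ^ 2) ^ (-s) * lapW s e₀ (actT g ξ) := by
  unfold lapW
  by_cases hξ : ξ ∈ lightCone 3
  · rw [indicator_of_mem hξ, indicator_of_mem (actT_mem g hξ), lorentzQ_actT, pr_act,
      Real.mul_rpow (by positivity) hξ.2.le, Real.rpow_neg (by positivity)]
    have := mult_pos g
    have : 0 < (mult g ^ 2) ^ s := by positivity
    field_simp
  · rw [indicator_of_notMem hξ, indicator_of_notMem (fun h => hξ ((actT_mem_iff g).1 h)), mul_zero]

theorem integrable_lapW_e₀ {s : ℝ} (hs : -1 < s) : Integrable (lapW s e₀) := by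
  refine ⟨(measurable_lapW s e₀).aestronglyMeasurable, ?_⟩
  rw [hasFiniteIntegral_iff_ofReal (Filter.Eventually.of_forall (lapW_nonneg s e₀))]
  have h := lintegral_cone_exp_lt_top (c := 1) one_pos hs
  rw [← lintegral_indicator measurableSet_cone] at h
  refine lt_of_eq_of_lt (lintegral_congr fun ξ => ?_) h
  unfold lapW
  by_cases hξ : ξ ∈ lightCone 3
  · simp only [indicator_of_mem hξ]
    rw [ENNReal.ofReal_mul (Real.rpow_nonneg hξ.2.le _), mul_comm, pr_e₀, one_mul]
  · simp [indicator_of_notMem hξ]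

theorem integrable_lapW {s : ℝ} (hs : -1 < s) {y : V} (hy : y ∈ lightCone 3) :
    Integrable (lapW s y) := by
  obtain ⟨g, rfl⟩ := exists_act_e₀ hy
  rw [show lapW s (act g e₀) = _ from funext (lapW_act s g)]
  refine Integrable.const_mul ?_ _
  have h := (actTHomeo g).measurableEmbedding.integrable_map_iff (μ := volume) (g := lapW s e₀)
  have h2 : Measure.map (actTHomeo g) volume = _ := map_actT g
  rw [h2] at h
  exact h.1 ((integrable_lapW_e₀ hs).smul_measure ENNReal.ofReal_ne_top)

/-- The normalizing constant of the Laplace transform. -/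
def lapC (s : ℝ) : ℝ := ∫ ξ, lapW s e₀ ξ

theorem lapC_pos {s : ℝ} (hs : -1 < s) : 0 < lapC s := by
  unfold lapC
  rw [integral_pos_iff_support_of_nonneg (lapW_nonneg s e₀) (integrable_lapW_e₀ hs)]
  refine lt_of_lt_of_le (isOpen_cone.measure_pos volume ⟨e₀, e₀_mem⟩) (measure_mono fun ξ hξ => ?_)
  rw [Function.mem_support, lapW, indicator_of_mem hξ]
  exact (mul_pos (Real.rpow_pos_of_pos hξ.2 _) (Real.exp_pos _)).ne'

theorem integral_lapW {s : ℝ} {y : V} (hy : y ∈ lightCone 3) :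
    ∫ ξ, lapW s y ξ = lapC s * lorentzQ 3 y ^ (-(s + 3 / 2)) := by
  obtain ⟨g, rfl⟩ := exists_act_e₀ hy
  simp_rw [lapW_act, integral_const_mul]
  have h := (actTHomeo g).measurableEmbedding.integral_map (μ := volume) (lapW s e₀)
  have h2 : Measure.map (actTHomeo g) volume = _ := map_actT g
  rw [h2, integral_smul_measure, ENNReal.toReal_ofReal
    (inv_pos.2 (pow_pos (mult_pos g) 3)).le] at h
  have h3 : ∫ ξ, lapW s e₀ (actT g ξ) = (mult g ^ 3)⁻¹ • ∫ ξ, lapW s e₀ ξ := h.symm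
  rw [h3, act_mult_e₀, lapC, smul_eq_mul]
  have hm := mult_pos g
  rw [show -(s + 3 / 2) = -s + (-(3 / 2)) by ring, Real.rpow_add (by positivity)]
  have : (mult g ^ 2) ^ (-(3 / 2 : ℝ)) = (mult g ^ 3)⁻¹ := by
    rw [← Real.rpow_natCast, ← Real.rpow_mul hm.le, ← Real.rpow_natCast, ← Real.rpow_neg hm.le]
    norm_num
  rw [this]; ring

theorem lorentzQC_cpt_mem_slitPlane {y : V} (hy : y ∈ lightCone 3) (x : V) :
    lorentzQC 3 (cpt y x) ∈ slitPlane := by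
  obtain ⟨h0, hQ⟩ := mem_cone.1 hy
  have e : lorentzQC 3 (cpt y x) =
      ((y 0 ^ 2 - y 1 ^ 2 - y 2 ^ 2 - (x 0 ^ 2 - x 1 ^ 2 - x 2 ^ 2) : ℝ) : ℂ) +
      ((-2 * (y 0 * x 0 - y 1 * x 1 - y 2 * x 2) : ℝ) : ℂ) * I := by
    rw [lorentzQC_three]
    simp only [cpt]
    push_cast
    have := I_sq
    linear_combination ((x 0 : ℂ) ^ 2 - (x 1 : ℂ) ^ 2 - (x 2 : ℂ) ^ 2) * this
  rw [e, mem_slitPlane_iff]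
  by_cases him : y 0 * x 0 - y 1 * x 1 - y 2 * x 2 = 0
  · left
    simp only [add_re, ofReal_re, mul_re, I_re, mul_zero, ofReal_im, I_im, mul_one, sub_self,
      add_zero]
    have h1 : (y 1 * x 1 + y 2 * x 2) ^ 2 ≤ (y 1 ^ 2 + y 2 ^ 2) * (x 1 ^ 2 + x 2 ^ 2) := by
      nlinarith [sq_nonneg (y 1 * x 2 - y 2 * x 1)]
    have h2 : (y 1 ^ 2 + y 2 ^ 2) * (x 1 ^ 2 + x 2 ^ 2) ≤ y 0 ^ 2 * (x 1 ^ 2 + x 2 ^ 2) := by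
      gcongr; linarith
    have h3 : y 0 ^ 2 * x 0 ^ 2 ≤ y 0 ^ 2 * (x 1 ^ 2 + x 2 ^ 2) := by
      rw [← mul_pow, show y 0 * x 0 = y 1 * x 1 + y 2 * x 2 by linarith]; linarith
    have h4 := le_of_mul_le_mul_left h3 (by positivity)
    linarith
  · right
    rw [add_im, ofReal_im, zero_add, im_ofReal_mul, I_im, mul_one]
    simpa using him

/-- The Laplace transform of `1_Λ Q^s` is a multiple of a power of the Lorentz form. -/
theorem integral_lapW_cexp {s : ℝ} (hs : -1 < s) {y : V} (hy : y ∈ lightCone 3) (x : V) :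
    ∫ ξ, (lapW s y ξ : ℂ) * cexp ((pr x ξ : ℂ) * I) =
      (lapC s : ℂ) * lorentzQC 3 (cpt y x) ^ ((-(s + 3 / 2) : ℝ) : ℂ) := by
  set μ : Measure V := volume.withDensity fun ξ => ENNReal.ofReal (lapW s y ξ) with hμ
  have hmeas : Measurable fun ξ => ENNReal.ofReal (lapW s y ξ) :=
    (measurable_lapW s y).ennreal_ofReal
  have htr : ∀ ξ, (ENNReal.ofReal (lapW s y ξ)).toReal = lapW s y ξ := fun ξ =>
    ENNReal.toReal_ofReal (lapW_nonneg s y ξ)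
  have hW : ∀ (t : ℝ) (ξ : V), lapW s y ξ * Real.exp (t * pr x ξ) = lapW s (y - t • x) ξ := by
    intro t ξ
    unfold lapW
    by_cases hξ : ξ ∈ lightCone 3
    · rw [indicator_of_mem hξ, indicator_of_mem hξ, mul_assoc, ← Real.exp_add]
      congr 2; simp [pr]; ring
    · simp [indicator_of_notMem hξ]
  obtain ⟨δ, hδ, hball⟩ : ∃ δ > 0, ∀ t : ℝ, |t| < δ → y - t • x ∈ lightCone 3 := by
    have hc : Continuous fun t : ℝ => y - t • x := by fun_prop
    have ho := isOpen_cone.preimage hc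
    obtain ⟨δ, hδ, h⟩ := Metric.isOpen_iff.1 ho 0 (by simpa using hy)
    exact ⟨δ, hδ, fun t ht => h (by simpa using ht)⟩
  have hset : ∀ t : ℝ, |t| < δ → t ∈ ProbabilityTheory.integrableExpSet (pr x) μ := by
    intro t ht
    rw [ProbabilityTheory.integrableExpSet, mem_ofPred_eq, hμ,
      integrable_withDensity_iff_integrable_smul' hmeas
      (Filter.Eventually.of_forall fun _ => ENNReal.ofReal_lt_top)]
    simp only [htr, smul_eq_mul, hW]
    exact integrable_lapW hs (hball t ht)
  set U : Set ℂ := {z | |z.re| < δ} with hU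
  have hUo : IsOpen U := isOpen_lt (continuous_re.abs) continuous_const
  have hUc : IsPreconnected U := by
    have : U = re ⁻¹' (Ioo (-δ) δ) := by ext z; simp [hU, abs_lt]
    rw [this]
    exact ((convex_Ioo _ _).linear_preimage reLm).isPreconnected
  set f : ℂ → ℂ := ProbabilityTheory.complexMGF (pr x) μ
  set G : ℂ → Fin 3 → ℂ := fun z k => (y k : ℂ) - (x k : ℂ) * z
  have hGz : ∀ z, G z = cpt (y - z.re • x) (z.im • x) := by
    intro z; ext k
    simp only [G, cpt, Pi.sub_apply, Pi.smul_apply, smul_eq_mul]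
    conv_lhs => rw [← re_add_im z]
    push_cast; ring
  set g : ℂ → ℂ := fun z => (lapC s : ℂ) * lorentzQC 3 (G z) ^ ((-(s + 3 / 2) : ℝ) : ℂ)
  have hf : AnalyticOnNhd ℂ f U := by
    refine ProbabilityTheory.analyticOnNhd_complexMGF.mono fun z hz => ?_
    refine mem_interior.2 ⟨{t | |t| < δ}, fun t ht => hset t ht,
      isOpen_lt continuous_abs continuous_const, hz⟩
  have hg : AnalyticOnNhd ℂ g U := by
    refine DifferentiableOn.analyticOnNhd (fun z hz => ?_) hUo
    refine DifferentiableAt.differentiableWithinAt ?_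
    refine DifferentiableAt.const_mul (DifferentiableAt.cpow ?_ (by fun_prop) ?_) _
    · simp only [lorentzQC_three, G]; fun_prop
    · rw [hGz]; exact lorentzQC_cpt_mem_slitPlane (hball _ hz) _
  have hreal : ∀ t : ℝ, |t| < δ → f t = g t := by
    intro t ht
    have h1 : f t = ∫ ξ, ((lapW s (y - t • x) ξ : ℝ) : ℂ) := by
      simp only [f, ProbabilityTheory.complexMGF, hμ]
      rw [integral_withDensity_eq_integral_toReal_smul hmeas
        (Filter.Eventually.of_forall fun _ => ENNReal.ofReal_lt_top)]
      refine integral_congr_ae (Filter.Eventually.of_forall fun ξ => ?_)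
      simp only [htr, ← hW]
      push_cast
      rfl
    rw [h1, integral_complex_ofReal, integral_lapW (hball t ht)]
    simp only [g, hGz]
    have h2 : lorentzQC 3 (cpt (y - (t : ℂ).re • x) ((t : ℂ).im • x))
        = ((lorentzQ 3 (y - t • x) : ℝ) : ℂ) := by
      simp [lorentzQC_three, lorentzQ_three, cpt]
    rw [h2, ← ofReal_cpow (hball t ht).2.le]
    push_cast; rfl
  have hfreq : ∃ᶠ z in nhdsWithin (0 : ℂ) {0}ᶜ, f z = g z := by
    have ht : Filter.Tendsto (fun t : ℝ => (t : ℂ)) (nhdsWithin 0 {0}ᶜ) (nhdsWithin 0 {0}ᶜ) := by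
      refine tendsto_nhdsWithin_iff.2 ⟨?_, ?_⟩
      · exact (continuous_ofReal.tendsto' 0 0 (by simp)).mono_left nhdsWithin_le_nhds
      · filter_upwards [self_mem_nhdsWithin] with t ht
        simpa using ht
    refine ht.frequently (Filter.Eventually.frequently ?_)
    refine Filter.Eventually.filter_mono nhdsWithin_le_nhds ?_
    filter_upwards [Metric.ball_mem_nhds (0 : ℝ) hδ] with t ht
    exact hreal t (by simpa using ht)
  have key := hf.eqOn_of_preconnected_of_frequently_eq hg hUc (z₀ := 0) (by simpa [hU] using hδ)
    hfreq (show I ∈ U by simpa [hU] using hδ)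
  have e1 : f I = ∫ ξ, (lapW s y ξ : ℂ) * cexp ((pr x ξ : ℂ) * I) := by
    simp only [f, ProbabilityTheory.complexMGF, hμ]
    rw [integral_withDensity_eq_integral_toReal_smul hmeas
        (Filter.Eventually.of_forall fun _ => ENNReal.ofReal_lt_top)]
    refine integral_congr_ae (Filter.Eventually.of_forall fun ξ => ?_)
    simp only [htr, mul_comm I]
    rfl
  rw [← e1, key]
  simp only [g, hGz]
  simp

end ConeBergman

/-! ### The partition of unity -/

namespace ConeBergman

open Real (smoothTransition)

/-- A smooth bump function whose integer translates form a partition of unity. -/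
def bump (x : ℝ) : ℝ := smoothTransition (x + 1) - smoothTransition x

theorem contDiff_bump {n : ℕ∞} : ContDiff ℝ n bump :=
  (Real.smoothTransition.contDiff.comp (contDiff_id.add contDiff_const)).sub
    Real.smoothTransition.contDiff

theorem bump_eq_zero {x : ℝ} (h : 1 ≤ |x|) : bump x = 0 := by
  unfold bump
  rcases le_abs.1 h with h | h
  · rw [Real.smoothTransition.one_of_one_le (by linarith),
      Real.smoothTransition.one_of_one_le h, sub_self]
  · rw [Real.smoothTransition.zero_of_nonpos (by linarith),
      Real.smoothTransition.zero_of_nonpos (by linarith), sub_self]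

theorem abs_le_of_bump_ne_zero {x : ℝ} (h : bump x ≠ 0) : |x| ≤ 1 := by
  by_contra! h'
  exact h (bump_eq_zero h'.le)

theorem bump_nonneg (x : ℝ) : 0 ≤ bump x := by
  unfold bump
  rcases le_total x 0 with h | h
  · rw [Real.smoothTransition.zero_of_nonpos h, sub_zero]
    exact Real.smoothTransition.nonneg _
  · rw [Real.smoothTransition.one_of_one_le (by linarith : (1:ℝ) ≤ x + 1)]
    linarith [Real.smoothTransition.le_one x]

theorem hasSum_bump (x : ℝ) : HasSum (fun l : ℤ => bump (x - l)) 1 := by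
  have hz : ∀ l ∉ ({⌊x⌋, ⌊x⌋ + 1} : Finset ℤ), bump (x - l) = 0 := by
    intro l hl
    simp only [Finset.mem_insert, Finset.mem_singleton, not_or] at hl
    apply bump_eq_zero
    have h1 := Int.floor_le x
    have h2 := Int.lt_floor_add_one x
    rcases lt_or_gt_of_ne hl.1 with h | h
    · have : (l:ℝ) + 1 ≤ ⌊x⌋ := by exact_mod_cast h
      exact le_abs.2 (Or.inl (by linarith))
    · have h3 : ⌊x⌋ + 2 ≤ l := by omega
      have : (⌊x⌋:ℝ) + 2 ≤ l := by exact_mod_cast h3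
      exact le_abs.2 (Or.inr (by linarith))
  have h : HasSum (fun l : ℤ => bump (x - l)) _ := hasSum_sum_of_ne_finset_zero hz
  rw [Finset.sum_pair (by simp)] at h
  convert h using 1
  unfold bump
  have h1 := Int.floor_le x
  have h2 := Int.lt_floor_add_one x
  rw [Real.smoothTransition.one_of_one_le (by linarith : (1:ℝ) ≤ x - ⌊x⌋ + 1),
    Real.smoothTransition.zero_of_nonpos (by push_cast; linarith : x - ((⌊x⌋ + 1 : ℤ):ℝ) ≤ 0)]
  have : x - ((⌊x⌋ + 1 : ℤ):ℝ) + 1 = x - ⌊x⌋ := by push_cast; ring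
  rw [this]; ring

/-- The first light-ray coordinate. -/
def ca (ξ : V) : ℝ := (ξ 0 + ξ 1) / 2
/-- The second light-ray coordinate. -/
def cd (ξ : V) : ℝ := (ξ 0 - ξ 1) / 2
/-- The transversal coordinate. -/
def cb (ξ : V) : ℝ := ξ 2 / 2
/-- The slope coordinate on the cone. -/
def ct (ξ : V) : ℝ := cb ξ / ca ξ
/-- The defect coordinate on the cone. -/
def cs (ξ : V) : ℝ := cd ξ - cb ξ ^ 2 / ca ξ

theorem ca_pos {ξ : V} (h : ξ ∈ lightCone 3) : 0 < ca ξ := by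
  have := (cone_bounds h).1
  rw [abs_lt] at this
  unfold ca; linarith

theorem lorentzQ_eq_ca_cs {ξ : V} (h : ca ξ ≠ 0) : lorentzQ 3 ξ = 4 * ca ξ * cs ξ := by
  rw [lorentzQ_three, cs]
  field_simp
  unfold ca cb cd; ring

theorem cs_pos {ξ : V} (h : ξ ∈ lightCone 3) : 0 < cs ξ := by
  have h1 := ca_pos h
  have h2 := h.2
  rw [lorentzQ_eq_ca_cs h1.ne'] at h2
  exact pos_of_mul_pos_right h2 (by positivity)

theorem ca_actT (g : Par) (ξ : V) : ca (actT g ξ) = Real.exp g.1 ^ 2 * ca ξ := by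
  unfold ca; rw [actT_zero, actT_one]; ring

theorem cb_actT (g : Par) (ξ : V) :
    cb (actT g ξ) = Real.exp g.1 * Real.exp g.2.2 * (cb ξ + g.2.1 * ca ξ) := by
  unfold ca cb; rw [actT_two]; ring

theorem cd_actT (g : Par) (ξ : V) :
    cd (actT g ξ) = Real.exp g.2.2 ^ 2 * (cd ξ + 2 * g.2.1 * cb ξ + g.2.1 ^ 2 * ca ξ) := by
  unfold ca cb cd; rw [actT_zero, actT_one]; ring

theorem ct_actT (g : Par) {ξ : V} (h : ξ ∈ lightCone 3) :
    ct (actT g ξ) = Real.exp (g.2.2 - g.1) * (ct ξ + g.2.1) := by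
  have := ca_pos h
  rw [ct, ca_actT, cb_actT, Real.exp_sub, ct]
  field_simp

theorem cs_actT (g : Par) {ξ : V} (h : ξ ∈ lightCone 3) :
    cs (actT g ξ) = Real.exp g.2.2 ^ 2 * cs ξ := by
  have := ca_pos h
  rw [cs, ca_actT, cb_actT, cd_actT, cs]
  field_simp; ring

/-- The basic cutoff in the cone. -/
def chi (h : ℝ) : V → ℝ := (lightCone 3).indicator fun ξ =>
  bump (Real.log (ca ξ) / (2 * h)) * bump (Real.log (cs ξ) / 2) * bump (ct ξ)

theorem chi_nonneg (h : ℝ) (ξ : V) : 0 ≤ chi h ξ :=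
  indicator_nonneg (fun _ _ => mul_nonneg (mul_nonneg (bump_nonneg _) (bump_nonneg _))
    (bump_nonneg _)) ξ

/-- A compact subset of the cone containing the support of the basic cutoff. -/
def chiSupp (h : ℝ) : Set V := (fun w : ℝ × ℝ × ℝ =>
    (![w.1 + w.2.2 + w.1 * w.2.1 ^ 2, w.1 - w.2.2 - w.1 * w.2.1 ^ 2, 2 * w.1 * w.2.1] : V)) ''
  (Icc (Real.exp (-(2 * h))) (Real.exp (2 * h)) ×ˢ Icc (-1) 1 ×ˢ Icc (Real.exp (-2)) (Real.exp 2))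

theorem isCompact_chiSupp (h : ℝ) : IsCompact (chiSupp h) := by
  refine (isCompact_Icc.prod (isCompact_Icc.prod isCompact_Icc)).image ?_
  refine continuous_pi fun i => ?_
  fin_cases i <;> simp <;> fun_prop

theorem chiSupp_subset (h : ℝ) : chiSupp h ⊆ lightCone 3 := by
  rintro _ ⟨⟨a, t, s⟩, ⟨⟨h1, -⟩, -, h3, -⟩, rfl⟩
  have ha : 0 < a := (Real.exp_pos _).trans_le h1
  have hs : 0 < s := (Real.exp_pos _).trans_le h3
  rw [mem_cone]
  constructor
  · simp; positivity
  · simp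
    have : 0 < 4 * (a * s) := by positivity
    nlinarith

theorem chi_bounds {h : ℝ} (hh : 0 < h) {ξ : V} (hξ : chi h ξ ≠ 0) : ξ ∈ lightCone 3 ∧
    ca ξ ∈ Icc (Real.exp (-(2 * h))) (Real.exp (2 * h)) ∧ ct ξ ∈ Icc (-1) 1 ∧
    cs ξ ∈ Icc (Real.exp (-2)) (Real.exp 2) := by
  have hc : ξ ∈ lightCone 3 := by
    by_contra hn
    exact hξ (indicator_of_notMem hn _)
  rw [chi, indicator_of_mem hc] at hξ
  have h3 := abs_le_of_bump_ne_zero (right_ne_zero_of_mul hξ)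
  have h12 := left_ne_zero_of_mul hξ
  have h1 := abs_le_of_bump_ne_zero (left_ne_zero_of_mul h12)
  have h2 := abs_le_of_bump_ne_zero (right_ne_zero_of_mul h12)
  rw [abs_le, le_div_iff₀ (by positivity), div_le_iff₀ (by positivity)] at h1 h2
  refine ⟨hc, ⟨?_, ?_⟩, abs_le.1 h3, ?_, ?_⟩
  · rw [← Real.le_log_iff_exp_le (ca_pos hc)]; linarith
  · rw [← Real.log_le_iff_le_exp (ca_pos hc)]; linarith
  · rw [← Real.le_log_iff_exp_le (cs_pos hc)]; linarith
  · rw [← Real.log_le_iff_le_exp (cs_pos hc)]; linarith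

theorem support_chi_subset {h : ℝ} (hh : 0 < h) : Function.support (chi h) ⊆ chiSupp h := by
  intro ξ hξ
  obtain ⟨hc, h1, h2, h3⟩ := chi_bounds hh hξ
  refine ⟨(ca ξ, ct ξ, cs ξ), ⟨h1, h2, h3⟩, ?_⟩
  have := ca_pos hc
  have e1 : cs ξ + ca ξ * ct ξ ^ 2 = cd ξ := by unfold cs ct; field_simp; ring
  have e2 : ca ξ * ct ξ = cb ξ := by unfold ct; field_simp
  ext i
  fin_cases i
  · simp; rw [add_assoc, e1]; unfold ca cd; ring
  · simp; rw [sub_sub, e1]; unfold ca cd; ring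
  · simp; rw [mul_assoc, e2]; unfold cb; ring

theorem contDiff_chi_mul_rpow {h : ℝ} (hh : 0 < h) (s : ℝ) {n : ℕ∞} :
    ContDiff ℝ n fun ξ => chi h ξ * lorentzQ 3 ξ ^ s := by
  rw [contDiff_iff_contDiffAt]
  intro ξ
  by_cases hξ : ξ ∈ lightCone 3
  · have h1 := (ca_pos hξ).ne'
    have h2 := (cs_pos hξ).ne'
    have hQ : lorentzQ 3 ξ ≠ 0 := hξ.2.ne'
    have ha : ContDiffAt ℝ n ca ξ := by unfold ca; fun_prop
    have hb : ContDiffAt ℝ n cb ξ := by unfold cb; fun_prop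
    have hd : ContDiffAt ℝ n cd ξ := by unfold cd; fun_prop
    have ht : ContDiffAt ℝ n ct ξ := by unfold ct; exact hb.div ha h1
    have hs : ContDiffAt ℝ n cs ξ := by unfold cs; exact hd.sub ((hb.pow 2).div ha h1)
    have hq : ContDiffAt ℝ n (lorentzQ 3) ξ := by
      have : lorentzQ 3 = fun y : V => y 0 ^ 2 - y 1 ^ 2 - y 2 ^ 2 := by
        ext y; exact lorentzQ_three y
      rw [this]; fun_prop
    have : ContDiffAt ℝ n (fun ξ => bump (Real.log (ca ξ) / (2 * h)) * bump (Real.log (cs ξ) / 2) *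
        bump (ct ξ) * lorentzQ 3 ξ ^ s) ξ :=
      (((contDiff_bump.contDiffAt.comp ξ ((ha.log h1).div_const _)).mul
        (contDiff_bump.contDiffAt.comp ξ ((hs.log h2).div_const _))).mul
        (contDiff_bump.contDiffAt.comp ξ ht)).mul (hq.rpow_const_of_ne hQ)
    refine this.congr_of_eventuallyEq ?_
    filter_upwards [isOpen_cone.mem_nhds hξ] with x hx
    rw [chi, indicator_of_mem hx]
  · have hK : ξ ∈ (chiSupp h)ᶜ := fun hk => hξ (chiSupp_subset h hk)
    refine (contDiffAt_const (c := (0:ℝ))).congr_of_eventuallyEq ?_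
    filter_upwards [(isCompact_chiSupp h).isClosed.isOpen_compl.mem_nhds hK] with x hx
    have : chi h x = 0 := by
      by_contra hn
      exact hx (support_chi_subset hh hn)
    rw [this, zero_mul]

theorem continuous_chi {h : ℝ} (hh : 0 < h) : Continuous (chi h) := by
  have := (contDiff_chi_mul_rpow hh 0 (n := 0)).continuous
  simpa using this

end ConeBergman

/-! ### Regularity of the localized symbols -/

namespace ConeBergman

/-- The pairing as a continuous bilinear map. -/
def prL : V →L[ℝ] V →L[ℝ] ℝ :=
  ∑ i, (ContinuousLinearMap.proj (R := ℝ) (φ := fun _ : Fin 3 => ℝ) i).smulRight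
    (ContinuousLinearMap.proj (R := ℝ) (φ := fun _ : Fin 3 => ℝ) i)

theorem prL_apply (y ξ : V) : prL y ξ = pr y ξ := by
  simp [prL, pr, Fin.sum_univ_three]

/-- The Fourier-type transform `x ↦ ∫ f(ξ) exp(i x·ξ) dξ`. -/
def four (f : V → ℂ) (x : V) : ℂ := ∫ ξ, f ξ * cexp ((pr x ξ : ℂ) * I)

theorem four_eq (f : V → ℂ) : four f =
    VectorFourier.fourierIntegral Real.fourierChar volume
      ((-(2 * Real.pi)⁻¹ • prL).toLinearMap₁₂) f := by
  ext x
  unfold four VectorFourier.fourierIntegral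
  congr 1; ext ξ
  rw [Circle.smul_def, Real.fourierChar_apply, smul_eq_mul, mul_comm]
  congr 2
  have : (-((-(2 * Real.pi)⁻¹ • prL).toLinearMap₁₂ ξ x)) = (2 * Real.pi)⁻¹ * pr x ξ := by
    change -((-(2 * Real.pi)⁻¹) * (prL ξ x)) = _
    rw [prL_apply, pr_comm]; ring
  rw [this]
  push_cast
  have hp : (Real.pi : ℂ) ≠ 0 := by exact_mod_cast Real.pi_ne_zero
  field_simp

theorem norm_four_le (f : V → ℂ) (x : V) : ‖four f x‖ ≤ ∫ ξ, ‖f ξ‖ := by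
  refine (norm_integral_le_integral_norm _).trans_eq ?_
  congr 1; ext ξ
  rw [norm_mul, Complex.norm_exp_ofReal_mul_I, mul_one]

theorem pow_mul_norm_four_le {f : V → ℂ} (hf : ContDiff ℝ 4 f) (hc : HasCompactSupport f) (x : V) :
    ‖x‖ ^ 4 * ‖four f x‖ ≤ (2 * Real.pi) ^ 4 * 16 *
      ∑ p ∈ Finset.range 5, ∫ ξ, ‖iteratedFDeriv ℝ p f ξ‖ := by
  obtain ⟨i, hi⟩ : ∃ i, ‖x‖ = |x i| := by
    obtain ⟨i, hi⟩ := Finite.exists_max fun i => ‖x i‖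
    refine ⟨i, le_antisymm ?_ (norm_le_pi_norm x i)⟩
    exact (pi_norm_le_iff_of_nonneg (abs_nonneg _)).2 hi
  have key := VectorFourier.pow_mul_norm_iteratedFDeriv_fourierIntegral_le
    (L := -(2 * Real.pi)⁻¹ • prL) (μ := (volume : Measure V)) (f := f) (K := 0) (N := 4) (k := 0)
    (n := 4) hf ?_ le_rfl le_rfl (Pi.single i 1) x
  · rw [← four_eq, norm_iteratedFDeriv_zero] at key
    have h1 : (-(2 * Real.pi)⁻¹ • prL) (Pi.single i 1) x = -((2 * Real.pi)⁻¹ * x i) := by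
      change (-(2 * Real.pi)⁻¹) * (prL (Pi.single i 1) x) = _
      rw [prL_apply]
      have : pr (Pi.single i 1) x = x i := by
        unfold pr
        fin_cases i <;> simp
      rw [this]; ring
    rw [h1, abs_neg, abs_mul, ← hi, abs_of_pos (by positivity), mul_pow] at key
    have h2 : ‖(Pi.single i 1 : V)‖ = 1 := by rw [Pi.norm_single, norm_one]
    rw [h2] at key
    have h3 : (Finset.range (0 + 1) ×ˢ Finset.range (4 + 1)) =
        (Finset.range 5).map ⟨fun p => (0, p), fun a b h => by simpa using h⟩ := by decide
    rw [h3, Finset.sum_map] at key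
    have key' : (2 * Real.pi)⁻¹ ^ 4 * ‖x‖ ^ 4 * ‖four f x‖ ≤
        16 * ∑ p ∈ Finset.range 5, ∫ ξ, ‖iteratedFDeriv ℝ p f ξ‖ := by
      refine key.trans_eq ?_
      norm_num
      refine Finset.sum_congr rfl fun p _ => ?_
      change ∫ v, ‖v‖ ^ 0 * ‖iteratedFDeriv ℝ p f v‖ = _
      simp
    have hp : 0 < (2 * Real.pi) ^ 4 := by positivity
    calc ‖x‖ ^ 4 * ‖four f x‖ = (2 * Real.pi) ^ 4 * ((2 * Real.pi)⁻¹ ^ 4 * ‖x‖ ^ 4 * ‖four f x‖) := by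
          field_simp
      _ ≤ _ := (mul_le_mul_of_nonneg_left key' hp.le).trans_eq (mul_assoc _ _ _).symm
  · intro k n hk hn
    have hk0 : k = 0 := by simpa using hk
    subst hk0
    simp only [pow_zero, one_mul]
    have hcont : Continuous (iteratedFDeriv ℝ n f) :=
      hf.continuous_iteratedFDeriv (by exact_mod_cast hn)
    exact (hcont.integrable_of_hasCompactSupport (hc.iteratedFDeriv n)).norm

theorem norm_iteratedFDeriv_exp_neg_pr_le (y ξ : V) {D : ℝ} (hD : 1 ≤ D) (hy : 3 * ‖y‖ ≤ D)
    (n : ℕ) :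
    ‖iteratedFDeriv ℝ n (fun ξ => Real.exp (-pr y ξ)) ξ‖ ≤
      n.factorial * Real.exp (-pr y ξ) * D ^ n := by
  have e : (fun ξ => Real.exp (-pr y ξ)) = Real.exp ∘ (-(prL y)) := by
    ext ξ; simp [prL_apply]
  have e2 : Real.exp (-pr y ξ) = Real.exp ((-(prL y)) ξ) := by simp [prL_apply]
  rw [e, e2]
  refine norm_iteratedFDeriv_comp_le (N := n) Real.contDiff_exp (ContinuousLinearMap.contDiff _) le_rfl ξ
    ?_ ?_
  · intro i _
    rw [norm_iteratedFDeriv_eq_norm_iteratedDeriv, iteratedDeriv_eq_iterate, Real.iter_deriv_exp,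
      Real.norm_of_nonneg (Real.exp_pos _).le]
  · intro i hi _
    have hn : ‖-(prL y)‖ ≤ D := by
      refine le_trans ?_ hy
      refine ContinuousLinearMap.opNorm_le_bound _ (by positivity) fun w => ?_
      rw [neg_apply, norm_neg, prL_apply, pr, Real.norm_eq_abs]
      have a := fun i => norm_le_pi_norm y i
      have b := fun i => norm_le_pi_norm w i
      have c : ∀ i, |y i * w i| ≤ ‖y‖ * ‖w‖ := fun i => by
        rw [abs_mul]; exact mul_le_mul (a i) (b i) (abs_nonneg _) (norm_nonneg _)
      refine (abs_add_le _ _).trans ?_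
      have := abs_add_le (y 0 * w 0) (y 1 * w 1)
      linarith [c 0, c 1, c 2]
    have hfd : fderiv ℝ (⇑(-(prL y))) = fun _ => -(prL y) := by
      ext1 x; exact ContinuousLinearMap.fderiv _
    obtain ⟨j, rfl⟩ : ∃ j, i = j + 1 := ⟨i - 1, by omega⟩
    rw [← norm_iteratedFDeriv_fderiv, hfd]
    rcases j with _ | j
    · rw [norm_iteratedFDeriv_zero]; simpa using hn
    · rw [iteratedFDeriv_const_of_ne (by omega)]
      simp; positivity

theorem exists_pr_ge (h : ℝ) : ∃ c > 0, ∀ y ∈ lightCone 3, ∀ ξ ∈ chiSupp h, c * y 0 ≤ pr y ξ := by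
  have hcont : Continuous fun ξ : V => ξ 0 - Real.sqrt (ξ 1 ^ 2 + ξ 2 ^ 2) := by fun_prop
  have hpos : ∀ ξ ∈ lightCone 3, 0 < ξ 0 - Real.sqrt (ξ 1 ^ 2 + ξ 2 ^ 2) := by
    intro ξ hξ
    obtain ⟨h1, h2⟩ := mem_cone.1 hξ
    rw [sub_pos, Real.sqrt_lt' h1]; linarith
  have hne : (chiSupp h).Nonempty ∨ chiSupp h = ∅ := (eq_empty_or_nonempty _).symm
  rcases hne with hne | hne
  · obtain ⟨ξ₀, h0, hmin⟩ := (isCompact_chiSupp h).exists_isMinOn hne hcont.continuousOn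
    refine ⟨_, hpos _ (chiSupp_subset h h0), fun y hy ξ hξ => ?_⟩
    have h1 : _ ≤ ξ 0 - Real.sqrt (ξ 1 ^ 2 + ξ 2 ^ 2) := hmin hξ
    obtain ⟨y0, hyQ⟩ := mem_cone.1 hy
    refine (mul_le_mul_of_nonneg_right h1 y0.le).trans ?_
    set r := Real.sqrt (ξ 1 ^ 2 + ξ 2 ^ 2)
    have hr : r ^ 2 = ξ 1 ^ 2 + ξ 2 ^ 2 := Real.sq_sqrt (by positivity)
    have hr0 : 0 ≤ r := Real.sqrt_nonneg _
    have : (y 1 * ξ 1 + y 2 * ξ 2) ^ 2 ≤ (r * y 0) ^ 2 := by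
      rw [mul_pow, hr]
      nlinarith [sq_nonneg (y 1 * ξ 2 - y 2 * ξ 1), sq_nonneg (ξ 1), sq_nonneg (ξ 2),
        mul_nonneg (by linarith : 0 ≤ y 0 ^ 2 - y 1 ^ 2 - y 2 ^ 2)
          (by positivity : 0 ≤ ξ 1 ^ 2 + ξ 2 ^ 2)]
    have := (abs_le_of_sq_le_sq' this (by positivity)).1
    unfold pr; nlinarith
  · exact ⟨1, one_pos, fun y _ ξ hξ => by simp [hne] at hξ⟩

end ConeBergman

/-! ### Decay of the localized kernels -/

namespace ConeBergman

/-- The base frequency-localised kernel. -/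
def kerBase (h s : ℝ) (y x : V) : ℂ := four (fun ξ => ((chi h ξ * lapW s y ξ : ℝ) : ℂ)) x

theorem chi_mul_lapW (h s : ℝ) (y ξ : V) :
    chi h ξ * lapW s y ξ = chi h ξ * lorentzQ 3 ξ ^ s * Real.exp (-pr y ξ) := by
  by_cases hξ : ξ ∈ lightCone 3
  · rw [lapW, indicator_of_mem hξ]; ring
  · rw [chi, indicator_of_notMem hξ]; ring

theorem norm_le_of_mem_cone {y : V} (hy : y ∈ lightCone 3) : ‖y‖ ≤ y 0 := by
  have h := cone_bounds hy
  have h0 := (mem_cone.1 hy).1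
  rw [pi_norm_le_iff_of_nonneg h0.le]
  intro i
  fin_cases i
  · simp [abs_of_pos h0]
  · exact h.1.le
  · exact h.2.le

theorem one_add_pow_four_mul_exp_le {c : ℝ} (hc : 0 < c) :
    ∃ C > 0, ∀ t, 0 ≤ t → (1 + 3 * t) ^ 4 * Real.exp (-(c * t)) ≤ C * Real.exp (-(c / 2 * t)) := by
  refine ⟨(1 + 24 / c) ^ 4, by positivity, fun t ht => ?_⟩
  have h1 : 1 + 3 * t ≤ (1 + 24 / c) * Real.exp (c / 8 * t) := by
    have := Real.add_one_le_exp (c / 8 * t)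
    calc 1 + 3 * t ≤ (1 + 24 / c) * (c / 8 * t + 1) := by
          have : 24 / c * (c / 8 * t) = 3 * t := by field_simp; ring
          nlinarith [(by positivity : 0 ≤ c / 8 * t), (by positivity : 0 ≤ 24 / c)]
      _ ≤ _ := by gcongr
  calc (1 + 3 * t) ^ 4 * Real.exp (-(c * t))
      ≤ ((1 + 24 / c) * Real.exp (c / 8 * t)) ^ 4 * Real.exp (-(c * t)) := by gcongr
    _ = _ := by
        rw [mul_pow, ← Real.exp_nat_mul, mul_assoc, ← Real.exp_add]
        congr 2; push_cast; ring

theorem norm_kerBase_le {h : ℝ} (hh : 0 < h) (s : ℝ) : ∃ C > 0, ∃ c > 0, ∀ y ∈ lightCone 3, ∀ x,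
    ‖kerBase h s y x‖ * (1 + ‖x‖ ^ 4) ≤ C * Real.exp (-(c * y 0)) := by
  obtain ⟨c, hc, hpr⟩ := exists_pr_ge h
  set u : V → ℝ := fun ξ => chi h ξ * lorentzQ 3 ξ ^ s with hu
  have hus : ContDiff ℝ 4 u := contDiff_chi_mul_rpow hh s (n := 4)
  have husup : Function.support u ⊆ chiSupp h := fun ξ hξ =>
    support_chi_subset hh (left_ne_zero_of_mul hξ)
  have hclosed := (isCompact_chiSupp h).isClosed
  have hutsup : tsupport u ⊆ chiSupp h := closure_minimal husup hclosed
  have huc : HasCompactSupport u := (isCompact_chiSupp h).of_isClosed_subset isClosed_closure hutsup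
  have hB : ∃ B, ∀ i ≤ 4, ∀ ξ, ‖iteratedFDeriv ℝ i u ξ‖ ≤ B := by
    have : ∀ i : Fin 5, ∃ B, ∀ ξ, ‖iteratedFDeriv ℝ i u ξ‖ ≤ B := fun i =>
      (hus.continuous_iteratedFDeriv (by exact_mod_cast Nat.lt_succ_iff.1 i.2)).bounded_above_of_compact_support
        (huc.iteratedFDeriv i)
    choose B hB using this
    refine ⟨∑ i, |B i|, fun i hi ξ => (hB ⟨i, by omega⟩ ξ).trans ?_⟩
    exact (le_abs_self _).trans
      (Finset.single_le_sum (f := fun i => |B i|) (fun _ _ => abs_nonneg _) (Finset.mem_univ _))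
  obtain ⟨B, hB⟩ := hB
  have hB0 : 0 ≤ B := (norm_nonneg _).trans (hB 0 (by norm_num) 0)
  obtain ⟨C₁, hC₁, hD⟩ := one_add_pow_four_mul_exp_le hc
  set vK := (volume : Measure V).real (chiSupp h)
  set C₂ : ℝ := 16 * B * 24 * C₁ with hC₂
  have hC₂0 : 0 ≤ C₂ := by positivity
  refine ⟨C₂ * vK * (1 + (2 * Real.pi) ^ 4 * 16 * 5) + 1, by positivity, c / 2, by positivity,
    fun y hy x => ?_⟩
  have hy0 := (mem_cone.1 hy).1
  set m : V → ℝ := fun ξ => u ξ * Real.exp (-pr y ξ) with hm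
  have hexp : ContDiff ℝ 4 fun ξ => Real.exp (-pr y ξ) := by unfold pr; fun_prop
  have hms : ContDiff ℝ 4 m := hus.mul hexp
  have hmsup : tsupport m ⊆ chiSupp h :=
    closure_minimal (fun ξ hξ => husup (left_ne_zero_of_mul hξ)) hclosed
  have hmc : HasCompactSupport m := (isCompact_chiSupp h).of_isClosed_subset isClosed_closure hmsup
  have hmcC : ContDiff ℝ 4 fun ξ => (m ξ : ℂ) := Complex.ofRealCLM.contDiff.comp hms
  have hmcc : HasCompactSupport fun ξ => (m ξ : ℂ) := hmc.comp_left (g := fun r : ℝ => (r:ℂ)) (by simp)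
  have hk : kerBase h s y = four fun ξ => (m ξ : ℂ) := by
    unfold kerBase
    ext x
    simp only [chi_mul_lapW, hm, hu]
  have hpt : ∀ p ≤ 4, ∀ ξ, ‖iteratedFDeriv ℝ p m ξ‖ ≤
      (chiSupp h).indicator (fun _ => C₂ * Real.exp (-(c / 2 * y 0))) ξ := by
    intro p hp ξ
    by_cases hξ : ξ ∈ chiSupp h
    · rw [indicator_of_mem hξ]
      refine (norm_iteratedFDeriv_mul_le (N := 4) hus hexp ξ (by exact_mod_cast hp)).trans ?_
      have hterm : ∀ i ∈ Finset.range (p + 1), (p.choose i : ℝ) * ‖iteratedFDeriv ℝ i u ξ‖ *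
          ‖iteratedFDeriv ℝ (p - i) (fun ξ => Real.exp (-pr y ξ)) ξ‖ ≤
          p.choose i * (B * (24 * (C₁ * Real.exp (-(c / 2 * y 0))))) := by
        intro i hi
        rw [Finset.mem_range] at hi
        rw [mul_assoc]
        refine mul_le_mul_of_nonneg_left ?_ (by positivity)
        refine mul_le_mul (hB i (by omega) ξ) ?_ (norm_nonneg _) hB0
        refine (norm_iteratedFDeriv_exp_neg_pr_le y ξ (D := 1 + 3 * y 0) (by linarith)
          (by linarith [norm_le_of_mem_cone hy]) (p - i)).trans ?_
        have h1 : ((p - i).factorial : ℝ) ≤ 24 := by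
          have := Nat.factorial_le (show p - i ≤ 4 by omega)
          exact_mod_cast this
        have h2 : Real.exp (-pr y ξ) ≤ Real.exp (-(c * y 0)) := by
          have := hpr y hy ξ hξ
          gcongr
        have h3 : (1 + 3 * y 0) ^ (p - i) ≤ (1 + 3 * y 0) ^ 4 :=
          pow_le_pow_right₀ (by linarith) (by omega)
        calc _ ≤ 24 * Real.exp (-(c * y 0)) * (1 + 3 * y 0) ^ 4 := by gcongr
          _ = 24 * ((1 + 3 * y 0) ^ 4 * Real.exp (-(c * y 0))) := by ring
          _ ≤ _ := mul_le_mul_of_nonneg_left (hD _ hy0.le) (by norm_num)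
      refine (Finset.sum_le_sum hterm).trans ?_
      rw [← Finset.sum_mul]
      have h4 : ∑ i ∈ Finset.range (p + 1), (p.choose i : ℝ) ≤ 16 := by
        have e := Nat.sum_range_choose p
        have : 2 ^ p ≤ 2 ^ 4 := Nat.pow_le_pow_right (by norm_num) hp
        rw [← e] at this
        exact_mod_cast this
      calc _ ≤ 16 * (B * (24 * (C₁ * Real.exp (-(c / 2 * y 0))))) := by gcongr
        _ = _ := by rw [hC₂]; ring
    · rw [indicator_of_notMem hξ, norm_le_zero_iff]
      have := (tsupport_iteratedFDeriv_subset (𝕜 := ℝ) (f := m) p).trans hmsup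
      exact image_eq_zero_of_notMem_tsupport fun hx => hξ (this hx)
  have h_int : ∀ p ≤ 4, ∫ ξ, ‖iteratedFDeriv ℝ p (fun ξ => (m ξ : ℂ)) ξ‖ ≤
      C₂ * Real.exp (-(c / 2 * y 0)) * vK := by
    intro p hp
    have e : ∀ ξ, ‖iteratedFDeriv ℝ p (fun ξ => (m ξ : ℂ)) ξ‖ = ‖iteratedFDeriv ℝ p m ξ‖ := fun ξ =>
      Complex.ofRealLI.norm_iteratedFDeriv_comp_left hms.contDiffAt (by exact_mod_cast hp)
    simp_rw [e]
    refine (integral_mono_of_nonneg (Filter.Eventually.of_forall fun _ => norm_nonneg _) ?_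
      (Filter.Eventually.of_forall (hpt p hp))).trans_eq ?_
    · rw [integrable_indicator_iff hclosed.measurableSet]
      exact integrableOn_const (isCompact_chiSupp h).measure_lt_top.ne
    · rw [integral_indicator hclosed.measurableSet, setIntegral_const, smul_eq_mul, mul_comm]
  rw [hk, mul_add, mul_one, mul_comm _ (‖x‖ ^ 4)]
  have h1 : ‖four (fun ξ => (m ξ : ℂ)) x‖ ≤ C₂ * Real.exp (-(c / 2 * y 0)) * vK := by
    refine (norm_four_le _ x).trans ?_
    have := h_int 0 (by norm_num)
    simpa only [norm_iteratedFDeriv_zero] using this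
  have h2 : ‖x‖ ^ 4 * ‖four (fun ξ => (m ξ : ℂ)) x‖ ≤ (2 * Real.pi) ^ 4 * 16 *
      (5 * (C₂ * Real.exp (-(c / 2 * y 0)) * vK)) := by
    refine (pow_mul_norm_four_le hmcC hmcc x).trans ?_
    gcongr
    refine (Finset.sum_le_card_nsmul _ _ (C₂ * Real.exp (-(c / 2 * y 0)) * vK) fun p hp => ?_).trans_eq ?_
    · rw [Finset.mem_range] at hp
      exact h_int p (by omega)
    · simp
  have h3 := Real.exp_pos (-(c / 2 * y 0))
  nlinarith

end ConeBergman

/-! ### Norms of the localized kernels -/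

namespace ConeBergman

/-- The cutoff translated by a group element. -/
def chiG (h : ℝ) (g : Par) (ξ : V) : ℝ := chi h (actT (ginv g) ξ)

theorem chiG_nonneg (h : ℝ) (g : Par) (ξ : V) : 0 ≤ chiG h g ξ := chi_nonneg _ _

theorem continuous_chiG {h : ℝ} (hh : 0 < h) (g : Par) : Continuous (chiG h g) :=
  (continuous_chi hh).comp (continuous_actT _)

theorem hasCompactSupport_chi {h : ℝ} (hh : 0 < h) : HasCompactSupport (chi h) :=
  (isCompact_chiSupp h).of_isClosed_subset isClosed_closure
    (closure_minimal (support_chi_subset hh) (isCompact_chiSupp h).isClosed)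

theorem hasCompactSupport_chiG {h : ℝ} (hh : 0 < h) (g : Par) : HasCompactSupport (chiG h g) :=
  (hasCompactSupport_chi hh).comp_homeomorph (actTHomeo (ginv g))

/-- The frequency-localised kernel. -/
def ker (h s : ℝ) (g : Par) (y x : V) : ℂ :=
  four (fun ξ => ((chiG h g ξ * lapW s y ξ : ℝ) : ℂ)) x

theorem lapW_actT (s : ℝ) (g : Par) (y ξ : V) :
    lapW s y (actT g ξ) = mult g ^ (2 * s) * lapW s (act g y) ξ := by
  unfold lapW
  by_cases hξ : ξ ∈ lightCone 3
  · rw [indicator_of_mem hξ, indicator_of_mem (actT_mem g hξ), lorentzQ_actT, pr_act,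
      Real.mul_rpow (by positivity) hξ.2.le, Real.rpow_mul (mult_pos g).le, mul_assoc,
      Real.rpow_two]
  · rw [indicator_of_notMem hξ, indicator_of_notMem (fun h => hξ ((actT_mem_iff g).1 h)), mul_zero]

theorem ker_eq (h s : ℝ) (g : Par) (y x : V) :
    ker h s g y x = ((mult g ^ (2 * s + 3) : ℝ) : ℂ) * kerBase h s (act g y) (act g x) := by
  have hm := mult_pos g
  unfold ker kerBase four
  have h1 := integral_comp_actT g
    (fun ξ => ((chiG h g ξ * lapW s y ξ : ℝ) : ℂ) * cexp ((pr x ξ : ℂ) * I))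
  have h2 : ∀ η, ((chiG h g (actT g η) * lapW s y (actT g η) : ℝ) : ℂ) *
      cexp ((pr x (actT g η) : ℂ) * I) = ((mult g ^ (2 * s) : ℝ) : ℂ) *
      (((chi h η * lapW s (act g y) η : ℝ) : ℂ) * cexp ((pr (act g x) η : ℂ) * I)) := by
    intro η
    rw [chiG, actT_ginv_actT, lapW_actT, pr_act]
    push_cast; ring
  simp_rw [h2] at h1
  rw [integral_const_mul, Complex.real_smul] at h1
  rw [Real.rpow_add hm]
  have h3 : mult g ^ (3:ℝ) = mult g ^ 3 := by exact_mod_cast Real.rpow_natCast (mult g) 3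
  rw [h3, ofReal_mul, mul_comm ((mult g ^ (2 * s) : ℝ) : ℂ), mul_assoc, h1, ← mul_assoc, ← ofReal_mul,
    mul_inv_cancel₀ (by positivity), ofReal_one, one_mul]

theorem lintegral_one_add_norm_pow_lt_top :
    ∫⁻ x : V, ENNReal.ofReal (1 + ‖x‖ ^ 4)⁻¹ < ∞ := by
  have h := integrable_one_add_norm (E := V) (μ := volume) (r := 4) (by simp; norm_num)
  have h2 : Integrable fun x : V => 8 * (1 + ‖x‖) ^ (-4 : ℝ) := h.const_mul 8
  refine lt_of_le_of_lt (lintegral_mono fun x => ?_) h2.lintegral_lt_top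
  refine ENNReal.ofReal_le_ofReal ?_
  have h0 := norm_nonneg x
  rw [Real.rpow_neg (by positivity), ← div_eq_mul_inv, inv_eq_one_div,
    div_le_div_iff₀ (by positivity) (by positivity)]
  have : (1 + ‖x‖) ^ (4:ℝ) = (1 + ‖x‖) ^ 4 := by exact_mod_cast Real.rpow_natCast (1 + ‖x‖) 4
  rw [this]
  nlinarith [sq_nonneg (‖x‖ - 1), sq_nonneg (‖x‖ ^ 2 - 1), sq_nonneg (‖x‖ ^ 2 - ‖x‖), mul_nonneg h0 (sq_nonneg (‖x‖ - 1))]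

theorem exists_lintegral_ker_le {h : ℝ} (hh : 0 < h) (s : ℝ) :
    ∃ C > 0, ∃ c > 0, ∀ g : Par, ∀ y ∈ lightCone 3, ∀ p : ℝ, 1 ≤ p →
      (∫⁻ x, ‖ker h s g y x‖ₑ ^ p) ^ (1 / p) ≤
        ENNReal.ofReal (C * mult g ^ (2 * s + 3 - 3 / p) * Real.exp (-(c * act g y 0))) := by
  obtain ⟨C, hC, c, hc, hk⟩ := norm_kerBase_le hh s
  set A := ∫⁻ x : V, ENNReal.ofReal (1 + ‖x‖ ^ 4)⁻¹ with hA
  have hAfin : A < ∞ := lintegral_one_add_norm_pow_lt_top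
  refine ⟨C * (1 + A.toReal), by positivity, c, hc, fun g y hy p hp => ?_⟩
  have hp0 : 0 < p := by linarith
  have hm := mult_pos g
  set E := C * Real.exp (-(c * act g y 0)) with hE
  have hE0 : 0 < E := by positivity
  set φ : V → ℝ≥0∞ := fun x => ENNReal.ofReal (1 + ‖x‖ ^ 4)⁻¹ with hφ
  have hφm : Measurable φ := by rw [hφ]; fun_prop
  have hpt : ∀ x, ‖ker h s g y x‖ₑ ^ p ≤
      ENNReal.ofReal (mult g ^ (2 * s + 3) * E) ^ p * φ (act g x) := by
    intro x
    have h1 := hk (act g y) (act_mem g hy) (act g x)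
    have h2 : ‖kerBase h s (act g y) (act g x)‖ ≤ E * (1 + ‖act g x‖ ^ 4)⁻¹ := by
      rw [← div_eq_mul_inv, le_div_iff₀ (by positivity)]; exact h1
    have h3 : ‖ker h s g y x‖ₑ ≤ ENNReal.ofReal (mult g ^ (2 * s + 3) * E) * φ (act g x) := by
      rw [hφ, ← ENNReal.ofReal_mul (by positivity), ker_eq, ← ofReal_norm, norm_mul,
        Complex.norm_real, Real.norm_of_nonneg (by positivity)]
      refine ENNReal.ofReal_le_ofReal ?_
      rw [mul_assoc]
      gcongr
    refine (ENNReal.rpow_le_rpow h3 hp0.le).trans ?_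
    rw [ENNReal.mul_rpow_of_nonneg _ _ hp0.le]
    refine mul_le_mul_right ?_ _
    have h4 : φ (act g x) ≤ 1 := by
      rw [hφ, ENNReal.ofReal_le_one]
      exact inv_le_one_of_one_le₀ (by linarith [pow_nonneg (norm_nonneg (act g x)) 4])
    calc _ ≤ φ (act g x) ^ (1:ℝ) := ENNReal.rpow_le_rpow_of_exponent_ge h4 hp
      _ = _ := ENNReal.rpow_one _
  have h5 : ∫⁻ x, ‖ker h s g y x‖ₑ ^ p ≤
      ENNReal.ofReal (mult g ^ (2 * s + 3) * E) ^ p * (ENNReal.ofReal ((mult g ^ 3)⁻¹) * A) := by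
    refine (lintegral_mono hpt).trans_eq ?_
    have := lintegral_const_mul (μ := volume) (ENNReal.ofReal (mult g ^ (2 * s + 3) * E) ^ p)
      (hφm.comp (continuous_act g).measurable)
    simp only [Function.comp_apply] at this
    rw [this, lintegral_comp_act g φ hφm]
  refine (ENNReal.rpow_le_rpow h5 (by positivity)).trans ?_
  have hA1 : A ≤ ENNReal.ofReal (1 + A.toReal) := by
    rw [ENNReal.ofReal_add (by norm_num) ENNReal.toReal_nonneg, ENNReal.ofReal_toReal hAfin.ne]
    exact le_add_self
  rw [ENNReal.mul_rpow_of_nonneg _ _ (by positivity), ENNReal.mul_rpow_of_nonneg _ _ (by positivity),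
    ← ENNReal.rpow_mul, mul_one_div_cancel hp0.ne', ENNReal.rpow_one]
  have h6 : A ^ (1 / p) ≤ ENNReal.ofReal (1 + A.toReal) := by
    refine (ENNReal.rpow_le_rpow hA1 (by positivity)).trans ?_
    calc _ ≤ ENNReal.ofReal (1 + A.toReal) ^ (1:ℝ) := by
          refine ENNReal.rpow_le_rpow_of_exponent_le ?_ ?_
          · rw [ENNReal.one_le_ofReal]; linarith [ENNReal.toReal_nonneg (a := A)]
          · rw [div_le_one hp0]; exact hp
      _ = _ := ENNReal.rpow_one _
  have h7 : ENNReal.ofReal ((mult g ^ 3)⁻¹) ^ (1 / p) = ENNReal.ofReal (mult g ^ (-(3 / p))) := by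
    rw [ENNReal.ofReal_rpow_of_pos (by positivity)]
    congr 1
    have : (mult g ^ 3)⁻¹ = mult g ^ (-3:ℝ) := by
      rw [Real.rpow_neg hm.le]; congr 1; exact_mod_cast (Real.rpow_natCast (mult g) 3).symm
    rw [this, ← Real.rpow_mul hm.le]; congr 1; ring
  rw [h7]
  calc _ ≤ ENNReal.ofReal (mult g ^ (2 * s + 3) * E) *
        (ENNReal.ofReal (mult g ^ (-(3 / p))) * ENNReal.ofReal (1 + A.toReal)) := by gcongr
    _ = _ := by
      rw [← ENNReal.ofReal_mul (by positivity), ← ENNReal.ofReal_mul (by positivity)]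
      congr 1
      rw [sub_eq_add_neg (2 * s + 3), Real.rpow_add hm (2 * s + 3), hE]; ring

theorem measurable_ker {h : ℝ} (hh : 0 < h) (s : ℝ) (g : Par) :
    Measurable (Function.uncurry (ker h s g)) := by
  have : StronglyMeasurable fun w : (V × V) × V =>
      ((chiG h g w.2 * lapW s w.1.1 w.2 : ℝ) : ℂ) * cexp ((pr w.1.2 w.2 : ℂ) * I) := by
    refine Measurable.stronglyMeasurable ?_
    have h1 : Measurable fun w : (V × V) × V => chiG h g w.2 :=
      (continuous_chiG hh g).measurable.comp measurable_snd
    have h2 : Measurable fun w : (V × V) × V => lapW s w.1.1 w.2 := by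
      have e : (fun w : (V × V) × V => lapW s w.1.1 w.2) =
          (Prod.snd ⁻¹' (lightCone 3)).indicator
            fun w : (V × V) × V => lorentzQ 3 w.2 ^ s * Real.exp (-pr w.1.1 w.2) := by
        ext w; rfl
      rw [e]
      refine Measurable.indicator ?_ (measurable_snd measurableSet_cone)
      have h3 : Measurable fun w : (V × V) × V => lorentzQ 3 w.2 :=
        continuous_lorentzQ.measurable.comp measurable_snd
      unfold pr
      fun_prop
    unfold pr
    fun_prop
  exact this.integral_prod_right.measurable

end ConeBergman

/-! ### Fourier transforms of amplitudes -/

namespace ConeBergman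

open scoped FourierTransform Convolution ComplexConjugate

theorem continuous_pr_left (x : V) : Continuous (pr x) := by unfold pr; fun_prop

theorem integrable_mul_cexp {f : V → ℂ} (hf : Integrable f) (x : V) :
    Integrable fun ξ => f ξ * cexp ((pr x ξ : ℂ) * I) := by
  refine hf.mul_bdd (c := 1) ?_ (Filter.Eventually.of_forall fun ξ => ?_)
  · have := continuous_pr_left x
    exact Continuous.aestronglyMeasurable (by fun_prop)
  · rw [Complex.norm_exp_ofReal_mul_I]

theorem continuous_four {f : V → ℂ} (hf : Integrable f) : Continuous (four f) := by
  rw [four_eq]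
  refine VectorFourier.fourierIntegral_continuous Real.continuous_fourierChar ?_ hf
  exact (-(2 * Real.pi)⁻¹ • prL).continuous₂

theorem inner_eq_pr (v w : EuclideanSpace ℝ (Fin 3)) : inner ℝ v w = pr v.ofLp w.ofLp := by
  simp [PiLp.inner_apply, Fin.sum_univ_three, pr, mul_comm]

theorem pr_smul_left (c : ℝ) (x ξ : V) : pr (c • x) ξ = c * pr x ξ := by
  simp [pr]; ring

theorem four_inversion {N : V → ℂ} (hc : Continuous N) (hN : Integrable N)
    (hF : Integrable (four N)) (ξ : V) :
    ∫ x, four N x * cexp (-((pr x ξ : ℂ) * I)) = ((2 * Real.pi) ^ 3 : ℝ) * N ξ := by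
  set f : EuclideanSpace ℝ (Fin 3) → ℂ := fun v => N v.ofLp with hf
  have mp := PiLp.volume_preserving_ofLp (Fin 3)
  have me : MeasurableEmbedding (@WithLp.ofLp 2 (Fin 3 → ℝ)) :=
    (MeasurableEquiv.toLp 2 (Fin 3 → ℝ)).symm.measurableEmbedding
  have hpi := Real.pi_pos
  have h1 : 𝓕 f = fun w => four N ((-(2 * Real.pi)) • w.ofLp) := by
    ext w
    rw [Real.fourier_eq']
    have := mp.integral_comp me fun ξ => cexp ((pr (-(2 * Real.pi) • w.ofLp) ξ : ℂ) * I) • N ξ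
    unfold four
    rw [← integral_congr_ae (Filter.Eventually.of_forall fun ξ => mul_comm _ _)]
    rw [show (∫ ξ, cexp ((pr (-(2 * Real.pi) • w.ofLp) ξ : ℂ) * I) * N ξ) = _ from this.symm]
    refine integral_congr_ae (Filter.Eventually.of_forall fun v => ?_)
    change _ = cexp ((pr (-(2 * Real.pi) • w.ofLp) v.ofLp : ℂ) * I) • N v.ofLp
    beta_reduce
    rw [inner_eq_pr, pr_smul_left, pr_comm w.ofLp]
    simp only [hf]
    congr 5
    ring
  have hfi : Integrable f := mp.integrable_comp_of_integrable hN
  have hFi : Integrable (𝓕 f) := by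
    rw [h1]
    have h2 : Integrable fun x : V => four N ((-(2 * Real.pi)) • x) :=
      (integrable_comp_smul_iff volume _ (by linarith)).2 hF
    exact mp.integrable_comp_of_integrable h2
  have hfc : Continuous f := hc.comp (PiLp.continuous_ofLp 2 _)
  have h3 := hfi.fourierInv_fourier_eq hFi (v := WithLp.toLp 2 ξ) hfc.continuousAt
  rw [Real.fourierInv_eq', h1] at h3
  have h4 := mp.integral_comp me fun x => four N ((-(2 * Real.pi)) • x) *
    cexp (-((pr ((-(2 * Real.pi)) • x) ξ : ℂ) * I))
  have h5 := Measure.integral_comp_smul (volume : Measure V)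
    (fun x => four N x * cexp (-((pr x ξ : ℂ) * I))) (-(2 * Real.pi))
  rw [h5] at h4
  have h6 : f (WithLp.toLp 2 ξ) = N ξ := rfl
  rw [h6] at h3
  have h7 : N ξ = |((-(2 * Real.pi)) ^ 3)⁻¹| • ∫ x, four N x * cexp (-((pr x ξ : ℂ) * I)) := by
    rw [← h3]
    have e3 : Module.finrank ℝ V = 3 := by simp
    rw [e3] at h4
    rw [← h4]
    refine integral_congr_ae (Filter.Eventually.of_forall fun v => ?_)
    change cexp _ * four N _ = four N _ * _
    rw [inner_eq_pr, pr_smul_left, mul_comm]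
    congr 2
    push_cast; ring
  rw [h7, Complex.real_smul, ← mul_assoc, ← ofReal_mul]
  have : (2 * Real.pi) ^ 3 * |((-(2 * Real.pi)) ^ 3)⁻¹| = 1 := by
    rw [abs_inv, abs_pow, abs_neg, abs_of_pos (by positivity : 0 < 2 * Real.pi)]
    exact mul_inv_cancel₀ (by positivity)
  rw [this, ofReal_one, one_mul]

/-- Continuous compactly supported amplitudes with an integrable transform. -/
structure IsAmp (m : V → ℂ) : Prop where
  cont : Continuous m
  cpt : HasCompactSupport m
  int_four : Integrable (four m)

theorem IsAmp.int {m : V → ℂ} (h : IsAmp m) : Integrable m :=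
  h.cont.integrable_of_hasCompactSupport h.cpt

theorem four_add {m n : V → ℂ} (hm : Integrable m) (hn : Integrable n) (x : V) :
    four (fun ξ => m ξ + n ξ) x = four m x + four n x := by
  unfold four
  rw [← integral_add (integrable_mul_cexp hm x) (integrable_mul_cexp hn x)]
  congr 1; ext ξ; ring

theorem isAmp_zero : IsAmp fun _ => 0 := by
  refine ⟨continuous_const, HasCompactSupport.zero, ?_⟩
  have : four (fun _ => 0) = fun _ => 0 := by ext x; simp [four]
  rw [this]; exact integrable_zero _ _ _

theorem IsAmp.add {m n : V → ℂ} (hm : IsAmp m) (hn : IsAmp n) : IsAmp fun ξ => m ξ + n ξ := by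
  refine ⟨hm.cont.add hn.cont, hm.cpt.add hn.cpt, ?_⟩
  rw [show four (fun ξ => m ξ + n ξ) = _ from funext (four_add hm.int hn.int)]
  exact hm.int_four.add hn.int_four

theorem IsAmp.sum {ι : Type*} {m : ι → V → ℂ} (s : Finset ι) (hm : ∀ i ∈ s, IsAmp (m i)) :
    IsAmp (fun ξ => ∑ i ∈ s, m i ξ) ∧
      four (fun ξ => ∑ i ∈ s, m i ξ) = fun x => ∑ i ∈ s, four (m i) x := by
  classical
  induction s using Finset.induction_on with
  | empty =>
    refine ⟨by simpa using isAmp_zero, ?_⟩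
    ext x; simp [four]
  | insert a s ha ih =>
    have h1 := hm a (Finset.mem_insert_self _ _)
    have h2 := ih fun i hi => hm i (Finset.mem_insert_of_mem hi)
    simp only [Finset.sum_insert ha]
    refine ⟨h1.add h2.1, ?_⟩
    ext x
    rw [four_add h1.int h2.1.int, h2.2]

theorem four_convolution {m n : V → ℂ} (hm : Integrable m) (hn : Integrable n) (x : V) :
    four (m ⋆[ContinuousLinearMap.mul ℝ ℂ, volume] n) x = four m x * four n x := by
  have h := integral_convolution (ContinuousLinearMap.mul ℝ ℂ) (integrable_mul_cexp hm x)
    (integrable_mul_cexp hn x) (μ := volume) (ν := volume)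
  rw [ContinuousLinearMap.mul_apply'] at h
  unfold four
  rw [← h]
  congr 1; ext ξ
  unfold MeasureTheory.convolution
  rw [← integral_mul_const]
  congr 1; ext t
  simp only [ContinuousLinearMap.mul_apply']
  have : pr x ξ = pr x t + pr x (ξ - t) := by simp [pr]; ring
  rw [this]; push_cast
  rw [add_mul, Complex.exp_add]; ring

theorem IsAmp.norm_four_le {m : V → ℂ} (_h : IsAmp m) (x : V) : ‖four m x‖ ≤ ∫ ξ, ‖m ξ‖ :=
  ConeBergman.norm_four_le m x

theorem IsAmp.integrable_pow_four {m : V → ℂ} (h : IsAmp m) :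
    Integrable fun x => ‖four m x‖ ^ 4 := by
  have h1 : Integrable fun x => ‖four m x‖ * ‖four m x‖ ^ 3 := by
    refine h.int_four.norm.mul_bdd (c := (∫ ξ, ‖m ξ‖) ^ 3) (h.int_four.1.norm.pow 3)
      (Filter.Eventually.of_forall fun x => ?_)
    rw [norm_pow, norm_norm]
    exact pow_le_pow_left₀ (norm_nonneg _) (h.norm_four_le x) 3
  exact h1.congr (Filter.Eventually.of_forall fun x => by ring)

theorem IsAmp.memLp {m : V → ℂ} (h : IsAmp m) : MemLp (four m) 4 := by
  rw [← integrable_norm_rpow_iff h.int_four.1 (by norm_num) (by norm_num)]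
  refine h.integrable_pow_four.congr (Filter.Eventually.of_forall fun x => ?_)
  simp only [ENNReal.toReal_ofNat]
  exact_mod_cast rfl

theorem IsAmp.convolution {m n : V → ℂ} (hm : IsAmp m) (hn : IsAmp n) :
    IsAmp (m ⋆[ContinuousLinearMap.mul ℝ ℂ, volume] n) := by
  refine ⟨hn.cpt.continuous_convolution_right _ hm.int.locallyIntegrable hn.cont,
    hm.cpt.convolution _ hn.cpt, ?_⟩
  rw [show four _ = _ from funext (four_convolution hm.int hn.int)]
  exact hm.int_four.mul_bdd (c := ∫ ξ, ‖n ξ‖) (hn.int_four.1)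
    (Filter.Eventually.of_forall hn.norm_four_le)

theorem integral_four_mul_conj_four {M N : V → ℂ} (hM : IsAmp M) (hN : IsAmp N) :
    ∫ x, four M x * conj (four N x) = ((2 * Real.pi) ^ 3 : ℝ) * ∫ ξ, M ξ * conj (N ξ) := by
  have hswap : ∫ x, ∫ ξ, M ξ * cexp ((pr x ξ : ℂ) * I) * conj (four N x) =
      ∫ ξ, ∫ x, M ξ * cexp ((pr x ξ : ℂ) * I) * conj (four N x) := by
    refine integral_integral_swap ?_
    have h1 : Integrable (fun w : V × V => conj (four N w.1) * M w.2) (volume.prod volume) :=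
      Integrable.mul_prod (f := fun x => conj (four N x)) (g := M)
        (Complex.conjLIE.integrable_comp_iff.2 hN.int_four) hM.int
    have h2 : Integrable (fun w : V × V => conj (four N w.1) * M w.2 *
        cexp ((pr w.1 w.2 : ℂ) * I)) (volume.prod volume) := by
      refine h1.mul_bdd (c := 1) ?_ (Filter.Eventually.of_forall fun ξ => ?_)
      · have : Continuous fun w : V × V => pr w.1 w.2 := by unfold pr; fun_prop
        exact Continuous.aestronglyMeasurable (by fun_prop)
      · rw [Complex.norm_exp_ofReal_mul_I]
    refine h2.congr (Filter.Eventually.of_forall fun w => ?_)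
    simp only [Function.uncurry]; ring
  calc ∫ x, four M x * conj (four N x)
      = ∫ x, ∫ ξ, M ξ * cexp ((pr x ξ : ℂ) * I) * conj (four N x) := by
        congr 1; ext x
        rw [integral_mul_const]; rfl
    _ = _ := hswap
    _ = ∫ ξ, M ξ * conj (((2 * Real.pi) ^ 3 : ℝ) * N ξ) := by
        congr 1; ext ξ
        rw [← four_inversion hN.cont hN.int hN.int_four ξ, ← integral_conj, ← integral_const_mul]
        congr 1; ext x
        rw [map_mul, ← Complex.exp_conj]
        simp
        ring
    _ = _ := by
        rw [← integral_const_mul]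
        congr 1; ext ξ
        rw [map_mul, conj_ofReal]; ring

theorem integral_four_orthogonal {m₁ m₂ m₃ m₄ : V → ℂ} (h₁ : IsAmp m₁) (h₂ : IsAmp m₂)
    (h₃ : IsAmp m₃) (h₄ : IsAmp m₄)
    (hd : ∀ ξ₁ ξ₂ ξ₃ ξ₄, m₁ ξ₁ ≠ 0 → m₂ ξ₂ ≠ 0 → m₃ ξ₃ ≠ 0 → m₄ ξ₄ ≠ 0 → ξ₁ + ξ₂ ≠ ξ₃ + ξ₄) :
    ∫ x, (four m₁ x * four m₂ x) * conj (four m₃ x * four m₄ x) = 0 := by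
  have h := integral_four_mul_conj_four (h₁.convolution h₂) (h₃.convolution h₄)
  simp_rw [four_convolution h₁.int h₂.int, four_convolution h₃.int h₄.int] at h
  rw [h]
  have : ∀ ξ, (m₁ ⋆[ContinuousLinearMap.mul ℝ ℂ, volume] m₂) ξ *
      conj ((m₃ ⋆[ContinuousLinearMap.mul ℝ ℂ, volume] m₄) ξ) = 0 := by
    intro ξ
    by_contra hne
    have e1 := support_convolution_subset (ContinuousLinearMap.mul ℝ ℂ) (left_ne_zero_of_mul hne)
    have e2 := support_convolution_subset (ContinuousLinearMap.mul ℝ ℂ)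
      ((map_ne_zero _).1 (right_ne_zero_of_mul hne))
    obtain ⟨a, ha, b, hb, hab⟩ := e1
    obtain ⟨c, hc, d, hd', hcd⟩ := e2
    exact hd a b c d ha hb hc hd' (hab.trans hcd.symm)
  simp [this]

end ConeBergman

/-! ### Geometry of the frequency pieces -/

namespace ConeBergman

open scoped ComplexConjugate

/-- The `L⁴` norm as a real number. -/
def nrm (f : V → ℂ) : ℝ := (eLpNorm f 4 volume).toReal

theorem nrm_nonneg (f : V → ℂ) : 0 ≤ nrm f := ENNReal.toReal_nonneg

theorem nrm_pow_four {f : V → ℂ} (hf : MemLp f 4) : nrm f ^ 4 = ∫ x, ‖f x‖ ^ 4 := by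
  have h := hf.eLpNorm_eq_integral_rpow_norm (by norm_num) (by norm_num)
  have h0 : 0 ≤ ∫ x, ‖f x‖ ^ 4 := integral_nonneg fun x => by positivity
  have e : (∫ x, ‖f x‖ ^ (4 : ℝ≥0∞).toReal) = ∫ x, ‖f x‖ ^ 4 := by
    congr 1; ext x
    simp only [ENNReal.toReal_ofNat]
    exact_mod_cast rfl
  rw [e] at h
  unfold nrm
  rw [h, ENNReal.toReal_ofReal (by positivity), ← Real.rpow_natCast, ← Real.rpow_mul h0]
  simp

theorem nrm_add_le {f g : V → ℂ} (hf : MemLp f 4) (hg : MemLp g 4) :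
    nrm (fun x => f x + g x) ≤ nrm f + nrm g := by
  unfold nrm
  rw [← ENNReal.toReal_add hf.2.ne hg.2.ne]
  refine ENNReal.toReal_mono (ENNReal.add_ne_top.2 ⟨hf.2.ne, hg.2.ne⟩) ?_
  exact eLpNorm_add_le hf.1 hg.1 (by norm_num)

theorem nrm_sum_le {ι : Type*} (s : Finset ι) {f : ι → V → ℂ} (hf : ∀ i ∈ s, MemLp (f i) 4) :
    nrm (fun x => ∑ i ∈ s, f i x) ≤ ∑ i ∈ s, nrm (f i) := by
  classical
  induction s using Finset.induction_on with
  | empty => simp [nrm]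
  | insert a s ha ih =>
    simp only [Finset.sum_insert ha]
    have h2 := ih fun i hi => hf i (Finset.mem_insert_of_mem hi)
    have h3 : MemLp (fun x => ∑ i ∈ s, f i x) 4 :=
      memLp_finsetSum s fun i hi => hf i (Finset.mem_insert_of_mem hi)
    exact (nrm_add_le (hf a (Finset.mem_insert_self _ _)) h3).trans (by gcongr)

theorem integral_sq_mul_sq_le {f g : V → ℂ} (hf : MemLp f 4) (hg : MemLp g 4) :
    ∫ x, ‖f x * g x‖ ^ 2 ≤ nrm f ^ 2 * nrm g ^ 2 := by
  have key : ∀ {f : V → ℂ}, MemLp f 4 → MemLp (fun x => ‖f x‖ ^ 2) (ENNReal.ofReal 2) := by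
    intro f hf
    rw [show ENNReal.ofReal 2 = 2 by simp,
      memLp_two_iff_integrable_sq (f := fun x => ‖f x‖ ^ 2) (hf.1.norm.pow 2)]
    have := hf.integrable_norm_rpow (by norm_num) (by norm_num)
    refine this.congr (Filter.Eventually.of_forall fun x => ?_)
    simp only [ENNReal.toReal_ofNat]
    rw [← pow_mul]
    exact_mod_cast rfl
  have h := integral_mul_le_Lp_mul_Lq_of_nonneg (μ := (volume : Measure V))
    (p := 2) (q := 2) ⟨by norm_num, by norm_num, by norm_num⟩
    (Filter.Eventually.of_forall fun x => by positivity)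
    (Filter.Eventually.of_forall fun x => by positivity) (key hf) (key hg)
  have e : ∀ f : V → ℂ, MemLp f 4 → (∫ x, (‖f x‖ ^ 2) ^ (2 : ℝ)) ^ (1 / 2 : ℝ) = nrm f ^ 2 := by
    intro f hf
    have : (∫ x, (‖f x‖ ^ 2) ^ (2 : ℝ)) = (nrm f ^ 2) ^ 2 := by
      rw [← pow_mul, nrm_pow_four hf]
      congr 1; ext x
      rw [Real.rpow_two, ← pow_mul]
    rw [this, ← Real.sqrt_eq_rpow, Real.sqrt_sq (by positivity)]
  rw [e f hf, e g hg] at h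
  refine le_trans (le_of_eq ?_) h
  congr 1; ext x
  rw [norm_mul, mul_pow]

/-- Square function bound for finitely many pieces whose pairwise sums have finite overlap. -/
theorem nrm_sum_sq_le_of_biorthogonal (S : Finset ℤ) {m : ℤ → V → ℂ} (hm : ∀ b ∈ S, IsAmp (m b))
    (hsep : ∀ b₁ ∈ S, ∀ b₂ ∈ S, ∀ b₃ ∈ S, ∀ b₄ ∈ S, ∀ ξ₁ ξ₂ ξ₃ ξ₄ : V, m b₁ ξ₁ ≠ 0 → m b₂ ξ₂ ≠ 0 →
      m b₃ ξ₃ ≠ 0 → m b₄ ξ₄ ≠ 0 → ξ₁ + ξ₂ = ξ₃ + ξ₄ →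
      (|b₃ - b₁| ≤ 5 ∧ |b₄ - b₂| ≤ 5) ∨ (|b₄ - b₁| ≤ 5 ∧ |b₃ - b₂| ≤ 5)) :
    nrm (fun x => ∑ b ∈ S, four (m b) x) ^ 2 ≤ 16 * ∑ b ∈ S, nrm (four (m b)) ^ 2 := by
  classical
  set H : ℤ × ℤ → V → ℂ := fun α x => four (m α.1) x * four (m α.2) x with hH
  set P := S ×ˢ S with hP
  set a : ℤ × ℤ → ℝ := fun α => ∫ x, ‖H α x‖ ^ 2 with ha
  have ha0 : ∀ α, 0 ≤ a α := fun α => integral_nonneg fun x => by positivity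
  have hal : ∀ α ∈ P, a α ≤ nrm (four (m α.1)) ^ 2 * nrm (four (m α.2)) ^ 2 := by
    intro α hα
    rw [hP, Finset.mem_product] at hα
    exact integral_sq_mul_sq_le (hm _ hα.1).memLp (hm _ hα.2).memLp
  have hHi : ∀ α ∈ P, ∀ β ∈ P, Integrable fun x => H α x * conj (H β x) := by
    intro α hα β hβ
    rw [hP, Finset.mem_product] at hα hβ
    have i1 := (hm _ hα.1).convolution (hm _ hα.2)
    have i2 := (hm _ hβ.1).convolution (hm _ hβ.2)
    have e1 := funext (four_convolution (hm _ hα.1).int (hm _ hα.2).int)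
    have e2 := funext (four_convolution (hm _ hβ.1).int (hm _ hβ.2).int)
    have := i1.int_four.mul_bdd (g := fun x => conj (H β x)) (c := ∫ ξ, ‖_‖)
      (by
        have := i2.int_four.1
        rw [e2] at this
        exact Complex.continuous_conj.comp_aestronglyMeasurable this)
      (Filter.Eventually.of_forall fun x => by
        have := i2.norm_four_le x
        rw [e2] at this
        rw [RCLike.norm_conj]
        exact this)
    rw [e1] at this
    exact this
  have hHsq : ∀ α ∈ P, Integrable fun x => ‖H α x‖ ^ 2 := by
    intro α hα
    refine (hHi α hα α hα).norm.congr (Filter.Eventually.of_forall fun x => ?_)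
    simp [sq]
  set near : ℤ × ℤ → ℤ × ℤ → Prop := fun α β =>
    (|β.1 - α.1| ≤ 5 ∧ |β.2 - α.2| ≤ 5) ∨ (|β.2 - α.1| ≤ 5 ∧ |β.1 - α.2| ≤ 5) with hnear
  have hsym : ∀ α β, near α β ↔ near β α := by
    intro α β
    simp only [hnear, abs_sub_comm α.1, abs_sub_comm α.2]
    tauto
  have hterm : ∀ α ∈ P, ∀ β ∈ P, (∫ x, H α x * conj (H β x)).re ≤
      if near α β then (a α + a β) / 2 else 0 := by
    intro α hα β hβ
    split_ifs with hn
    · have hre := integral_re (hHi α hα β hβ)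
      simp only [RCLike.re_to_complex] at hre
      rw [← hre, ha]
      beta_reduce
      rw [← integral_add (hHsq α hα) (hHsq β hβ), ← integral_div]
      refine integral_mono (hHi α hα β hβ).re (((hHsq α hα).add (hHsq β hβ)).div_const 2) fun x => ?_
      have h1 := Complex.re_le_norm (H α x * conj (H β x))
      rw [norm_mul, RCLike.norm_conj] at h1
      have h2 := two_mul_le_add_sq ‖H α x‖ ‖H β x‖
      linarith
    · rw [hP, Finset.mem_product] at hα hβ
      rw [hH]
      beta_reduce
      rw [integral_four_orthogonal (hm _ hα.1) (hm _ hα.2) (hm _ hβ.1) (hm _ hβ.2)]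
      · simp
      · intro ξ₁ ξ₂ ξ₃ ξ₄ h1 h2 h3 h4 he
        exact hn (hsep _ hα.1 _ hα.2 _ hβ.1 _ hβ.2 ξ₁ ξ₂ ξ₃ ξ₄ h1 h2 h3 h4 he)
  have hcard : ∀ α, ((P.filter (near α)).card : ℝ) ≤ 242 := by
    intro α
    have hsub : P.filter (near α) ⊆
        (Finset.Icc (α.1 - 5) (α.1 + 5) ×ˢ Finset.Icc (α.2 - 5) (α.2 + 5)) ∪
        (Finset.Icc (α.2 - 5) (α.2 + 5) ×ˢ Finset.Icc (α.1 - 5) (α.1 + 5)) := by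
      intro β hβ
      have := (Finset.mem_filter.1 hβ).2
      simp only [hnear, abs_le] at this
      simp only [Finset.mem_union, Finset.mem_product, Finset.mem_Icc]
      omega
    have h1 := (Finset.card_le_card hsub).trans (Finset.card_union_le _ _)
    simp only [Finset.card_product, Int.card_Icc] at h1
    have e1 : ∀ z : ℤ, (z + 5 + 1 - (z - 5)).toNat = 11 := by intro z; omega
    simp only [e1] at h1
    exact_mod_cast h1
  have hmain : nrm (fun x => ∑ b ∈ S, four (m b) x) ^ 4 ≤
      242 * (∑ b ∈ S, nrm (four (m b)) ^ 2) ^ 2 := by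
    rw [nrm_pow_four (memLp_finsetSum S fun b hb => (hm b hb).memLp)]
    have hpt : ∀ x, ‖∑ b ∈ S, four (m b) x‖ ^ 4 =
        (∑ α ∈ P, ∑ β ∈ P, H α x * conj (H β x)).re := by
      intro x
      have h1 : ∑ α ∈ P, H α x = (∑ b ∈ S, four (m b) x) ^ 2 := by
        rw [sq, Finset.sum_mul_sum, hP, Finset.sum_product]
      rw [← Finset.sum_mul_sum, ← map_sum, h1, Complex.mul_conj, ofReal_re, Complex.normSq_eq_norm_sq,
        norm_pow, ← pow_mul]
    simp_rw [hpt]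
    have hi : Integrable fun x => ∑ α ∈ P, ∑ β ∈ P, H α x * conj (H β x) :=
      integrable_finsetSum _ fun α hα => integrable_finsetSum _ fun β hβ => hHi α hα β hβ
    have hre := integral_re hi
    simp only [RCLike.re_to_complex] at hre
    rw [hre, integral_finsetSum _ fun α hα => integrable_finsetSum _ fun β hβ => hHi α hα β hβ]
    have e2 : ∀ α ∈ P, ∫ x, ∑ β ∈ P, H α x * conj (H β x) =
        ∑ β ∈ P, ∫ x, H α x * conj (H β x) := fun α hα =>
      integral_finsetSum _ fun β hβ => hHi α hα β hβ
    rw [Finset.sum_congr rfl e2]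
    simp only [re_sum]
    calc ∑ α ∈ P, ∑ β ∈ P, (∫ x, H α x * conj (H β x)).re
        ≤ ∑ α ∈ P, ∑ β ∈ P, (if near α β then (a α + a β) / 2 else 0) :=
          Finset.sum_le_sum fun α hα => Finset.sum_le_sum fun β hβ => hterm α hα β hβ
      _ = ∑ α ∈ P, ∑ β ∈ P, (if near α β then a α / 2 else 0) +
          ∑ α ∈ P, ∑ β ∈ P, (if near α β then a β / 2 else 0) := by
          rw [← Finset.sum_add_distrib]
          refine Finset.sum_congr rfl fun α _ => ?_
          rw [← Finset.sum_add_distrib]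
          refine Finset.sum_congr rfl fun β _ => ?_
          split_ifs <;> ring
      _ = 2 * ∑ α ∈ P, ∑ β ∈ P, (if near α β then a α / 2 else 0) := by
          rw [two_mul]
          congr 1
          rw [Finset.sum_comm]
          refine Finset.sum_congr rfl fun α _ => Finset.sum_congr rfl fun β _ => ?_
          simp only [hsym β α]
      _ = ∑ α ∈ P, (P.filter (near α)).card * a α := by
          rw [Finset.mul_sum]
          refine Finset.sum_congr rfl fun α _ => ?_
          rw [← Finset.sum_filter, Finset.sum_const, nsmul_eq_mul]
          ring
      _ ≤ ∑ α ∈ P, 242 * (nrm (four (m α.1)) ^ 2 * nrm (four (m α.2)) ^ 2) :=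
          Finset.sum_le_sum fun α hα => mul_le_mul (hcard α) (hal α hα) (ha0 α) (by norm_num)
      _ = 242 * (∑ b ∈ S, nrm (four (m b)) ^ 2) ^ 2 := by
          rw [← Finset.mul_sum, sq, Finset.sum_mul_sum, hP, Finset.sum_product]
  have hS : 0 ≤ ∑ b ∈ S, nrm (four (m b)) ^ 2 := Finset.sum_nonneg fun b _ => by positivity
  refine le_of_sq_le_sq ?_ (by positivity)
  rw [← pow_mul]
  refine hmain.trans ?_
  nlinarith [sq_nonneg (∑ b ∈ S, nrm (four (m b)) ^ 2)]

end ConeBergman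

/-! ### Multiscale decoupling -/

namespace ConeBergman

theorem near_of_sum_eq {M δ : ℝ} (hM : 1 ≤ M) (hδ : δ ≤ 1 / (4 * (M + 2) ^ 2))
    {a₁ a₂ a₃ a₄ u₁ u₂ u₃ u₄ : ℝ} (ha₁ : |a₁ - 1| ≤ δ) (ha₂ : |a₂ - 1| ≤ δ) (ha₃ : |a₃ - 1| ≤ δ)
    (ha₄ : |a₄ - 1| ≤ δ) (hu₁ : |u₁| ≤ M + 1) (hu₂ : |u₂| ≤ M + 1) (hu₃ : |u₃| ≤ M + 1)
    (hu₄ : |u₄| ≤ M + 1) (hb : a₁ * u₁ + a₂ * u₂ = a₃ * u₃ + a₄ * u₄)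
    (hd : |a₁ * u₁ ^ 2 + a₂ * u₂ ^ 2 - a₃ * u₃ ^ 2 - a₄ * u₄ ^ 2| ≤ 15) :
    (|u₁ - u₃| ≤ 7 / 2 ∧ |u₂ - u₄| ≤ 7 / 2) ∨ (|u₁ - u₄| ≤ 7 / 2 ∧ |u₂ - u₃| ≤ 7 / 2) := by
  have six : ∀ x y : ℝ, 0 ≤ x → x ≤ y → x * y ≤ 36 → x ≤ 6 := fun x y _ _ _ => by nlinarith
  have hM2 : 0 < M + 2 := by linarith
  have hδ0 : 0 ≤ δ := (abs_nonneg _).trans ha₁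
  have lin : ∀ {a u : ℝ}, |a - 1| ≤ δ → |u| ≤ M + 1 → |(a - 1) * u| ≤ δ * (M + 1) := by
    intro a u ha hu
    rw [abs_mul]
    exact mul_le_mul ha hu (abs_nonneg _) hδ0
  have quad : ∀ {a u : ℝ}, |a - 1| ≤ δ → |u| ≤ M + 1 → |(a - 1) * u ^ 2| ≤ δ * (M + 1) ^ 2 := by
    intro a u ha hu
    rw [abs_mul, abs_pow]
    exact mul_le_mul ha (pow_le_pow_left₀ (abs_nonneg _) hu 2) (by positivity) hδ0
  have hδ' : δ * (4 * (M + 2) ^ 2) ≤ 1 := by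
    rwa [le_div_iff₀ (by positivity)] at hδ
  have hl : δ * (M + 1) * 4 * (M + 2) ≤ 1 := by nlinarith
  have hq : δ * (M + 1) ^ 2 * 4 ≤ 1 := by nlinarith
  have l₁ := abs_le.1 (lin ha₁ hu₁)
  have l₂ := abs_le.1 (lin ha₂ hu₂)
  have l₃ := abs_le.1 (lin ha₃ hu₃)
  have l₄ := abs_le.1 (lin ha₄ hu₄)
  have q₁ := abs_le.1 (quad ha₁ hu₁)
  have q₂ := abs_le.1 (quad ha₂ hu₂)
  have q₃ := abs_le.1 (quad ha₃ hu₃)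
  have q₄ := abs_le.1 (quad ha₄ hu₄)
  have v₁ := abs_le.1 hu₁
  have v₂ := abs_le.1 hu₂
  have v₃ := abs_le.1 hu₃
  have v₄ := abs_le.1 hu₄
  have hd' := abs_le.1 hd
  have hσ : |(u₁ + u₂) - (u₃ + u₄)| ≤ δ * (M + 1) * 4 := by
    rw [abs_le]; constructor <;> linarith
  have hσ1 : |(u₁ + u₂) - (u₃ + u₄)| ≤ 1 := by
    refine hσ.trans (le_trans ?_ hl)
    exact le_mul_of_one_le_right
      (mul_nonneg (mul_nonneg hδ0 (by linarith)) (by norm_num)) (by linarith)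
  have hsq : |u₁ ^ 2 + u₂ ^ 2 - u₃ ^ 2 - u₄ ^ 2| ≤ 16 := by
    rw [abs_le]; constructor <;> linarith
  have hσ2 : |(u₁ + u₂) ^ 2 - (u₃ + u₄) ^ 2| ≤ 4 := by
    rw [show (u₁ + u₂) ^ 2 - (u₃ + u₄) ^ 2 =
      ((u₁ + u₂) - (u₃ + u₄)) * (u₁ + u₂ + u₃ + u₄) by ring, abs_mul]
    have h1 : |u₁ + u₂ + u₃ + u₄| ≤ 4 * (M + 1) := by
      rw [abs_le]; constructor <;> linarith
    have h2 := mul_le_mul hσ h1 (abs_nonneg _)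
      (mul_nonneg (mul_nonneg hδ0 (by linarith)) (by norm_num))
    linarith
  have hD : |(u₁ - u₂) ^ 2 - (u₃ - u₄) ^ 2| ≤ 36 := by
    have e1 := abs_le.1 hsq
    have e2 := abs_le.1 hσ2
    rw [abs_le]; constructor <;> linarith
  have e1 := abs_le.1 hσ1
  rw [show (u₁ - u₂) ^ 2 - (u₃ - u₄) ^ 2 = ((u₁ - u₂) - (u₃ - u₄)) * ((u₁ - u₂) + (u₃ - u₄)) by ring,
    abs_mul] at hD
  rcases le_total |(u₁ - u₂) - (u₃ - u₄)| |(u₁ - u₂) + (u₃ - u₄)| with h | h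
  · left
    have h6 : |(u₁ - u₂) - (u₃ - u₄)| ≤ 6 := six _ _ (abs_nonneg _) h hD
    have := abs_le.1 h6
    constructor <;> rw [abs_le] <;> constructor <;> linarith
  · right
    have h6 : |(u₁ - u₂) + (u₃ - u₄)| ≤ 6 :=
      six _ _ (abs_nonneg _) h (by rwa [mul_comm])
    have := abs_le.1 h6
    constructor <;> rw [abs_le] <;> constructor <;> linarith

/-- Support condition for pieces of a thin conical shell, in coordinates adapted to the cone. -/
def InPlank (A B D : V →+ ℝ) (δ : ℝ) (l : ℤ) (ξ : V) : Prop :=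
  |A ξ - 1| ≤ δ ∧ ∃ t s : ℝ, B ξ = A ξ * t ∧ D ξ = s + A ξ * t ^ 2 ∧ |t - l| ≤ 1 ∧ 0 ≤ s ∧ s ≤ 15 / 2

theorem nrm_sum_sq_le_of_range {A B D : V →+ ℝ} {δ : ℝ} {M : ℕ} (hM : 2 ≤ M)
    (hδ : δ ≤ 1 / (4 * ((M : ℝ) + 2) ^ 2)) {m : ℤ → V → ℂ} (hm : ∀ l, IsAmp (m l))
    (hP : ∀ l ξ, m l ξ ≠ 0 → InPlank A B D δ l ξ) (n : ℕ) :
    ∀ (T : ℤ) (J : Finset ℤ), (∀ l ∈ J, T ≤ l ∧ l < T + (M : ℤ) ^ n) →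
      nrm (fun x => ∑ l ∈ J, four (m l) x) ^ 2 ≤ 16 ^ n * ∑ l ∈ J, nrm (four (m l)) ^ 2 := by
  classical
  induction n with
  | zero =>
    intro T J hJ
    have hsub : J ⊆ {T} := fun l hl => by
      have := hJ l hl
      simp only [pow_zero] at this
      rw [Finset.mem_singleton]; omega
    rcases Finset.subset_singleton_iff.1 hsub with h | h <;> rw [h] <;> simp [nrm]
  | succ n ih =>
    intro T J hJ
    set L : ℤ := (M : ℤ) ^ n with hL
    have hL1 : 1 ≤ L := by
      have : (1 : ℤ) ≤ M := by omega
      exact one_le_pow₀ this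
    set S := J.image fun l => (l - T) / L with hS
    set Jb : ℤ → Finset ℤ := fun b => J.filter fun l => (l - T) / L = b with hJb
    set μ : ℤ → V → ℂ := fun b ξ => ∑ l ∈ Jb b, m l ξ with hμ
    have hamp : ∀ b, IsAmp (μ b) ∧ four (μ b) = fun x => ∑ l ∈ Jb b, four (m l) x :=
      fun b => IsAmp.sum _ fun l _ => hm l
    have hblk : ∀ b, ∀ l ∈ Jb b, T + b * L ≤ l ∧ l < T + b * L + L := by
      intro b l hl
      have h1 := (Finset.mem_filter.1 hl).2
      have h2 := Int.mul_ediv_add_emod (l - T) L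
      have h3 := Int.emod_nonneg (l - T) (by omega : L ≠ 0)
      have h4 := Int.emod_lt_of_pos (l - T) (by omega : 0 < L)
      rw [h1, mul_comm] at h2
      omega
    have hbM : ∀ b ∈ S, 0 ≤ b ∧ b + 1 ≤ M := by
      intro b hb
      obtain ⟨l, hl, rfl⟩ := Finset.mem_image.1 hb
      have h1 := hJ l hl
      refine ⟨Int.ediv_nonneg (by omega) (by omega), ?_⟩
      have : (l - T) / L < M := by
        rw [Int.ediv_lt_iff_lt_mul (by omega), hL, ← pow_succ']
        omega
      omega
    have hLr : (1 : ℝ) ≤ L := by exact_mod_cast hL1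
    have hMr : (1 : ℝ) ≤ M := by exact_mod_cast (by omega : 1 ≤ M)
    have hpt : ∀ b ∈ S, ∀ ξ, μ b ξ ≠ 0 → |A ξ - 1| ≤ δ ∧ ∃ u s : ℝ,
        B ξ - A ξ * T = L * (A ξ * u) ∧ D ξ - 2 * T * B ξ + T ^ 2 * A ξ = s + L ^ 2 * (A ξ * u ^ 2) ∧
        b - 1 ≤ u ∧ u ≤ b + 1 ∧ 0 ≤ s ∧ s ≤ 15 / 2 := by
      intro b hb ξ hξ
      obtain ⟨l, hl, hlne⟩ := Finset.exists_ne_zero_of_sum_ne_zero hξ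
      obtain ⟨hA, t, s, hBt, hDt, htl, hs0, hs1⟩ := hP l ξ hlne
      have hb' := hblk b l hl
      have h1 : ((T + b * L : ℤ) : ℝ) ≤ l := by exact_mod_cast hb'.1
      have h2 : ((l + 1 : ℤ) : ℝ) ≤ ((T + b * L + L : ℤ) : ℝ) := by
        exact_mod_cast (by omega : l + 1 ≤ T + b * L + L)
      push_cast at h1 h2
      have htl' := abs_le.1 htl
      refine ⟨hA, (t - T) / L, s, ?_, ?_, ?_, ?_, hs0, hs1⟩
      · rw [hBt]; field_simp
      · rw [hDt, hBt]; field_simp; ring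
      · rw [le_div_iff₀ (by linarith)]; nlinarith
      · rw [div_le_iff₀ (by linarith)]; nlinarith
    have hstep := nrm_sum_sq_le_of_biorthogonal S (m := μ) (fun b _ => (hamp b).1) ?_
    · have e1 : (fun x => ∑ l ∈ J, four (m l) x) = fun x => ∑ b ∈ S, four (μ b) x := by
        ext x
        simp only [fun b => (hamp b).2]
        exact (Finset.sum_fiberwise_of_maps_to (fun l hl => Finset.mem_image_of_mem _ hl) _).symm
      rw [e1]
      refine hstep.trans ?_
      rw [pow_succ', mul_assoc]
      refine mul_le_mul_of_nonneg_left ?_ (by norm_num)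
      have e2 : ∑ l ∈ J, nrm (four (m l)) ^ 2 = ∑ b ∈ S, ∑ l ∈ Jb b, nrm (four (m l)) ^ 2 :=
        (Finset.sum_fiberwise_of_maps_to (fun l hl => Finset.mem_image_of_mem _ hl) _).symm
      rw [e2, Finset.mul_sum]
      refine Finset.sum_le_sum fun b _ => ?_
      rw [(hamp b).2]
      exact ih (T + b * L) (Jb b) (hblk b)
    · intro b₁ h₁ b₂ h₂ b₃ h₃ b₄ h₄ ξ₁ ξ₂ ξ₃ ξ₄ n₁ n₂ n₃ n₄ he
      obtain ⟨hA₁, u₁, s₁, B₁, D₁, l₁, r₁, p₁, p₁'⟩ := hpt b₁ h₁ ξ₁ n₁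
      obtain ⟨hA₂, u₂, s₂, B₂, D₂, l₂, r₂, p₂, p₂'⟩ := hpt b₂ h₂ ξ₂ n₂
      obtain ⟨hA₃, u₃, s₃, B₃, D₃, l₃, r₃, p₃, p₃'⟩ := hpt b₃ h₃ ξ₃ n₃
      obtain ⟨hA₄, u₄, s₄, B₄, D₄, l₄, r₄, p₄, p₄'⟩ := hpt b₄ h₄ ξ₄ n₄
      have eA : A ξ₁ + A ξ₂ = A ξ₃ + A ξ₄ := by rw [← map_add, he, map_add]
      have eB : B ξ₁ + B ξ₂ = B ξ₃ + B ξ₄ := by rw [← map_add, he, map_add]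
      have eD : D ξ₁ + D ξ₂ = D ξ₃ + D ξ₄ := by rw [← map_add, he, map_add]
      have hu : ∀ {b : ℤ} {u : ℝ}, b ∈ S → (b : ℝ) - 1 ≤ u → u ≤ b + 1 → |u| ≤ M + 1 := by
        intro b u hb h1 h2
        have h3 := hbM b hb
        have h4 : (0 : ℝ) ≤ b := by exact_mod_cast h3.1
        have h5 : (b : ℝ) + 1 ≤ M := by exact_mod_cast h3.2
        rw [abs_le]; constructor <;> linarith
      have hlin : A ξ₁ * u₁ + A ξ₂ * u₂ = A ξ₃ * u₃ + A ξ₄ * u₄ := by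
        have hL0 : (L : ℝ) ≠ 0 := by positivity
        refine mul_left_cancel₀ hL0 ?_
        linear_combination eB - T * eA - B₁ - B₂ + B₃ + B₄
      have hquad : (L : ℝ) ^ 2 * (A ξ₁ * u₁ ^ 2 + A ξ₂ * u₂ ^ 2 - A ξ₃ * u₃ ^ 2 - A ξ₄ * u₄ ^ 2) =
          s₃ + s₄ - s₁ - s₂ := by
        linear_combination eD - 2 * T * eB + T ^ 2 * eA - D₁ - D₂ + D₃ + D₄
      have hq15 : |A ξ₁ * u₁ ^ 2 + A ξ₂ * u₂ ^ 2 - A ξ₃ * u₃ ^ 2 - A ξ₄ * u₄ ^ 2| ≤ 15 := by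
        have h1 : |(L : ℝ) ^ 2 * (A ξ₁ * u₁ ^ 2 + A ξ₂ * u₂ ^ 2 - A ξ₃ * u₃ ^ 2 - A ξ₄ * u₄ ^ 2)| ≤ 15 := by
          rw [hquad, abs_le]; constructor <;> linarith
        rw [abs_mul, abs_of_pos (by positivity)] at h1
        refine le_trans ?_ h1
        exact le_mul_of_one_le_left (abs_nonneg _) (one_le_pow₀ hLr)
      have fin : ∀ {b c : ℤ} {u v : ℝ}, (b : ℝ) - 1 ≤ u → u ≤ b + 1 → (c : ℝ) - 1 ≤ v → v ≤ c + 1 →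
          |u - v| ≤ 7 / 2 → |c - b| ≤ 5 := by
        intro b c u v h1 h2 h3 h4 h5
        have h6 := abs_le.1 h5
        have h7 : (c : ℝ) - b < 6 := by linarith
        have h8 : (b : ℝ) - c < 6 := by linarith
        have h7' : c - b < 6 := by exact_mod_cast h7
        have h8' : b - c < 6 := by exact_mod_cast h8
        rw [abs_le]; omega
      rcases near_of_sum_eq hMr hδ hA₁ hA₂ hA₃ hA₄ (hu h₁ l₁ r₁) (hu h₂ l₂ r₂) (hu h₃ l₃ r₃)
        (hu h₄ l₄ r₄) hlin hq15 with ⟨e, f⟩ | ⟨e, f⟩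
      · exact Or.inl ⟨fin l₁ r₁ l₃ r₃ e, fin l₂ r₂ l₄ r₄ f⟩
      · exact Or.inr ⟨fin l₁ r₁ l₄ r₄ e, fin l₂ r₂ l₃ r₃ f⟩

theorem nrm_sum_sq_le_of_log {A B D : V →+ ℝ} {δ : ℝ} {M : ℕ} (hM : 2 ≤ M)
    (hδ : δ ≤ 1 / (4 * ((M : ℝ) + 2) ^ 2)) {m : ℤ → V → ℂ} (hm : ∀ l, IsAmp (m l))
    (hP : ∀ l ξ, m l ξ ≠ 0 → InPlank A B D δ l ξ) (n : ℕ) (J : Finset ℤ)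
    (hJ : ∀ l ∈ J, Nat.log M l.natAbs = n) :
    nrm (fun x => ∑ l ∈ J, four (m l) x) ^ 2 ≤ 16 ^ (n + 2) * ∑ l ∈ J, nrm (four (m l)) ^ 2 := by
  refine nrm_sum_sq_le_of_range hM hδ hm hP (n + 2) (-(M : ℤ) ^ (n + 1)) J fun l hl => ?_
  have h1 : l.natAbs < M ^ (n + 1) := by
    rw [← hJ l hl]
    exact Nat.lt_pow_succ_log_self (by omega) _
  have h2 : (l.natAbs : ℤ) < (M : ℤ) ^ (n + 1) := by exact_mod_cast h1
  have h3 : (M : ℤ) ^ (n + 2) = M * (M : ℤ) ^ (n + 1) := by ring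
  have h4 : 2 * (M : ℤ) ^ (n + 1) ≤ M * (M : ℤ) ^ (n + 1) :=
    mul_le_mul_of_nonneg_right (by omega) (by positivity)
  omega

end ConeBergman

/-! ### Decoupling over the lattice -/

namespace ConeBergman

theorem summable_exp_neg_mul_abs_int {c : ℝ} (hc : 0 < c) :
    Summable fun n : ℤ => Real.exp (-(c * |(n : ℝ)|)) := by
  have h : Summable fun n : ℕ => Real.exp (-(c * (n : ℝ))) := by
    have := Real.summable_exp_nat_mul_iff.2 (neg_neg_of_pos hc)
    refine this.congr fun n => ?_
    ring_nf
  rw [summable_int_iff_summable_nat_and_neg]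
  constructor <;> simpa using h

/-- The parameters at which the cone is sampled. -/
def lat (h : ℝ) (j : ℤ × ℤ × ℤ) : Par := (h * j.1, (j.2.2 : ℝ), (j.2.1 : ℝ))

/-- The loss of the square function estimate. -/
def lossW (ε h : ℝ) (j : ℤ × ℤ × ℤ) : ℝ :=
  (1 + |(j.2.2 : ℝ)|) ^ ε * Real.exp (ε * (h * |(j.1 : ℝ)| + |(j.2.1 : ℝ)|))

theorem lossW_pos (ε h : ℝ) (j : ℤ × ℤ × ℤ) : 0 < lossW ε h j := by
  unfold lossW; positivity

/-- The scaled light-ray coordinate. -/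
def plankA (α : ℝ) : V →+ ℝ where
  toFun ξ := ca ξ / Real.exp α ^ 2
  map_zero' := by simp [ca]
  map_add' x y := by simp [ca]; ring

/-- The scaled transversal coordinate. -/
def plankB (α β : ℝ) : V →+ ℝ where
  toFun ξ := cb ξ / (Real.exp α * Real.exp β)
  map_zero' := by simp [cb]
  map_add' x y := by simp [cb]; ring

/-- The second scaled light-ray coordinate. -/
def plankD (β : ℝ) : V →+ ℝ where
  toFun ξ := cd ξ / Real.exp β ^ 2
  map_zero' := by simp [cd]
  map_add' x y := by simp [cd]; ring

theorem inPlank_of_chiG_ne_zero {h δ : ℝ} (hh : 0 < h) (hδ : Real.exp (2 * h) ≤ 1 + δ) {α β : ℝ}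
    {l : ℤ} {ξ : V} (hξ : chiG h (α, (l : ℝ), β) ξ ≠ 0) :
    InPlank (plankA α) (plankB α β) (plankD β) δ l ξ := by
  set η := actT (ginv (α, (l : ℝ), β)) ξ with hη
  obtain ⟨hc, ha, ht, hs⟩ := chi_bounds hh hξ
  rw [← hη] at hc ha ht hs
  have hξη : ξ = actT (α, (l : ℝ), β) η := by rw [hη, actT_actT_ginv]
  have hca := ca_pos hc
  have ea := Real.exp_pos α
  have eb := Real.exp_pos β
  have hA : plankA α ξ = ca η := by
    change ca ξ / _ = _
    rw [hξη, ca_actT]; field_simp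
  have hcb : cb η = ca η * ct η := by unfold ct; field_simp
  have hcd : cd η = cs η + ca η * ct η ^ 2 := by unfold cs ct; field_simp; ring
  have h2h : 1 < Real.exp (2 * h) := Real.one_lt_exp_iff.2 (by linarith)
  refine ⟨?_, ct η + l, cs η, ?_, ?_, ?_, (Real.exp_pos _).le.trans hs.1, hs.2.trans ?_⟩
  · rw [hA, abs_le]
    have h1 := ha.1
    have h2 := ha.2
    refine ⟨?_, by linarith⟩
    have h3 : Real.exp (-(2 * h)) * Real.exp (2 * h) = 1 := by rw [← Real.exp_add]; simp
    nlinarith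
  · rw [hA]
    change cb ξ / _ = _
    rw [hξη, cb_actT, hcb]; field_simp
  · rw [hA]
    change cd ξ / _ = _
    rw [hξη, cd_actT, hcb, hcd]; field_simp; ring
  · rw [add_sub_cancel_right, abs_le]; exact ht
  · have h1 := Real.exp_one_lt_d9
    have : Real.exp 2 = Real.exp 1 ^ 2 := by rw [← Real.exp_nat_mul]; norm_num
    rw [this]
    nlinarith [Real.exp_pos 1]

theorem nrm_sum_sq_le_of_fiber {M : ℕ} (hM : 2 ≤ M) {h : ℝ} (hh : 0 < h)
    (heh : Real.exp (2 * h) ≤ 1 + 1 / (4 * ((M : ℝ) + 2) ^ 2)) {m : ℤ × ℤ × ℤ → V → ℂ}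
    (hm : ∀ j, IsAmp (m j)) (hsupp : ∀ j ξ, m j ξ ≠ 0 → chiG h (lat h j) ξ ≠ 0) {i k : ℤ} {n : ℕ}
    {J : Finset (ℤ × ℤ × ℤ)} (hmem : ∀ j ∈ J, j = (i, k, j.2.2) ∧ Nat.log M j.2.2.natAbs = n) :
    nrm (fun x => ∑ j ∈ J, four (m j) x) ^ 2 ≤ 16 ^ (n + 2) * ∑ j ∈ J, nrm (four (m j)) ^ 2 := by
  classical
  have hinj : Set.InjOn (fun j : ℤ × ℤ × ℤ => j.2.2) J := by
    intro a ha b hb hab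
    rw [(hmem a ha).1, (hmem b hb).1]
    simp only at hab
    rw [hab]
  have hP : ∀ (l : ℤ) (ξ : V), m (i, k, l) ξ ≠ 0 → InPlank (plankA (h * i)) (plankB (h * i) k)
      (plankD k) (1 / (4 * ((M : ℝ) + 2) ^ 2)) l ξ := fun l ξ hne =>
    inPlank_of_chiG_ne_zero hh heh (hsupp (i, k, l) ξ hne)
  have hI : ∀ l ∈ J.image fun j => j.2.2, Nat.log M l.natAbs = n := by
    intro l hl
    obtain ⟨j, hj, rfl⟩ := Finset.mem_image.1 hl
    exact (hmem j hj).2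
  have hlog := nrm_sum_sq_le_of_log hM le_rfl (fun l => hm (i, k, l)) hP n _ hI
  simp only [Finset.sum_image hinj] at hlog
  have e : ∀ j ∈ J, m (i, k, j.2.2) = m j := fun j hj => by rw [← (hmem j hj).1]
  have e1 : ∑ j ∈ J, nrm (four (m (i, k, j.2.2))) ^ 2 = ∑ j ∈ J, nrm (four (m j)) ^ 2 :=
    Finset.sum_congr rfl fun j hj => by rw [e j hj]
  have e2 : (fun x => ∑ j ∈ J, four (m (i, k, j.2.2)) x) = fun x => ∑ j ∈ J, four (m j) x := by
    ext x
    exact Finset.sum_congr rfl fun j hj => by rw [e j hj]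
  rw [e1, e2] at hlog
  exact hlog

theorem exists_decoupling {ε : ℝ} (hε : 0 < ε) : ∃ h > 0, ∃ C > 0, ∀ m : ℤ × ℤ × ℤ → V → ℂ,
    (∀ j, IsAmp (m j)) → (∀ j ξ, m j ξ ≠ 0 → chiG h (lat h j) ξ ≠ 0) → ∀ J : Finset (ℤ × ℤ × ℤ),
      nrm (fun x => ∑ j ∈ J, four (m j) x) ^ 2 ≤
        C * ∑ j ∈ J, lossW ε h j * nrm (four (m j)) ^ 2 := by
  classical
  obtain ⟨M, hM2, hM⟩ : ∃ M : ℕ, 2 ≤ M ∧ (32 : ℝ) ≤ (M : ℝ) ^ ε := by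
    obtain ⟨N, hN⟩ := exists_nat_ge ((32 : ℝ) ^ (1 / ε))
    refine ⟨max 2 N, le_max_left _ _, ?_⟩
    have h1 : (32 : ℝ) ^ (1 / ε) ≤ (max 2 N : ℕ) := hN.trans (by exact_mod_cast le_max_right _ _)
    calc (32 : ℝ) = ((32 : ℝ) ^ (1 / ε)) ^ ε := by
          rw [← Real.rpow_mul (by norm_num), one_div_mul_cancel hε.ne', Real.rpow_one]
      _ ≤ _ := Real.rpow_le_rpow (by positivity) h1 hε.le
  set δ : ℝ := 1 / (4 * ((M : ℝ) + 2) ^ 2) with hδ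
  have hδ0 : 0 < δ := by positivity
  set h : ℝ := Real.log (1 + δ) / 2 with hh
  have hh0 : 0 < h := by
    have := Real.log_pos (by linarith : 1 < 1 + δ)
    positivity
  have heh : Real.exp (2 * h) ≤ 1 + δ := by
    rw [hh, mul_div_cancel₀ _ (by norm_num), Real.exp_log (by positivity)]
  set v : ℤ × ℤ × ℕ → ℝ := fun g => Real.exp (-((ε * h) * |(g.1 : ℝ)|)) *
    (Real.exp (-(ε * |(g.2.1 : ℝ)|)) * (1 / 2 : ℝ) ^ g.2.2) with hv
  have hv0 : ∀ g, 0 < v g := fun g => by rw [hv]; positivity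
  have hvs : Summable v := by
    refine (summable_exp_neg_mul_abs_int (mul_pos hε hh0)).mul_of_nonneg
      (g := fun g : ℤ × ℕ => Real.exp (-(ε * |(g.1 : ℝ)|)) * (1 / 2 : ℝ) ^ g.2)
      ((summable_exp_neg_mul_abs_int hε).mul_of_nonneg (g := fun n : ℕ => (1 / 2 : ℝ) ^ n)
        summable_geometric_two ?_ ?_) ?_ ?_
    all_goals
      intro i
      simp only [Pi.zero_apply]
      positivity
  have hvt : 0 < ∑' g, v g := hvs.tsum_pos (fun g => (hv0 g).le) (0, 0, 0) (hv0 _)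
  refine ⟨h, hh0, (∑' g, v g) * 256, by positivity, fun m hm hsupp J => ?_⟩
  set φ : ℤ × ℤ × ℤ → ℤ × ℤ × ℕ := fun j => (j.1, j.2.1, Nat.log M j.2.2.natAbs) with hφ
  set G := J.image φ with hG
  set Jg : ℤ × ℤ × ℕ → Finset (ℤ × ℤ × ℤ) := fun g => J.filter fun j => φ j = g with hJg
  set F : ℤ × ℤ × ℕ → V → ℂ := fun g x => ∑ j ∈ Jg g, four (m j) x with hF
  have hmaps : ∀ j ∈ J, φ j ∈ G := fun j hj => Finset.mem_image_of_mem _ hj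
  have hgrp : ∀ g, nrm (F g) ^ 2 ≤ 16 ^ (g.2.2 + 2) * ∑ j ∈ Jg g, nrm (four (m j)) ^ 2 := by
    rintro ⟨i, k, n⟩
    have hmem : ∀ j ∈ Jg (i, k, n), j = (i, k, j.2.2) ∧ Nat.log M j.2.2.natAbs = n := by
      intro j hj
      have h1 := (Finset.mem_filter.1 hj).2
      simp only [hφ, Prod.mk.injEq] at h1
      refine ⟨?_, h1.2.2⟩
      rw [← h1.1, ← h1.2.1]
    exact nrm_sum_sq_le_of_fiber hM2 hh0 heh hm hsupp hmem
  have hFm : ∀ g ∈ G, MemLp (F g) 4 := fun g _ =>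
    memLp_finsetSum _ fun j _ => (hm j).memLp
  have e1 : (fun x => ∑ j ∈ J, four (m j) x) = fun x => ∑ g ∈ G, F g x := by
    ext x
    exact (Finset.sum_fiberwise_of_maps_to hmaps _).symm
  have hw : ∀ g, ∀ j ∈ Jg g, (16 : ℝ) ^ (g.2.2 + 2) ≤ v g * (256 * lossW ε h j) := by
    intro g j hj
    have h1 := (Finset.mem_filter.1 hj).2
    rw [← h1]
    simp only [hφ, hv, lossW]
    set n := Nat.log M j.2.2.natAbs with hn
    have hMn : ((M : ℝ) ^ n) ≤ 1 + |(j.2.2 : ℝ)| := by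
      rcases eq_or_ne j.2.2.natAbs 0 with h0 | h0
      · rw [hn, h0]; simp
      · have h2 := Nat.pow_log_le_self M h0
        rw [← hn] at h2
        have h3 : ((M : ℝ) ^ n) ≤ (j.2.2.natAbs : ℝ) := by exact_mod_cast h2
        rw [Nat.cast_natAbs] at h3
        push_cast at h3
        linarith
    have h4 : (32 : ℝ) ^ n ≤ (1 + |(j.2.2 : ℝ)|) ^ ε := by
      calc (32 : ℝ) ^ n ≤ ((M : ℝ) ^ ε) ^ n := pow_le_pow_left₀ (by norm_num) hM n
        _ = ((M : ℝ) ^ n) ^ ε := by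
            rw [← Real.rpow_natCast, ← Real.rpow_natCast, ← Real.rpow_mul (by positivity),
              ← Real.rpow_mul (by positivity), mul_comm]
        _ ≤ _ := Real.rpow_le_rpow (by positivity) hMn hε.le
    have h5 : Real.exp (-(ε * h * |(j.1 : ℝ)|)) * Real.exp (-(ε * |(j.2.1 : ℝ)|)) *
        Real.exp (ε * (h * |(j.1 : ℝ)| + |(j.2.1 : ℝ)|)) = 1 := by
      rw [← Real.exp_add, ← Real.exp_add, ← Real.exp_zero]
      congr 1; ring
    calc (16 : ℝ) ^ (n + 2) = 256 * ((1 / 2 : ℝ) ^ n * 32 ^ n) := by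
          rw [← mul_pow, pow_add]; norm_num; ring
      _ ≤ 256 * ((1 / 2 : ℝ) ^ n * (1 + |(j.2.2 : ℝ)|) ^ ε) := by gcongr
      _ = _ := by
          linear_combination (-256 * ((1 / 2 : ℝ) ^ n * (1 + |(j.2.2 : ℝ)|) ^ ε)) * h5
  have hcs := Finset.sum_sq_le_sum_mul_sum_of_sq_le_mul G (r := fun g => nrm (F g)) (f := v)
    (g := fun g => 256 * ∑ j ∈ Jg g, lossW ε h j * nrm (four (m j)) ^ 2)
    (fun g _ => (hv0 g).le)
    (fun g _ => mul_nonneg (by norm_num) (Finset.sum_nonneg fun j _ =>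
      mul_nonneg (lossW_pos _ _ _).le (sq_nonneg _)))
    (fun g _ => by
      refine (hgrp g).trans ?_
      rw [Finset.mul_sum, Finset.mul_sum, Finset.mul_sum]
      refine Finset.sum_le_sum fun j hj => ?_
      have := mul_le_mul_of_nonneg_right (hw g j hj) (sq_nonneg (nrm (four (m j))))
      linarith)
  have e3 : ∑ g ∈ G, 256 * ∑ j ∈ Jg g, lossW ε h j * nrm (four (m j)) ^ 2 =
      256 * ∑ j ∈ J, lossW ε h j * nrm (four (m j)) ^ 2 := by
    rw [← Finset.mul_sum]
    congr 1
    exact Finset.sum_fiberwise_of_maps_to hmaps _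
  rw [e3] at hcs
  have hpos : 0 ≤ ∑ j ∈ J, lossW ε h j * nrm (four (m j)) ^ 2 := Finset.sum_nonneg fun j _ =>
      mul_nonneg (lossW_pos _ _ _).le (sq_nonneg _)
  rw [e1]
  calc nrm (fun x => ∑ g ∈ G, F g x) ^ 2 ≤ (∑ g ∈ G, nrm (F g)) ^ 2 :=
        pow_le_pow_left₀ (nrm_nonneg _) (nrm_sum_le G hFm) 2
    _ ≤ (∑ g ∈ G, v g) * (256 * ∑ j ∈ J, lossW ε h j * nrm (four (m j)) ^ 2) := hcs
    _ ≤ (∑' g, v g) * (256 * ∑ j ∈ J, lossW ε h j * nrm (four (m j)) ^ 2) := by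
        refine mul_le_mul_of_nonneg_right ?_ (by positivity)
        exact hvs.sum_le_tsum G fun g _ => (hv0 g).le
    _ = _ := by ring

end ConeBergman

/-! ### Expansion of the Bergman kernel -/

namespace ConeBergman

theorem hasSum_prod_of_nonneg {β γ : Type*} {f : β × γ → ℝ} (hf : 0 ≤ f) {g : β → ℝ} {a : ℝ}
    (h1 : ∀ b, HasSum (fun c => f (b, c)) (g b)) (h2 : HasSum g a) : HasSum f a := by
  have hs : Summable f := by
    rw [summable_prod_of_nonneg hf]
    refine ⟨fun b => (h1 b).summable, ?_⟩
    simp only [fun b => (h1 b).tsum_eq]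
    exact h2.summable
  have := hs.hasSum.prod_fiberwise h1
  rw [h2.unique this]
  exact hs.hasSum

theorem hasSum_chiG {h : ℝ} (hh : 0 < h) {ξ : V} (hξ : ξ ∈ lightCone 3) :
    HasSum (fun j => chiG h (lat h j) ξ) 1 := by
  have hca := ca_pos hξ
  have hcs := cs_pos hξ
  have key : ∀ i k l : ℤ, chiG h (lat h (i, k, l)) ξ = bump (Real.log (ca ξ) / (2 * h) - i) *
      (bump (Real.log (cs ξ) / 2 - k) * bump (Real.exp (h * i - k) * ct ξ - l)) := by
    intro i k l
    have hη : actT (ginv (lat h (i, k, l))) ξ ∈ lightCone 3 := actT_mem _ hξ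
    rw [chiG, chi, indicator_of_mem hη, ca_actT, cs_actT _ hξ, ct_actT _ hξ]
    have e1 : Real.log (Real.exp (ginv (lat h (i, k, l))).1 ^ 2 * ca ξ) / (2 * h) =
        Real.log (ca ξ) / (2 * h) - i := by
      rw [Real.log_mul (by positivity) hca.ne', Real.log_pow, Real.log_exp]
      simp only [ginv, lat]
      field_simp
      push_cast; ring
    have e2 : Real.log (Real.exp (ginv (lat h (i, k, l))).2.2 ^ 2 * cs ξ) / 2 =
        Real.log (cs ξ) / 2 - k := by
      rw [Real.log_mul (by positivity) hcs.ne', Real.log_pow, Real.log_exp]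
      simp only [ginv, lat]
      push_cast; ring
    have e3 : Real.exp ((ginv (lat h (i, k, l))).2.2 - (ginv (lat h (i, k, l))).1) *
        (ct ξ + (ginv (lat h (i, k, l))).2.1) = Real.exp (h * i - k) * ct ξ - l := by
      simp only [ginv, lat]
      have : Real.exp (h * i - k) * Real.exp (k - h * i) = 1 := by
        rw [← Real.exp_add]; simp
      rw [show -(k : ℝ) - -(h * i) = h * i - k by ring]
      linear_combination (-(l : ℝ)) * this
    rw [e1, e2, e3, mul_assoc]
  refine hasSum_prod_of_nonneg (fun j => chiG_nonneg _ _ _)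
    (g := fun i : ℤ => bump (Real.log (ca ξ) / (2 * h) - i)) (fun i => ?_) (hasSum_bump _)
  refine hasSum_prod_of_nonneg (fun j => chiG_nonneg _ _ _)
    (g := fun k : ℤ => bump (Real.log (ca ξ) / (2 * h) - i) * bump (Real.log (cs ξ) / 2 - k))
    (fun k => ?_) ?_
  · simp only [key, ← mul_assoc]
    simpa using (hasSum_bump (Real.exp (h * i - k) * ct ξ)).mul_left
      (bump (Real.log (ca ξ) / (2 * h) - i) * bump (Real.log (cs ξ) / 2 - k))
  · simpa using (hasSum_bump (Real.log (cs ξ) / 2)).mul_left (bump (Real.log (ca ξ) / (2 * h) - i))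

theorem hasSum_chiG_mul_lapW {h : ℝ} (hh : 0 < h) (s : ℝ) (y ξ : V) :
    HasSum (fun j => chiG h (lat h j) ξ * lapW s y ξ) (lapW s y ξ) := by
  by_cases hξ : ξ ∈ lightCone 3
  · simpa using (hasSum_chiG hh hξ).mul_right (lapW s y ξ)
  · have : lapW s y ξ = 0 := indicator_of_notMem hξ _
    simp [this]

/-- The Bergman kernel in terms of real and imaginary parts. -/
def bker (s : ℝ) (y x : V) : ℂ := lorentzQC 3 (cpt y x) ^ ((-(s + 3 / 2) : ℝ) : ℂ)

theorem hasSum_ker {h : ℝ} (hh : 0 < h) {s : ℝ} (hs : -1 < s) {y : V}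
    (hy : y ∈ lightCone 3) (x : V) :
    HasSum (fun j => ker h s (lat h j) y x) ((lapC s : ℂ) * bker s y x) := by
  unfold bker
  rw [← integral_lapW_cexp hs hy x]
  unfold ker four
  have hc : Continuous fun ξ => cexp ((pr x ξ : ℂ) * I) := by
    have := continuous_pr_left x
    fun_prop
  refine hasSum_integral_of_dominated_convergence
    (fun j ξ => chiG h (lat h j) ξ * lapW s y ξ) (fun j => ?_) (fun j => ?_) ?_ ?_ ?_
  · refine AEStronglyMeasurable.mul ?_ hc.aestronglyMeasurable
    have h1 := (continuous_chiG hh (lat h j)).measurable.mul (measurable_lapW s y)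
    exact (Complex.measurable_ofReal.comp h1).aestronglyMeasurable
  · refine Filter.Eventually.of_forall fun ξ => ?_
    rw [norm_mul, Complex.norm_exp_ofReal_mul_I, mul_one, Complex.norm_real, Real.norm_of_nonneg]
    exact mul_nonneg (chiG_nonneg _ _ _) (lapW_nonneg _ _ _)
  · exact Filter.Eventually.of_forall fun ξ => (hasSum_chiG_mul_lapW hh s y ξ).summable
  · simp only [fun ξ => (hasSum_chiG_mul_lapW hh s y ξ).tsum_eq]
    exact integrable_lapW hs hy
  · refine Filter.Eventually.of_forall fun ξ => ?_
    exact (Complex.hasSum_ofReal.2 (hasSum_chiG_mul_lapW hh s y ξ)).mul_right _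

end ConeBergman

/-! ### Slices -/

namespace ConeBergman

theorem add_mem_cone {y v : V} (hy : y ∈ lightCone 3) (hv : v ∈ lightCone 3) :
    y + v ∈ lightCone 3 := by
  rw [mem_cone] at *
  obtain ⟨h1, h2⟩ := hy
  obtain ⟨h3, h4⟩ := hv
  simp only [Pi.add_apply]
  refine ⟨by linarith, ?_⟩
  have h5 : (y 1 * v 1 + y 2 * v 2) ^ 2 < (y 0 * v 0) ^ 2 := by
    have e1 : (y 1 * v 1 + y 2 * v 2) ^ 2 ≤ (y 1 ^ 2 + y 2 ^ 2) * (v 1 ^ 2 + v 2 ^ 2) := by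
      linarith [sq_nonneg (y 1 * v 2 - y 2 * v 1)]
    have e2 : (y 1 ^ 2 + y 2 ^ 2) * (v 1 ^ 2 + v 2 ^ 2) < y 0 ^ 2 * v 0 ^ 2 :=
      mul_lt_mul'' (by linarith) (by linarith) (by positivity) (by positivity)
    rw [mul_pow]; linarith
  have h6 := abs_lt_of_sq_lt_sq h5 (by positivity)
  rw [abs_lt] at h6
  linarith [h6.2]

/-- The mixed-norm slice of a density on the tube. -/
def sl (H : V × V → ℂ) (v : V) : ℝ≥0∞ := (∫⁻ u, ‖H (u, v)‖ₑ ^ (4 : ℝ)) ^ (1 / (4 : ℝ))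

theorem measurable_sl {H : V × V → ℂ} (hH : Measurable H) : Measurable (sl H) := by
  unfold sl
  refine Measurable.pow_const ?_ _
  refine Measurable.lintegral_prod_right' (f := fun w : V × V => ‖H (w.2, w.1)‖ₑ ^ (4 : ℝ)) ?_
  exact ((hH.comp measurable_swap).enorm).pow_const _

theorem sl_eq_zero {H : V × V → ℂ} (h0 : ∀ u, ∀ v ∉ lightCone 3, H (u, v) = 0) {v : V}
    (hv : v ∉ lightCone 3) : sl H v = 0 := by
  simp [sl, h0 _ v hv]

/-- The exponential average of the slices at scale `g`. -/
def slAvg (c : ℝ) (g : Par) (H : V × V → ℂ) : ℝ≥0∞ :=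
  ∫⁻ v, ENNReal.ofReal (Real.exp (-(c * act g v 0))) * sl H v

/-- The uniform kernel bound. -/
def KerBound (h s C c : ℝ) : Prop := ∀ g : Par, ∀ y ∈ lightCone 3, ∀ p : ℝ, 1 ≤ p →
  (∫⁻ x, ‖ker h s g y x‖ₑ ^ p) ^ (1 / p) ≤
    ENNReal.ofReal (C * mult g ^ (2 * s + 3 - 3 / p) * Real.exp (-(c * act g y 0)))

theorem measurable_ker_comp {α : Type*} [MeasurableSpace α] {h : ℝ} (hh : 0 < h) (s : ℝ) (g : Par)
    {y x : α → V} (hy : Measurable y) (hx : Measurable x) :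
    Measurable fun z => ker h s g (e₀ + y z) (x z) :=
  (measurable_ker hh s g).comp (f := fun z => (e₀ + y z, x z)) ((hy.const_add e₀).prodMk hx)

theorem KerBound.mul_sl_le {h s C c : ℝ} (hK : KerBound h s C c) (hC : 0 < C) (g : Par) {p : ℝ}
    (hp : 1 ≤ p) {H : V × V → ℂ} (h0 : ∀ u, ∀ v ∉ lightCone 3, H (u, v) = 0) (v : V) :
    (∫⁻ x, ‖ker h s g (e₀ + v) x‖ₑ ^ p) ^ (1 / p) * sl H v ≤
      ENNReal.ofReal (C * mult g ^ (2 * s + 3 - 3 / p) * Real.exp (-(c * act g e₀ 0))) *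
        (ENNReal.ofReal (Real.exp (-(c * act g v 0))) * sl H v) := by
  by_cases hv : v ∈ lightCone 3
  · have hm := mult_pos g
    rw [← mul_assoc, ← ENNReal.ofReal_mul (by positivity), mul_assoc, ← Real.exp_add,
      show -(c * act g e₀ 0) + -(c * act g v 0) = -(c * act g (e₀ + v) 0) by
        rw [act_add, Pi.add_apply]; ring]
    gcongr
    exact hK g _ (add_mem_cone e₀_mem hv) p hp
  · simp [sl_eq_zero h0 hv]

theorem KerBound.lintegral_mul_le {h s C c : ℝ} (hh : 0 < h) (hK : KerBound h s C c) (hC : 0 < C)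
    (g : Par) {H : V × V → ℂ} (hH : Measurable H) (h0 : ∀ u, ∀ v ∉ lightCone 3, H (u, v) = 0)
    (x : V) :
    ∫⁻ w : V × V, ‖ker h s g (e₀ + w.2) (x - w.1)‖ₑ * ‖H w‖ₑ ≤
      ENNReal.ofReal (C * mult g ^ (2 * s + 3 / 4) * Real.exp (-(c * act g e₀ 0))) *
        slAvg c g H := by
  have hk : Measurable fun w : V × V => ker h s g (e₀ + w.2) (x - w.1) :=
    measurable_ker_comp hh s g measurable_snd (measurable_fst.const_sub x)
  have hm : Measurable fun w : V × V => ‖ker h s g (e₀ + w.2) (x - w.1)‖ₑ * ‖H w‖ₑ :=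
    hk.enorm.mul hH.enorm
  rw [show (volume : Measure (V × V)) = (volume : Measure V).prod volume from rfl,
    lintegral_prod_symm' _ hm, slAvg, ← lintegral_const_mul]
  · refine lintegral_mono fun v => ?_
    have := hK.mul_sl_le hC g (p := 4 / 3) (by norm_num) h0 v
    rw [show 2 * s + 3 - 3 / (4 / 3) = 2 * s + 3 / 4 by ring] at this
    refine le_trans ?_ this
    have hpq : (4 / 3 : ℝ).HolderConjugate 4 := by
      rw [Real.holderConjugate_iff]; norm_num
    have h1 := ENNReal.lintegral_mul_le_Lp_mul_Lq volume hpq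
      (f := fun u => ‖ker h s g (e₀ + v) (x - u)‖ₑ) (g := fun u => ‖H (u, v)‖ₑ)
      (measurable_ker_comp hh s g measurable_const (measurable_id.const_sub x)).enorm.aemeasurable
      (hH.comp (measurable_prodMk_right (y := v))).enorm.aemeasurable
    refine h1.trans_eq ?_
    rw [lintegral_sub_left_eq_self (fun u => ‖ker h s g (e₀ + v) u‖ₑ ^ (4 / 3 : ℝ)) x, sl]
  · refine Measurable.mul ?_ (measurable_sl hH)
    have := (continuous_act g).measurable
    fun_prop

theorem KerBound.lintegral_lintegral_mul_pow_le {h s C c : ℝ} (hh : 0 < h) (hK : KerBound h s C c)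
    (hC : 0 < C) (g : Par) {H : V × V → ℂ} (hH : Measurable H)
    (h0 : ∀ u, ∀ v ∉ lightCone 3, H (u, v) = 0) :
    (∫⁻ x, (∫⁻ w : V × V, ‖ker h s g (e₀ + w.2) (x - w.1)‖ₑ * ‖H w‖ₑ) ^ (4 : ℝ)) ^ (1 / (4 : ℝ)) ≤
      ENNReal.ofReal (C * mult g ^ (2 * s) * Real.exp (-(c * act g e₀ 0))) * slAvg c g H := by
  have hker : Measurable fun w : V × V => ker h s g (e₀ + w.2) w.1 :=
    measurable_ker_comp hh s g measurable_snd measurable_fst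
  have hHx : Measurable fun z : V × (V × V) => H (z.1 - z.2.1, z.2.2) :=
    hH.comp ((measurable_fst.sub (measurable_fst.comp measurable_snd)).prodMk
      (measurable_snd.comp measurable_snd))
  have hsub : ∀ x, ∫⁻ w : V × V, ‖ker h s g (e₀ + w.2) (x - w.1)‖ₑ * ‖H w‖ₑ =
      ∫⁻ w : V × V, ‖ker h s g (e₀ + w.2) w.1‖ₑ * ‖H (x - w.1, w.2)‖ₑ := by
    intro x
    have hk : Measurable fun w : V × V => ‖ker h s g (e₀ + w.2) (x - w.1)‖ₑ * ‖H w‖ₑ :=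
      (measurable_ker_comp hh s g measurable_snd (measurable_fst.const_sub x)).enorm.mul hH.enorm
    have hk' : Measurable fun w : V × V => ‖ker h s g (e₀ + w.2) w.1‖ₑ * ‖H (x - w.1, w.2)‖ₑ :=
      hker.enorm.mul (hHx.comp (measurable_prodMk_left (x := x))).enorm
    rw [show (volume : Measure (V × V)) = (volume : Measure V).prod volume from rfl,
      lintegral_prod_symm' _ hk, lintegral_prod_symm' _ hk']
    refine lintegral_congr fun v => ?_
    rw [← lintegral_sub_left_eq_self _ x]
    simp
  simp only [hsub]
  have hF : Measurable (Function.uncurry fun (x : V) (w : V × V) =>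
      ‖ker h s g (e₀ + w.2) w.1‖ₑ * ‖H (x - w.1, w.2)‖ₑ) :=
    ((hker.comp measurable_snd).enorm).mul hHx.enorm
  have hM := lintegral_lintegral_rpow_le (μ := (volume : Measure V))
    (ρ := (volume : Measure (V × V))) hF (p := 4) (by norm_num)
  refine (ENNReal.rpow_le_rpow hM (by norm_num)).trans ?_
  rw [← ENNReal.rpow_mul, show (4 : ℝ) * (1 / 4) = 1 by norm_num, ENNReal.rpow_one]
  have hin : ∀ w : V × V, (∫⁻ x, (‖ker h s g (e₀ + w.2) w.1‖ₑ * ‖H (x - w.1, w.2)‖ₑ) ^ (4 : ℝ)) ^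
      (1 / (4 : ℝ)) = ‖ker h s g (e₀ + w.2) w.1‖ₑ * sl H w.2 := by
    intro w
    simp only [ENNReal.mul_rpow_of_nonneg _ _ (show (0 : ℝ) ≤ 4 by norm_num)]
    rw [lintegral_const_mul, ENNReal.mul_rpow_of_nonneg _ _ (by norm_num), ← ENNReal.rpow_mul,
      show (4 : ℝ) * (1 / 4) = 1 by norm_num, ENNReal.rpow_one,
      lintegral_sub_right_eq_self (fun x => ‖H (x, w.2)‖ₑ ^ (4 : ℝ)) w.1, sl]
    exact ((hHx.comp (measurable_prodMk_right (y := w))).enorm).pow_const _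
  simp only [hin]
  have hks : Measurable fun w : V × V => ‖ker h s g (e₀ + w.2) w.1‖ₑ * sl H w.2 :=
    hker.enorm.mul ((measurable_sl hH).comp measurable_snd)
  rw [show (volume : Measure (V × V)) = (volume : Measure V).prod volume from rfl,
    lintegral_prod_symm' _ hks, slAvg,
    ← lintegral_const_mul]
  · refine lintegral_mono fun v => ?_
    have := hK.mul_sl_le hC g (p := 1) le_rfl h0 v
    simp only [ENNReal.rpow_one, div_one, add_sub_cancel_right] at this
    refine le_trans (le_of_eq ?_) this
    dsimp only
    rw [lintegral_mul_const]
    exact (measurable_ker_comp hh s g measurable_const measurable_id).enorm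
  · refine Measurable.mul ?_ (measurable_sl hH)
    have := (continuous_act g).measurable
    fun_prop

end ConeBergman

/-! ### Pieces of the operator -/

namespace ConeBergman

theorem chiG_mul_lapW (h s : ℝ) (g : Par) (y ξ : V) : chiG h g ξ * lapW s y ξ =
    mult g ^ (2 * s) * (chi h (actT (ginv g) ξ) * lorentzQ 3 (actT (ginv g) ξ) ^ s *
      Real.exp (-pr (act g y) (actT (ginv g) ξ))) := by
  rw [← chi_mul_lapW, chiG]
  have := lapW_actT s g y (actT (ginv g) ξ)
  rw [actT_actT_ginv] at this
  rw [this]; ring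

theorem continuous_chiG_mul_lapW {h : ℝ} (hh : 0 < h) (s : ℝ) (g : Par) :
    Continuous fun w : V × V => chiG h g w.2 * lapW s w.1 w.2 := by
  simp only [chiG_mul_lapW]
  have h1 : Continuous fun w : V × V => chi h (actT (ginv g) w.2) *
      lorentzQ 3 (actT (ginv g) w.2) ^ s :=
    (contDiff_chi_mul_rpow hh s (n := 0)).continuous.comp
      ((continuous_actT (ginv g)).comp continuous_snd)
  have h2 : Continuous fun w : V × V => pr (act g w.1) (actT (ginv g) w.2) := by
    simp only [pr_act, actT_actT_ginv]
    unfold pr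
    fun_prop
  exact continuous_const.mul (h1.mul (Real.continuous_exp.comp h2.neg))

theorem chiG_mul_lapW_nonneg (h s : ℝ) (g : Par) (y ξ : V) : 0 ≤ chiG h g ξ * lapW s y ξ :=
  mul_nonneg (chiG_nonneg _ _ _) (lapW_nonneg _ _ _)

theorem chiG_mul_lapW_add_le (h s : ℝ) (g : Par) {v : V} (hv : v ∈ lightCone 3) (ξ : V) :
    chiG h g ξ * lapW s (e₀ + v) ξ ≤ chiG h g ξ * lapW s e₀ ξ := by
  refine mul_le_mul_of_nonneg_left ?_ (chiG_nonneg _ _ _)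
  by_cases hξ : ξ ∈ lightCone 3
  · rw [lapW, lapW, indicator_of_mem hξ, indicator_of_mem hξ, pr_add_left]
    refine mul_le_mul_of_nonneg_left (Real.exp_le_exp.2 ?_) (Real.rpow_nonneg hξ.2.le _)
    linarith [pr_pos hv hξ]
  · rw [lapW, lapW, indicator_of_notMem hξ, indicator_of_notMem hξ]

theorem continuous_chiG_mul_lapW_e₀ {h : ℝ} (hh : 0 < h) (s : ℝ) (g : Par) :
    Continuous fun ξ => chiG h g ξ * lapW s e₀ ξ :=
  (continuous_chiG_mul_lapW hh s g).comp (continuous_const.prodMk continuous_id)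

/-- The frequency-localised piece of the Bergman operator at height `e₀`. -/
def piece (h s : ℝ) (g : Par) (H : V × V → ℂ) (x : V) : ℂ :=
  ∫ w : V × V, ker h s g (e₀ + w.2) (x - w.1) * H w

/-- The integrand of the amplitude of a piece. -/
def pieceKer (h s : ℝ) (g : Par) (H : V × V → ℂ) (ξ : V) (w : V × V) : ℂ :=
  ((chiG h g ξ * lapW s (e₀ + w.2) ξ : ℝ) : ℂ) * cexp (-((pr w.1 ξ : ℂ) * I)) * H w

/-- The amplitude of a piece. -/
def pieceAmp (h s : ℝ) (g : Par) (H : V × V → ℂ) (ξ : V) : ℂ :=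
  ∫ w : V × V, pieceKer h s g H ξ w

theorem norm_pieceKer_le (h s : ℝ) (g : Par) {H : V × V → ℂ}
    (h0 : ∀ u, ∀ v ∉ lightCone 3, H (u, v) = 0) (ξ : V) (w : V × V) :
    ‖pieceKer h s g H ξ w‖ ≤ chiG h g ξ * lapW s e₀ ξ * ‖H w‖ := by
  by_cases hv : w.2 ∈ lightCone 3
  · rw [pieceKer, norm_mul, norm_mul, ← neg_mul, ← ofReal_neg, norm_exp_ofReal_mul_I, mul_one,
      norm_real, Real.norm_of_nonneg (chiG_mul_lapW_nonneg _ _ _ _ _)]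
    gcongr ?_ * _
    exact chiG_mul_lapW_add_le h s g hv ξ
  · have : H w = 0 := h0 w.1 w.2 hv
    simp [pieceKer, this]

theorem continuous_pieceKer_coeff {h : ℝ} (hh : 0 < h) (s : ℝ) (g : Par) :
    Continuous fun z : V × (V × V) => ((chiG h g z.1 * lapW s (e₀ + z.2.2) z.1 : ℝ) : ℂ) *
      cexp (-((pr z.2.1 z.1 : ℂ) * I)) := by
  have h1 : Continuous fun z : V × (V × V) => chiG h g z.1 * lapW s (e₀ + z.2.2) z.1 :=
    (continuous_chiG_mul_lapW hh s g).comp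
      (f := fun z : V × (V × V) => (e₀ + z.2.2, z.1)) (by fun_prop)
  have h2 : Continuous fun z : V × (V × V) => pr z.2.1 z.1 := by unfold pr; fun_prop
  fun_prop

theorem integrable_pieceKer_prod {h : ℝ} (hh : 0 < h) (s : ℝ) (g : Par) {H : V × V → ℂ}
    (hH : Integrable H) (h0 : ∀ u, ∀ v ∉ lightCone 3, H (u, v) = 0) :
    Integrable (Function.uncurry (pieceKer h s g H)) (volume.prod volume) := by
  have hc : Integrable fun ξ => chiG h g ξ * lapW s e₀ ξ :=
    (continuous_chiG_mul_lapW_e₀ hh s g).integrable_of_hasCompactSupport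
      ((hasCompactSupport_chiG hh g).mul_right)
  refine (hc.mul_prod hH.norm).mono' ?_ (Filter.Eventually.of_forall fun z =>
    norm_pieceKer_le h s g h0 z.1 z.2)
  exact (continuous_pieceKer_coeff hh s g).aestronglyMeasurable.mul hH.1.comp_snd

theorem continuous_pieceAmp {h : ℝ} (hh : 0 < h) (s : ℝ) (g : Par) {H : V × V → ℂ}
    (hH : Integrable H) (h0 : ∀ u, ∀ v ∉ lightCone 3, H (u, v) = 0) :
    Continuous (pieceAmp h s g H) := by
  obtain ⟨B, hB⟩ := (continuous_chiG_mul_lapW_e₀ hh s g).bounded_above_of_compact_support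
    ((hasCompactSupport_chiG hh g).mul_right)
  refine continuous_of_dominated (bound := fun w => B * ‖H w‖) (fun ξ => ?_) (fun ξ => ?_)
    (hH.norm.const_mul B) (Filter.Eventually.of_forall fun w => ?_)
  · exact ((continuous_pieceKer_coeff hh s g).comp
      (Continuous.prodMk_right ξ)).aestronglyMeasurable.mul hH.1
  · refine Filter.Eventually.of_forall fun w => (norm_pieceKer_le h s g h0 ξ w).trans ?_
    gcongr
    exact (Real.le_norm_self _).trans (hB ξ)
  · exact ((continuous_pieceKer_coeff hh s g).comp (Continuous.prodMk_left w)).mul continuous_const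

theorem pieceAmp_eq_zero {h s : ℝ} {g : Par} {H : V × V → ℂ} {ξ : V} (hξ : chiG h g ξ = 0) :
    pieceAmp h s g H ξ = 0 := by
  simp [pieceAmp, pieceKer, hξ]

theorem four_pieceAmp {h : ℝ} (hh : 0 < h) (s : ℝ) (g : Par) {H : V × V → ℂ}
    (hH : Integrable H) (h0 : ∀ u, ∀ v ∉ lightCone 3, H (u, v) = 0) :
    four (pieceAmp h s g H) = piece h s g H := by
  ext x
  unfold four piece pieceAmp
  have hc : Continuous fun z : V × (V × V) => cexp ((pr x z.1 : ℂ) * I) := by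
    unfold pr; fun_prop
  have hi : Integrable (Function.uncurry fun (ξ : V) (w : V × V) =>
      pieceKer h s g H ξ w * cexp ((pr x ξ : ℂ) * I)) (volume.prod volume) :=
    (integrable_pieceKer_prod hh s g hH h0).mul_bdd (c := 1) hc.aestronglyMeasurable
      (Filter.Eventually.of_forall fun z => by rw [norm_exp_ofReal_mul_I])
  simp only [← integral_mul_const]
  rw [integral_integral_swap hi]
  refine integral_congr_ae (Filter.Eventually.of_forall fun w => ?_)
  dsimp only
  rw [ker, four, ← integral_mul_const]
  refine integral_congr_ae (Filter.Eventually.of_forall fun ξ => ?_)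
  dsimp only
  rw [pieceKer, pr_sub_left, ofReal_sub, sub_mul, sub_eq_add_neg, Complex.exp_add]
  ring

theorem enorm_piece_le (h s : ℝ) (g : Par) (H : V × V → ℂ) (x : V) : ‖piece h s g H x‖ₑ ≤
    ∫⁻ w : V × V, ‖ker h s g (e₀ + w.2) (x - w.1)‖ₑ * ‖H w‖ₑ := by
  refine (enorm_integral_le_lintegral_enorm _).trans_eq (lintegral_congr fun w => ?_)
  rw [enorm_mul]

theorem KerBound.isAmp {h s C c : ℝ} (hh : 0 < h) (hK : KerBound h s C c) (hC : 0 < C) (hc : 0 < c)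
    (g : Par) {H : V × V → ℂ} (hHm : Measurable H) (hH : Integrable H)
    (h0 : ∀ u, ∀ v ∉ lightCone 3, H (u, v) = 0) : IsAmp (pieceAmp h s g H) := by
  have hcont := continuous_pieceAmp hh s g hH h0
  have hcpt : HasCompactSupport (pieceAmp h s g H) :=
    (hasCompactSupport_chiG hh g).mono fun ξ hξ hz => hξ (pieceAmp_eq_zero hz)
  refine ⟨hcont, hcpt,
    (continuous_four (hcont.integrable_of_hasCompactSupport hcpt)).aestronglyMeasurable, ?_⟩
  rw [four_pieceAmp hh s g hH h0]
  have hm : Measurable (Function.uncurry fun (x : V) (w : V × V) =>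
      ‖ker h s g (e₀ + w.2) (x - w.1)‖ₑ * ‖H w‖ₑ) :=
    (measurable_ker_comp hh s g (measurable_snd.comp measurable_snd)
      (measurable_fst.sub (measurable_fst.comp measurable_snd))).enorm.mul
      (hHm.comp measurable_snd).enorm
  refine lt_of_le_of_lt (lintegral_mono fun x => enorm_piece_le h s g H x) ?_
  rw [lintegral_lintegral_swap hm.aemeasurable]
  refine lt_of_le_of_lt (lintegral_mono (g := fun w => ENNReal.ofReal (C * mult g ^ (2 * s)) *
    ‖H w‖ₑ) fun w => ?_) ?_
  · have hk : Measurable fun x => ker h s g (e₀ + w.2) (x - w.1) :=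
      measurable_ker_comp hh s g measurable_const (measurable_id.sub_const _)
    rw [lintegral_mul_const _ hk.enorm]
    dsimp only
    by_cases hv : w.2 ∈ lightCone 3
    · gcongr
      rw [lintegral_sub_right_eq_self (fun x => ‖ker h s g (e₀ + w.2) x‖ₑ) w.1]
      have hy := add_mem_cone e₀_mem hv
      have := hK g _ hy 1 le_rfl
      simp only [ENNReal.rpow_one, div_one, add_sub_cancel_right] at this
      refine this.trans (ENNReal.ofReal_le_ofReal ?_)
      have hm := mult_pos g
      refine mul_le_of_le_one_right (by positivity) (Real.exp_le_one_iff.2 ?_)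
      have := (mem_cone.1 (act_mem g hy)).1
      nlinarith
    · have : H w = 0 := h0 w.1 w.2 hv
      simp [this]
  · rw [lintegral_const_mul _ hHm.enorm]
    exact ENNReal.mul_lt_top ENNReal.ofReal_lt_top hH.2

end ConeBergman

/-! ### Convergence of the expansion -/

namespace ConeBergman

theorem measurable_bker (s : ℝ) : Measurable (Function.uncurry (bker s)) := by
  have h : Continuous fun z : V × V => lorentzQC 3 (cpt z.1 z.2) := by
    simp only [lorentzQC_three, ConeBergman.cpt]
    fun_prop
  exact h.measurable.pow_const _

theorem measurable_bker_comp {α : Type*} [MeasurableSpace α] (s : ℝ) {y x : α → V}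
    (hy : Measurable y) (hx : Measurable x) : Measurable fun z => bker s (e₀ + y z) (x z) :=
  (measurable_bker s).comp (f := fun z => (e₀ + y z, x z)) ((hy.const_add e₀).prodMk hx)

/-- The Bergman-type operator at height `e₀`. -/
def opE (s : ℝ) (H : V × V → ℂ) (x : V) : ℂ :=
  ∫ w : V × V, bker s (e₀ + w.2) (x - w.1) * H w

theorem measurable_opE (s : ℝ) {H : V × V → ℂ} (hH : Measurable H) : Measurable (opE s H) := by
  have : StronglyMeasurable fun z : V × (V × V) => bker s (e₀ + z.2.2) (z.1 - z.2.1) * H z.2 :=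
    ((measurable_bker_comp s (measurable_snd.comp measurable_snd)
      (measurable_fst.sub (measurable_fst.comp measurable_snd))).mul
      (hH.comp measurable_snd)).stronglyMeasurable
  exact this.integral_prod_right.measurable

theorem hasSum_ker_mul {h : ℝ} (hh : 0 < h) {s : ℝ} (hs : -1 < s) {H : V × V → ℂ}
    (h0 : ∀ u, ∀ v ∉ lightCone 3, H (u, v) = 0) (x : V) (w : V × V) :
    HasSum (fun j => ker h s (lat h j) (e₀ + w.2) (x - w.1) * H w)
      (lapC s * (bker s (e₀ + w.2) (x - w.1) * H w)) := by
  by_cases hv : w.2 ∈ lightCone 3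
  · rw [← mul_assoc]
    exact (hasSum_ker hh hs (add_mem_cone e₀_mem hv) _).mul_right _
  · have : H w = 0 := h0 w.1 w.2 hv
    simp [this]

/-- The `L¹` mass of a piece at a point. -/
def pieceMass (h s : ℝ) (H : V × V → ℂ) (x : V) (j : ℤ × ℤ × ℤ) : ℝ≥0∞ :=
  ∫⁻ w : V × V, ‖ker h s (lat h j) (e₀ + w.2) (x - w.1) * H w‖ₑ

theorem measurable_ker_mul {h : ℝ} (hh : 0 < h) (s : ℝ) (g : Par) {H : V × V → ℂ}
    (hH : Measurable H) (x : V) :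
    Measurable fun w : V × V => ker h s g (e₀ + w.2) (x - w.1) * H w :=
  (measurable_ker_comp hh s g measurable_snd (measurable_fst.const_sub x)).mul hH

theorem integrable_bker_mul {h : ℝ} (hh : 0 < h) {s : ℝ} (hs : -1 < s) {H : V × V → ℂ}
    (hH : Measurable H) (h0 : ∀ u, ∀ v ∉ lightCone 3, H (u, v) = 0) (x : V)
    (hfin : ∑' j, pieceMass h s H x j ≠ ∞) :
    Integrable fun w : V × V => bker s (e₀ + w.2) (x - w.1) * H w := by
  have hm : Measurable fun w : V × V => bker s (e₀ + w.2) (x - w.1) * H w :=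
    (measurable_bker_comp s measurable_snd (measurable_fst.const_sub x)).mul hH
  have hl : (lapC s : ℂ) ≠ 0 := by exact_mod_cast (lapC_pos hs).ne'
  suffices Integrable fun w : V × V => (lapC s : ℂ) * (bker s (e₀ + w.2) (x - w.1) * H w) by
    exact (integrable_const_mul_iff (Ne.isUnit hl) _).1 this
  refine ⟨(hm.const_mul _).aestronglyMeasurable, lt_of_le_of_lt ?_ hfin.lt_top⟩
  unfold pieceMass
  rw [← lintegral_tsum fun j => (measurable_ker_mul hh s _ hH x).enorm.aemeasurable]
  refine lintegral_mono fun w => ?_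
  dsimp only
  rw [← (hasSum_ker_mul hh hs h0 x w).tsum_eq]
  exact enorm_tsum_le_tsum_enorm

theorem hasSum_piece {h : ℝ} (hh : 0 < h) {s : ℝ} (hs : -1 < s) {H : V × V → ℂ}
    (hH : Measurable H) (h0 : ∀ u, ∀ v ∉ lightCone 3, H (u, v) = 0) (x : V)
    (hfin : ∑' j, pieceMass h s H x j ≠ ∞) :
    HasSum (fun j => piece h s (lat h j) H x) (lapC s * opE s H x) := by
  have hle : ∀ j, ‖piece h s (lat h j) H x‖ₑ ≤ pieceMass h s H x j := fun j =>
    enorm_integral_le_lintegral_enorm _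
  have hsum : Summable fun j => piece h s (lat h j) H x := by
    refine Summable.of_norm ?_
    have := ENNReal.summable_toReal (ne_top_of_le_ne_top hfin (ENNReal.tsum_le_tsum hle))
    simpa using this
  have h1 := integral_tsum (μ := volume)
    (fun j => (measurable_ker_mul hh s (lat h j) hH x).aestronglyMeasurable) hfin
  simp only [fun w => (hasSum_ker_mul hh hs h0 x w).tsum_eq, integral_const_mul] at h1
  unfold opE
  rw [h1]
  exact hsum.hasSum

theorem eLpNorm_le_of_tendsto {ι : Type*} {l : Filter ι} [l.IsCountablyGenerated] [l.NeBot]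
    {f : ι → V → ℂ} {g : V → ℂ} {B : ℝ≥0∞} (hm : ∀ i, AEStronglyMeasurable (f i) volume)
    (ht : ∀ x, Filter.Tendsto (fun i => f i x) l (nhds (g x)))
    (hB : ∀ i, eLpNorm (f i) 4 volume ≤ B) : eLpNorm g 4 volume ≤ B := by
  obtain ⟨u, hu⟩ := l.exists_seq_tendsto
  refine (Lp.eLpNorm_lim_le_liminf_eLpNorm (f := fun n => f (u n)) (fun n => hm _) g
    (Filter.Eventually.of_forall fun x => (ht x).comp hu)).trans ?_
  refine Filter.liminf_le_of_le (by isBoundedDefault) fun b hb => ?_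
  obtain ⟨n, hn⟩ := hb.exists
  exact hn.trans (hB _)

theorem sl_mono {H H' : V × V → ℂ} (hle : ∀ w, ‖H w‖ₑ ≤ ‖H' w‖ₑ) (v : V) : sl H v ≤ sl H' v := by
  unfold sl
  gcongr
  exact hle _

theorem slAvg_mono {H H' : V × V → ℂ} (hle : ∀ w, ‖H w‖ₑ ≤ ‖H' w‖ₑ) (c : ℝ) (g : Par) :
    slAvg c g H ≤ slAvg c g H' := by
  unfold slAvg
  gcongr
  exact sl_mono hle _

theorem eLpNorm_four_eq (f : V → ℂ) :
    eLpNorm f 4 volume = (∫⁻ x, ‖f x‖ₑ ^ (4 : ℝ)) ^ (1 / (4 : ℝ)) := by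
  rw [eLpNorm_eq_lintegral_rpow_enorm_toReal (by norm_num) (by norm_num)]
  norm_num

theorem KerBound.eLpNorm_piece_le {h s C c : ℝ} (hh : 0 < h) (hK : KerBound h s C c) (hC : 0 < C)
    (g : Par) {H : V × V → ℂ} (hH : Measurable H) (h0 : ∀ u, ∀ v ∉ lightCone 3, H (u, v) = 0) :
    eLpNorm (piece h s g H) 4 volume ≤
      ENNReal.ofReal (C * mult g ^ (2 * s) * Real.exp (-(c * act g e₀ 0))) * slAvg c g H := by
  rw [eLpNorm_four_eq]
  refine le_trans ?_ (hK.lintegral_lintegral_mul_pow_le hh hC g hH h0)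
  gcongr with x
  exact enorm_piece_le h s g H x

end ConeBergman

/-! ### The square function bound at the base point -/

namespace ConeBergman

/-- The coefficient of the pointwise convergence series. -/
def coefA (h s c : ℝ) (j : ℤ × ℤ × ℤ) : ℝ :=
  mult (lat h j) ^ (2 * s + 3 / 4) * Real.exp (-(c * act (lat h j) e₀ 0))

/-- The coefficient of the square function series. -/
def coefB (ε h s c : ℝ) (j : ℤ × ℤ × ℤ) : ℝ :=
  lossW ε h j * (mult (lat h j) ^ (2 * s) * Real.exp (-(c * act (lat h j) e₀ 0))) ^ 2

/-- The pointwise convergence series. -/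
def serA (h s c : ℝ) (H : V × V → ℂ) : ℝ≥0∞ :=
  ∑' j, ENNReal.ofReal (coefA h s c j) * slAvg c (lat h j) H

/-- The square function series. -/
def serB (ε h s c : ℝ) (H : V × V → ℂ) : ℝ≥0∞ :=
  ∑' j, ENNReal.ofReal (coefB ε h s c j) * slAvg c (lat h j) H ^ 2

theorem coefA_nonneg (h s c : ℝ) (j : ℤ × ℤ × ℤ) : 0 ≤ coefA h s c j := by
  have := mult_pos (lat h j)
  unfold coefA; positivity

theorem coefB_nonneg (ε h s c : ℝ) (j : ℤ × ℤ × ℤ) : 0 ≤ coefB ε h s c j := by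
  have := mult_pos (lat h j)
  have := lossW_pos ε h j
  unfold coefB; positivity

theorem KerBound.tsum_pieceMass_le {h s C c : ℝ} (hh : 0 < h) (hK : KerBound h s C c) (hC : 0 < C)
    {H : V × V → ℂ} (hH : Measurable H) (h0 : ∀ u, ∀ v ∉ lightCone 3, H (u, v) = 0) (x : V) :
    ∑' j, pieceMass h s H x j ≤ ENNReal.ofReal C * serA h s c H := by
  unfold serA
  rw [← ENNReal.tsum_mul_left]
  refine ENNReal.tsum_le_tsum fun j => ?_
  have := hK.lintegral_mul_le hh hC (lat h j) hH h0 x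
  rw [mul_assoc, ENNReal.ofReal_mul hC.le, mul_assoc] at this
  simpa only [pieceMass, enorm_mul, coefA] using this

/-- The decoupling inequality at parameters `ε`, `h`, with constant `D`. -/
def Decoupling (ε h D : ℝ) : Prop := ∀ m : ℤ × ℤ × ℤ → V → ℂ, (∀ j, IsAmp (m j)) →
  (∀ j ξ, m j ξ ≠ 0 → chiG h (lat h j) ξ ≠ 0) → ∀ J : Finset (ℤ × ℤ × ℤ),
    nrm (fun x => ∑ j ∈ J, four (m j) x) ^ 2 ≤ D * ∑ j ∈ J, lossW ε h j * nrm (four (m j)) ^ 2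

theorem Decoupling.eLpNorm_le {ε h D : ℝ} (hD : Decoupling ε h D) (hD0 : 0 < D)
    {m : ℤ × ℤ × ℤ → V → ℂ} (hm : ∀ j, IsAmp (m j))
    (hs : ∀ j ξ, m j ξ ≠ 0 → chiG h (lat h j) ξ ≠ 0) (J : Finset (ℤ × ℤ × ℤ)) :
    eLpNorm (fun x => ∑ j ∈ J, four (m j) x) 4 volume ^ 2 ≤
      ENNReal.ofReal D * ∑ j ∈ J, ENNReal.ofReal (lossW ε h j) *
        eLpNorm (four (m j)) 4 volume ^ 2 := by
  have hof : ∀ f : V → ℂ, MemLp f 4 → eLpNorm f 4 volume = ENNReal.ofReal (nrm f) := fun f hf =>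
    (ENNReal.ofReal_toReal hf.2.ne).symm
  have hsum : MemLp (fun x => ∑ j ∈ J, four (m j) x) 4 := memLp_finsetSum J fun j _ => (hm j).memLp
  rw [hof _ hsum, ← ENNReal.ofReal_pow (nrm_nonneg _)]
  refine (ENNReal.ofReal_le_ofReal (hD m hm hs J)).trans_eq ?_
  rw [ENNReal.ofReal_mul hD0.le, ENNReal.ofReal_sum_of_nonneg fun j _ =>
    mul_nonneg (lossW_pos _ _ _).le (by positivity)]
  congr 1
  refine Finset.sum_congr rfl fun j _ => ?_
  rw [hof _ (hm j).memLp, ENNReal.ofReal_mul (lossW_pos _ _ _).le,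
    ENNReal.ofReal_pow (nrm_nonneg _)]

theorem eLpNorm_opE_le_of_integrable {ε h D s C c : ℝ} (hh : 0 < h) (hs : -1 < s)
    (hDec : Decoupling ε h D) (hD : 0 < D) (hK : KerBound h s C c) (hC : 0 < C) (hc : 0 < c)
    {H : V × V → ℂ} (hH : Measurable H) (h0 : ∀ u, ∀ v ∉ lightCone 3, H (u, v) = 0)
    (hHi : Integrable H) (hA : serA h s c H ≠ ∞) :
    (ENNReal.ofReal (lapC s) * eLpNorm (opE s H) 4 volume) ^ 2 ≤
      ENNReal.ofReal (D * C ^ 2) * serB ε h s c H := by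
  set R := ENNReal.ofReal (D * C ^ 2) * serB ε h s c H with hR
  have hamp : ∀ j, IsAmp (pieceAmp h s (lat h j) H) := fun j => hK.isAmp hh hC hc _ hH hHi h0
  have hJ : ∀ J : Finset (ℤ × ℤ × ℤ),
      eLpNorm (fun x => ∑ j ∈ J, piece h s (lat h j) H x) 4 volume ^ 2 ≤ R := by
    intro J
    have h1 := hDec.eLpNorm_le hD hamp (fun j ξ hξ hz => hξ (pieceAmp_eq_zero hz)) J
    simp only [four_pieceAmp hh s _ hHi h0] at h1
    refine h1.trans ?_
    rw [hR, ENNReal.ofReal_mul hD.le, mul_assoc]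
    gcongr
    refine le_trans ?_ (mul_le_mul_right (ENNReal.sum_le_tsum J) _)
    rw [Finset.mul_sum]
    refine Finset.sum_le_sum fun j _ => ?_
    have h2 := hK.eLpNorm_piece_le hh hC (lat h j) hH h0
    have hm := mult_pos (lat h j)
    calc _ ≤ ENNReal.ofReal (lossW ε h j) * (ENNReal.ofReal (C * mult (lat h j) ^ (2 * s) *
          Real.exp (-(c * act (lat h j) e₀ 0))) * slAvg c (lat h j) H) ^ 2 := by gcongr
      _ = _ := by
        rw [coefB, mul_pow, ← mul_assoc, ← mul_assoc, ← ENNReal.ofReal_pow (by positivity),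
          ← ENNReal.ofReal_mul (lossW_pos _ _ _).le, ← ENNReal.ofReal_mul (by positivity)]
        congr 2
        ring
  have hfin : ∀ x, ∑' j, pieceMass h s H x j ≠ ∞ := fun x =>
    ne_top_of_le_ne_top (ENNReal.mul_ne_top ENNReal.ofReal_ne_top hA)
      (hK.tsum_pieceMass_le hh hC hH h0 x)
  have hlim : eLpNorm (fun x => (lapC s : ℂ) * opE s H x) 4 volume ≤ R ^ (2 : ℝ)⁻¹ := by
    refine eLpNorm_le_of_tendsto (l := Filter.atTop)
      (f := fun (J : Finset (ℤ × ℤ × ℤ)) x => ∑ j ∈ J, piece h s (lat h j) H x) (fun J => ?_)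
      (fun x => hasSum_piece hh hs hH h0 x (hfin x)) fun J => ?_
    · simp only [← four_pieceAmp hh s _ hHi h0]
      exact (memLp_finsetSum J fun j _ => (hamp j).memLp).1
    · rw [ENNReal.le_rpow_inv_iff (by norm_num)]
      exact_mod_cast hJ J
  have hcm : eLpNorm (fun x => (lapC s : ℂ) * opE s H x) 4 volume =
      ENNReal.ofReal (lapC s) * eLpNorm (opE s H) 4 volume := by
    have := eLpNorm_const_smul (lapC s : ℂ) (opE s H) 4 (volume : Measure V)
    rw [← ofReal_norm, norm_real, Real.norm_of_nonneg (lapC_pos hs).le] at this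
    exact this
  rw [hcm, ENNReal.le_rpow_inv_iff (by norm_num)] at hlim
  exact_mod_cast hlim

/-- The truncation of a density. -/
def trunc (H : V × V → ℂ) (n : ℕ) : V × V → ℂ :=
  {w | ‖w‖ ≤ n ∧ ‖H w‖ ≤ n}.indicator H

theorem measurable_trunc {H : V × V → ℂ} (hH : Measurable H) (n : ℕ) : Measurable (trunc H n) :=
  hH.indicator ((measurableSet_le measurable_norm measurable_const).inter
    (measurableSet_le hH.norm measurable_const))

theorem norm_trunc_le (H : V × V → ℂ) (n : ℕ) (w : V × V) : ‖trunc H n w‖ ≤ ‖H w‖ :=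
  norm_indicator_le_norm_self _ _

theorem integrable_trunc {H : V × V → ℂ} (hH : Measurable H) (n : ℕ) : Integrable (trunc H n) := by
  have hb : Integrable ((Metric.closedBall (0 : V × V) n).indicator fun _ => (n : ℝ)) :=
    (integrableOn_const (isCompact_closedBall (0 : V × V) n).measure_ne_top).integrable_indicator
      Metric.isClosed_closedBall.measurableSet
  refine hb.mono' (measurable_trunc hH n).aestronglyMeasurable
    (Filter.Eventually.of_forall fun w => ?_)
  by_cases hw : ‖w‖ ≤ n ∧ ‖H w‖ ≤ n
  · rw [trunc, indicator_of_mem (by exact hw), indicator_of_mem (by simpa using hw.1)]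
    exact hw.2
  · rw [trunc, indicator_of_notMem (by exact hw), norm_zero]
    exact indicator_nonneg (fun _ _ => Nat.cast_nonneg n) _

theorem tendsto_trunc (H : V × V → ℂ) (w : V × V) :
    Filter.Tendsto (fun n => trunc H n w) Filter.atTop (nhds (H w)) := by
  obtain ⟨N, hN⟩ := exists_nat_ge (max ‖w‖ ‖H w‖)
  refine tendsto_const_nhds.congr' ?_
  filter_upwards [Filter.eventually_ge_atTop N] with n hn
  have : max ‖w‖ ‖H w‖ ≤ n := hN.trans (by exact_mod_cast hn)
  rw [trunc, indicator_of_mem]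
  exact ⟨(le_max_left _ _).trans this, (le_max_right _ _).trans this⟩

theorem opE_bound {ε h D s C c : ℝ} (hh : 0 < h) (hs : -1 < s)
    (hDec : Decoupling ε h D) (hD : 0 < D) (hK : KerBound h s C c) (hC : 0 < C) (hc : 0 < c)
    {H : V × V → ℂ} (hH : Measurable H) (h0 : ∀ u, ∀ v ∉ lightCone 3, H (u, v) = 0)
    (hA : serA h s c H ≠ ∞) :
    (∀ x, Integrable fun w : V × V => bker s (e₀ + w.2) (x - w.1) * H w) ∧
      (ENNReal.ofReal (lapC s) * eLpNorm (opE s H) 4 volume) ^ 2 ≤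
        ENNReal.ofReal (D * C ^ 2) * serB ε h s c H := by
  have hfin : ∀ x, ∑' j, pieceMass h s H x j ≠ ∞ := fun x =>
    ne_top_of_le_ne_top (ENNReal.mul_ne_top ENNReal.ofReal_ne_top hA)
      (hK.tsum_pieceMass_le hh hC hH h0 x)
  have h_int := fun x => integrable_bker_mul hh hs hH h0 x (hfin x)
  refine ⟨h_int, ?_⟩
  set R := ENNReal.ofReal (D * C ^ 2) * serB ε h s c H with hR
  have hle : ∀ n w, ‖trunc H n w‖ₑ ≤ ‖H w‖ₑ := fun n w =>
    enorm_le_iff_norm_le.2 (norm_trunc_le H n w)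
  have hl : ENNReal.ofReal (lapC s) ≠ 0 := by simpa using lapC_pos hs
  have hn : ∀ n, eLpNorm (opE s (trunc H n)) 4 volume ≤
      R ^ (2 : ℝ)⁻¹ / ENNReal.ofReal (lapC s) := by
    intro n
    have hA' : serA h s c (trunc H n) ≤ serA h s c H := by
      unfold serA
      gcongr with j
      exact slAvg_mono (hle n) _ _
    have hB' : serB ε h s c (trunc H n) ≤ serB ε h s c H := by
      unfold serB
      gcongr with j
      exact slAvg_mono (hle n) _ _
    have h1 := eLpNorm_opE_le_of_integrable hh hs hDec hD hK hC hc (measurable_trunc hH n)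
      (fun u v hv => by simp [trunc, indicator_apply, h0 u v hv]) (integrable_trunc hH n)
      (ne_top_of_le_ne_top hA hA')
    rw [ENNReal.le_div_iff_mul_le (Or.inl hl) (Or.inl ENNReal.ofReal_ne_top), mul_comm,
      ENNReal.le_rpow_inv_iff (by norm_num)]
    have h2 := h1.trans (mul_le_mul_right hB' _)
    exact_mod_cast h2
  have hlim := eLpNorm_le_of_tendsto (l := Filter.atTop) (g := opE s H)
    (fun n => (measurable_opE s (measurable_trunc hH n)).aestronglyMeasurable) (fun x => ?_) hn
  · rw [ENNReal.le_div_iff_mul_le (Or.inl hl) (Or.inl ENNReal.ofReal_ne_top), mul_comm,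
      ENNReal.le_rpow_inv_iff (by norm_num)] at hlim
    exact_mod_cast hlim
  · refine tendsto_integral_of_dominated_convergence
      (fun w => ‖bker s (e₀ + w.2) (x - w.1) * H w‖) (fun n => ?_) (h_int x).norm (fun n => ?_) ?_
    · exact ((measurable_bker_comp s measurable_snd (measurable_fst.const_sub x)).mul
        (measurable_trunc hH n)).aestronglyMeasurable
    · refine Filter.Eventually.of_forall fun w => ?_
      rw [norm_mul, norm_mul]
      gcongr
      exact norm_trunc_le H n w
    · exact Filter.Eventually.of_forall fun w => (tendsto_trunc H w).const_mul _

end ConeBergman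

/-! ### The square function bound at every height -/

namespace ConeBergman

theorem bker_act (s : ℝ) (γ : Par) {y : V} (hy : y ∈ lightCone 3) (x : V) :
    bker s (act γ y) (act γ x) = ((mult γ ^ (-(2 * s + 3)) : ℝ) : ℂ) * bker s y x := by
  have hm := mult_pos γ
  have hz : lorentzQC 3 (cpt y x) ≠ 0 := slitPlane_ne_zero (lorentzQC_cpt_mem_slitPlane hy x)
  have hm' : ((mult γ ^ 2 : ℝ) : ℂ) ≠ 0 := by exact_mod_cast (pow_pos hm 2).ne'
  unfold bker
  rw [lorentzQC_act, cpow_def_of_ne_zero (mul_ne_zero hm' hz), log_ofReal_mul (pow_pos hm 2) hz,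
    add_mul, Complex.exp_add, ← cpow_def_of_ne_zero hz]
  congr 1
  rw [ofReal_log (pow_pos hm 2).le, ← cpow_def_of_ne_zero hm', ← ofReal_cpow (pow_pos hm 2).le]
  congr 1
  rw [← Real.rpow_natCast, ← Real.rpow_mul hm.le]
  congr 1
  push_cast; ring

/-- The density transported by `γ`. -/
def pull (γ : Par) (H : V × V → ℂ) (w : V × V) : ℂ := H (act γ w.1, act γ w.2)

theorem measurable_pull (γ : Par) {H : V × V → ℂ} (hH : Measurable H) : Measurable (pull γ H) :=
  hH.comp (((continuous_act γ).comp continuous_fst).prodMk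
    ((continuous_act γ).comp continuous_snd)).measurable

/-- The Bergman-type operator at height `y`. -/
def opY (s : ℝ) (H : V × V → ℂ) (y x : V) : ℂ :=
  ∫ w : V × V, bker s (y + w.2) (x - w.1) * H w

theorem map_act_prod (γ : Par) :
    Measure.map ((actHomeo γ).prodCongr (actHomeo γ)) (volume : Measure (V × V)) =
      ENNReal.ofReal ((mult γ ^ 6)⁻¹) • (volume : Measure (V × V)) := by
  have h := Measure.map_prod_map (volume : Measure V) (volume : Measure V)
    (continuous_act γ).measurable (continuous_act γ).measurable
  have hm := mult_pos γ
  have e : Measure.map (Prod.map (act γ) (act γ)) ((volume : Measure V).prod volume) = _ := h.symm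
  rw [map_act, Measure.prod_smul_left, Measure.prod_smul_right, smul_smul,
    ← ENNReal.ofReal_mul (by positivity)] at e
  refine Eq.trans e ?_
  congr 2
  field_simp

theorem integral_comp_act_prod (γ : Par) (f : V × V → ℂ) :
    ∫ w : V × V, f (act γ w.1, act γ w.2) = ((mult γ ^ 6)⁻¹ : ℝ) • ∫ w, f w := by
  have h := ((actHomeo γ).prodCongr (actHomeo γ)).measurableEmbedding.integral_map
    (μ := volume) f
  rw [map_act_prod, integral_smul_measure, ENNReal.toReal_ofReal
    (inv_pos.2 (pow_pos (mult_pos γ) 6)).le] at h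
  exact h.symm

theorem integrable_comp_act_prod (γ : Par) (f : V × V → ℂ) :
    Integrable (fun w : V × V => f (act γ w.1, act γ w.2)) ↔ Integrable f := by
  have h := ((actHomeo γ).prodCongr (actHomeo γ)).measurableEmbedding.integrable_map_iff
    (μ := volume) (g := f)
  rw [map_act_prod, integrable_smul_measure
    (by simpa using pow_pos (mult_pos γ) 6) ENNReal.ofReal_ne_top] at h
  exact h.symm

theorem bker_mul_pull {s : ℝ} (γ : Par) {H : V × V → ℂ}
    (h0 : ∀ u, ∀ v ∉ lightCone 3, H (u, v) = 0) (x : V) (w : V × V) :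
    bker s (e₀ + w.2) (x - w.1) * pull γ H w = ((mult γ ^ (2 * s + 3) : ℝ) : ℂ) *
      (bker s (act γ e₀ + act γ w.2) (act γ x - act γ w.1) * H (act γ w.1, act γ w.2)) := by
  by_cases hv : w.2 ∈ lightCone 3
  · rw [← act_add, ← act_sub, bker_act s γ (add_mem_cone e₀_mem hv), pull, ← mul_assoc, ← mul_assoc,
      ← ofReal_mul, ← Real.rpow_add (mult_pos γ)]
    simp
  · have : H (act γ w.1, act γ w.2) = 0 := h0 _ _ (by rwa [act_mem_iff])
    simp [pull, this]

theorem opE_pull {s : ℝ} (γ : Par) {H : V × V → ℂ}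
    (h0 : ∀ u, ∀ v ∉ lightCone 3, H (u, v) = 0) (x : V) :
    opE s (pull γ H) x = ((mult γ ^ (2 * s - 3) : ℝ) : ℂ) * opY s H (act γ e₀) (act γ x) := by
  have hm := mult_pos γ
  unfold opE opY
  simp only [bker_mul_pull γ h0]
  rw [integral_const_mul, integral_comp_act_prod γ fun w =>
    bker s (act γ e₀ + w.2) (act γ x - w.1) * H w, real_smul, ← mul_assoc, ← ofReal_mul]
  congr 3
  rw [show 2 * s - 3 = 2 * s + 3 - (6 : ℕ) by push_cast; ring, Real.rpow_sub_natCast hm.ne']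
  rfl

theorem integrable_bker_pull {s : ℝ} (γ : Par) {H : V × V → ℂ}
    (h0 : ∀ u, ∀ v ∉ lightCone 3, H (u, v) = 0) (x : V)
    (hi : Integrable fun w : V × V => bker s (e₀ + w.2) (x - w.1) * pull γ H w) :
    Integrable fun w : V × V => bker s (act γ e₀ + w.2) (act γ x - w.1) * H w := by
  simp only [bker_mul_pull γ h0] at hi
  have hm : ((mult γ ^ (2 * s + 3) : ℝ) : ℂ) ≠ 0 := by
    exact_mod_cast (Real.rpow_pos_of_pos (mult_pos γ) _).ne'
  rw [integrable_const_mul_iff hm.isUnit] at hi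
  exact (integrable_comp_act_prod γ
    fun w => bker s (act γ e₀ + w.2) (act γ x - w.1) * H w).1 hi

theorem lintegral_pow_comp_act (γ : Par) {f : V → ℂ} (hf : Measurable f) :
    (∫⁻ x, ‖f (act γ x)‖ₑ ^ (4 : ℝ)) ^ (1 / (4 : ℝ)) =
      ENNReal.ofReal (mult γ ^ (-(3 / 4) : ℝ)) * (∫⁻ x, ‖f x‖ₑ ^ (4 : ℝ)) ^ (1 / (4 : ℝ)) := by
  have hm := mult_pos γ
  rw [lintegral_comp_act γ (fun x => ‖f x‖ₑ ^ (4 : ℝ)) (hf.enorm.pow_const _),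
    ENNReal.mul_rpow_of_nonneg _ _ (by norm_num),
    ENNReal.ofReal_rpow_of_pos (by positivity), ← Real.rpow_natCast, ← Real.rpow_neg hm.le,
    ← Real.rpow_mul hm.le]
  norm_num

theorem measurable_opY (s : ℝ) {H : V × V → ℂ} (hH : Measurable H) :
    Measurable (Function.uncurry (opY s H)) := by
  have : StronglyMeasurable fun z : (V × V) × (V × V) =>
      bker s (z.1.1 + z.2.2) (z.1.2 - z.2.1) * H z.2 := by
    refine (Measurable.mul ?_ (hH.comp measurable_snd)).stronglyMeasurable
    exact (measurable_bker s).comp (f := fun z : (V × V) × (V × V) =>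
      (z.1.1 + z.2.2, z.1.2 - z.2.1)) (by fun_prop)
  exact this.integral_prod_right.measurable

theorem eLpNorm_opE_pull {s : ℝ} (γ : Par) {H : V × V → ℂ} (hH : Measurable H)
    (h0 : ∀ u, ∀ v ∉ lightCone 3, H (u, v) = 0) :
    eLpNorm (opE s (pull γ H)) 4 volume =
      ENNReal.ofReal (mult γ ^ (2 * s - 3 - 3 / 4)) *
        (∫⁻ x, ‖opY s H (act γ e₀) x‖ₑ ^ (4 : ℝ)) ^ (1 / (4 : ℝ)) := by
  have hm := mult_pos γ
  have h1 : Measurable (opY s H (act γ e₀)) := (measurable_opY s hH).of_uncurry_left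
  have h2 : ∀ x, ‖opE s (pull γ H) x‖ₑ = ENNReal.ofReal (mult γ ^ (2 * s - 3)) *
      ‖opY s H (act γ e₀) (act γ x)‖ₑ := fun x => by
    rw [opE_pull γ h0, enorm_mul, ← ofReal_norm, norm_real, Real.norm_of_nonneg (by positivity)]
  have h3 : Measurable fun x => ‖opY s H (act γ e₀) (act γ x)‖ₑ ^ (4 : ℝ) :=
    ((h1.comp (continuous_act γ).measurable).enorm).pow_const _
  rw [eLpNorm_four_eq]
  simp only [h2, ENNReal.mul_rpow_of_nonneg _ _ (show (0 : ℝ) ≤ 4 by norm_num)]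
  rw [lintegral_const_mul _ h3, ENNReal.mul_rpow_of_nonneg _ _ (by norm_num),
    lintegral_pow_comp_act γ h1, ← ENNReal.rpow_mul, show (4 : ℝ) * (1 / 4) = 1 by norm_num,
    ENNReal.rpow_one, ← mul_assoc, ← ENNReal.ofReal_mul (by positivity), ← Real.rpow_add hm]
  rfl

/-- The exponential average over the cone at scale `g`, based at `γ`. -/
def coneAvg (c s : ℝ) (φ : V → ℝ≥0∞) (g γ : Par) : ℝ≥0∞ :=
  ∫⁻ v in lightCone 3, ENNReal.ofReal (Real.exp (-(c * act g v 0))) * φ (act γ v) *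
    ENNReal.ofReal (lorentzQ 3 v ^ (s - 3 / 2))

theorem slAvg_pull {c s : ℝ} (g γ : Par) {H : V × V → ℂ} (hH : Measurable H)
    (h0 : ∀ u, ∀ v ∉ lightCone 3, H (u, v) = 0) {φ : V → ℝ≥0∞}
    (hφ : ∀ v ∈ lightCone 3, sl H v = φ v * ENNReal.ofReal (lorentzQ 3 v ^ (s - 3 / 2))) :
    slAvg c g (pull γ H) = ENNReal.ofReal (mult γ ^ (2 * s - 3 - 3 / 4)) * coneAvg c s φ g γ := by
  have hm := mult_pos γ
  have h1 : ∀ v, sl (pull γ H) v = ENNReal.ofReal (mult γ ^ (-(3 / 4) : ℝ)) * sl H (act γ v) :=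
    fun v => lintegral_pow_comp_act γ (f := fun u => H (u, act γ v))
      (hH.comp (measurable_prodMk_right))
  unfold slAvg coneAvg
  rw [← lintegral_const_mul' _ _ ENNReal.ofReal_ne_top, ← lintegral_indicator measurableSet_cone]
  refine lintegral_congr fun v => ?_
  by_cases hv : v ∈ lightCone 3
  · rw [indicator_of_mem hv, h1, hφ _ (act_mem γ hv), lorentzQ_act,
      Real.mul_rpow (by positivity) hv.2.le, ENNReal.ofReal_mul (by positivity)]
    have e : ENNReal.ofReal (mult γ ^ (2 * s - 3 - 3 / 4)) =
        ENNReal.ofReal (mult γ ^ (-(3 / 4) : ℝ)) *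
          ENNReal.ofReal ((mult γ ^ 2) ^ (s - 3 / 2)) := by
      rw [← ENNReal.ofReal_mul (by positivity), ← Real.rpow_natCast, ← Real.rpow_mul hm.le,
        ← Real.rpow_add hm]
      congr 2
      push_cast; ring
    rw [e]
    ring
  · rw [indicator_of_notMem hv, h1, sl_eq_zero h0 (by rwa [act_mem_iff])]
    simp

theorem opY_bound {ε h D s C c : ℝ} (hh : 0 < h) (hs : -1 < s)
    (hDec : Decoupling ε h D) (hD : 0 < D) (hK : KerBound h s C c) (hC : 0 < C) (hc : 0 < c)
    {H : V × V → ℂ} (hH : Measurable H) (h0 : ∀ u, ∀ v ∉ lightCone 3, H (u, v) = 0)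
    {φ : V → ℝ≥0∞}
    (hφ : ∀ v ∈ lightCone 3, sl H v = φ v * ENNReal.ofReal (lorentzQ 3 v ^ (s - 3 / 2))) (γ : Par)
    (hA : ∑' j, ENNReal.ofReal (coefA h s c j) * coneAvg c s φ (lat h j) γ ≠ ∞) :
    (∀ x, Integrable fun w : V × V => bker s (act γ e₀ + w.2) (x - w.1) * H w) ∧
      (ENNReal.ofReal (lapC s) *
        (∫⁻ x, ‖opY s H (act γ e₀) x‖ₑ ^ (4 : ℝ)) ^ (1 / (4 : ℝ))) ^ 2 ≤
        ENNReal.ofReal (D * C ^ 2) *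
          ∑' j, ENNReal.ofReal (coefB ε h s c j) * coneAvg c s φ (lat h j) γ ^ 2 := by
  have hm := mult_pos γ
  have h0' : ∀ u, ∀ v ∉ lightCone 3, pull γ H (u, v) = 0 := fun u v hv =>
    h0 _ _ (by rwa [act_mem_iff])
  set κ := ENNReal.ofReal (mult γ ^ (2 * s - 3 - 3 / 4)) with hκ
  have hκ0 : κ ≠ 0 := by simpa [hκ] using Real.rpow_pos_of_pos hm _
  have hκt : κ ≠ ∞ := ENNReal.ofReal_ne_top
  have eA : serA h s c (pull γ H) =
      κ * ∑' j, ENNReal.ofReal (coefA h s c j) * coneAvg c s φ (lat h j) γ := by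
    unfold serA
    rw [← ENNReal.tsum_mul_left]
    refine tsum_congr fun j => ?_
    rw [slAvg_pull _ γ hH h0 hφ]; ring
  have eB : serB ε h s c (pull γ H) =
      κ ^ 2 * ∑' j, ENNReal.ofReal (coefB ε h s c j) * coneAvg c s φ (lat h j) γ ^ 2 := by
    unfold serB
    rw [← ENNReal.tsum_mul_left]
    refine tsum_congr fun j => ?_
    rw [slAvg_pull _ γ hH h0 hφ]; ring
  obtain ⟨h1, h2⟩ := opE_bound hh hs hDec hD hK hC hc (measurable_pull γ hH) h0'
    (by rw [eA]; exact ENNReal.mul_ne_top hκt hA)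
  refine ⟨fun x => ?_, ?_⟩
  · have := integrable_bker_pull γ h0 (act (ginv γ) x) (h1 _)
    simpa only [act_act_ginv] using this
  · rw [eLpNorm_opE_pull γ hH h0, eB] at h2
    refine (ENNReal.mul_le_mul_iff_right (pow_ne_zero 2 hκ0) (ENNReal.pow_ne_top hκt)).1
      (le_of_eq_of_le ?_ (h2.trans_eq ?_)) <;> ring

end ConeBergman

/-! ### Lattice sums -/

namespace ConeBergman

theorem summable_one_add_abs_rpow {p : ℝ} (hp : 1 < p) :
    Summable fun n : ℤ => (1 + |(n : ℝ)|) ^ (-p) := by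
  refine ((Real.summable_one_div_int_add_rpow (1 / 2) p).2 hp).of_nonneg_of_le
    (fun n => by positivity) fun n => ?_
  have hn : (0 : ℝ) < |(n : ℝ) + 1 / 2| := by
    rw [abs_pos]
    intro h
    have h2 : (2 * n + 1 : ℤ) = 0 := by
      have : (2 * n + 1 : ℝ) = 0 := by linarith
      exact_mod_cast this
    lia
  have hle : |(n : ℝ) + 1 / 2| ≤ 1 + |(n : ℝ)| := by
    refine (abs_add_le _ _).trans ?_
    norm_num
    linarith
  rw [Real.rpow_neg (by positivity), one_div]
  gcongr

theorem exp_neg_le_rpow {θ u : ℝ} (hθ : 0 < θ) (hu : 0 < u) :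
    Real.exp (-u) ≤ θ ^ θ * u ^ (-θ) := by
  have h1 : u / θ ≤ Real.exp (u / θ) := (by linarith [Real.add_one_le_exp (u / θ)])
  have h2 : u ^ θ ≤ θ ^ θ * Real.exp u := by
    have := Real.rpow_le_rpow (by positivity) h1 hθ.le
    rw [Real.div_rpow hu.le hθ.le, ← Real.exp_mul, div_mul_cancel₀ _ hθ.ne',
      div_le_iff₀ (by positivity)] at this
    linarith
  rw [Real.rpow_neg hu.le, Real.exp_neg, ← div_eq_mul_inv, le_div_iff₀ (by positivity),
    inv_mul_le_iff₀ (Real.exp_pos _)]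
  linarith

theorem exp_neg_sq_le {θ a : ℝ} (hθ : 0 < θ) (ha : 0 < a) :
    ∃ K : ℝ, 0 < K ∧ ∀ k l : ℝ, Real.exp (-(a * (Real.exp (2 * k) * (1 + l ^ 2)))) ≤
      K * (Real.exp (-(2 * θ * k)) * (1 + |l|) ^ (-(2 * θ))) := by
  refine ⟨θ ^ θ * a ^ (-θ) * 2 ^ θ, by positivity, fun k l => ?_⟩
  refine (exp_neg_le_rpow hθ (by positivity)).trans ?_
  have h1 : (1 + |l|) ^ 2 / 2 ≤ 1 + l ^ 2 := by
    have := sq_abs l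
    nlinarith [sq_nonneg (1 - |l|)]
  have h2 : (1 + l ^ 2) ^ (-θ) ≤ 2 ^ θ * (1 + |l|) ^ (-(2 * θ)) := by
    refine (Real.rpow_le_rpow_of_nonpos (by positivity) h1 (by linarith)).trans_eq ?_
    rw [Real.div_rpow (by positivity) (by norm_num), ← Real.rpow_natCast, ← Real.rpow_mul
      (by positivity), Real.rpow_neg (by norm_num : (0 : ℝ) ≤ 2), div_inv_eq_mul, mul_comm]
    congr 2; push_cast; ring
  rw [Real.mul_rpow ha.le (by positivity), Real.mul_rpow (Real.exp_pos _).le (by positivity),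
    ← Real.exp_mul, show 2 * k * -θ = -(2 * θ * k) by ring]
  calc _ ≤ θ ^ θ * (a ^ (-θ) * (Real.exp (-(2 * θ * k)) * (2 ^ θ * (1 + |l|) ^ (-(2 * θ))))) := by
        gcongr
    _ = _ := by ring

/-- Summability over the lattice of the exponentials that occur in the estimates. -/
theorem summable_lossW_mul_exp {ε h c A B : ℝ} (hε : 0 < ε) (hh : 0 < h) (hc : 0 < c)
    (hA : ε < A) (hB : 1 + 3 * ε < B) :
    Summable fun j : ℤ × ℤ × ℤ => lossW ε h j *
      (Real.exp (A * (lat h j).1 + B * (lat h j).2.2) *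
        Real.exp (-(c * act (lat h j) e₀ 0))) := by
  obtain ⟨K₁, hK₁⟩ := mul_sub_mul_exp_le (half_pos hc) (hε.trans hA)
  obtain ⟨K₂, hK₂, hK₂'⟩ := exp_neg_sq_le (θ := 1 / 2 + ε) (by positivity) (a := c / 4) (by positivity)
  obtain ⟨K₃, hK₃⟩ := mul_sub_mul_exp_le (c := c / 4) (by positivity)
    (show 0 < B - 1 - 2 * ε by linarith)
  have hs1 : Summable fun i : ℤ => Real.exp (-((A - ε) * h * |(i : ℝ)|)) :=
    summable_exp_neg_mul_abs_int (mul_pos (by linarith) hh)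
  have hs2 : Summable fun i : ℤ => Real.exp (-((B - 1 - 3 * ε) * |(i : ℝ)|)) :=
    summable_exp_neg_mul_abs_int (by linarith)
  have hs3 := summable_one_add_abs_rpow (p := 1 + ε) (by linarith)
  have hs := (hs1.mul_of_nonneg (hs2.mul_of_nonneg hs3 (fun _ => by positivity)
    (fun _ => by positivity)) (fun _ => by positivity)
    (fun _ => by positivity)).mul_left (Real.exp K₁ * Real.exp K₃ * K₂)
  refine hs.of_nonneg_of_le (fun j => mul_nonneg (lossW_pos _ _ _).le (by positivity)) fun j => ?_
  obtain ⟨i, k, l⟩ := j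
  simp only [lat, lossW, act_e₀_zero]
  have e1 : Real.exp (h * (i : ℝ)) ^ 2 = Real.exp (2 * (h * i)) := by
    rw [← Real.exp_nat_mul]; norm_num
  have e2 : Real.exp (k : ℝ) ^ 2 = Real.exp (2 * k) := by
    rw [← Real.exp_nat_mul]; norm_num
  rw [e1, e2]
  have a1 : Real.exp (ε * (h * |(i : ℝ)|) + A * (h * i) - c / 2 * Real.exp (2 * (h * i))) ≤
      Real.exp K₁ * Real.exp (-((A - ε) * h * |(i : ℝ)|)) := by
    rw [← Real.exp_add, Real.exp_le_exp]
    have := hK₁ (h * i)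
    rw [abs_mul, abs_of_pos hh] at this
    linarith
  have a2 := hK₂' k l
  have hl : (1 : ℝ) ≤ 1 + (l : ℝ) ^ 2 := by nlinarith [sq_nonneg (l : ℝ)]
  have a3 : Real.exp (ε * |(k : ℝ)| + B * k - c / 4 * (Real.exp (2 * k) * (1 + (l : ℝ) ^ 2)) +
      -(2 * (1 / 2 + ε) * k)) ≤
      Real.exp K₃ * Real.exp (-((B - 1 - 3 * ε) * |(k : ℝ)|)) := by
    rw [← Real.exp_add, Real.exp_le_exp]
    have := hK₃ k
    have h2 := le_mul_of_one_le_right (Real.exp_pos (2 * (k : ℝ))).le hl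
    nlinarith
  have hpos : (0 : ℝ) < 1 + |(l : ℝ)| := by positivity
  have e3 : (1 + |(l : ℝ)|) ^ ε * (1 + |(l : ℝ)|) ^ (-(2 * (1 / 2 + ε))) =
      (1 + |(l : ℝ)|) ^ (-(1 + ε)) := by
    rw [← Real.rpow_add hpos]; congr 1; ring
  calc _ = (1 + |(l : ℝ)|) ^ ε *
        (Real.exp (ε * (h * |(i : ℝ)|) + A * (h * i) - c / 2 * Real.exp (2 * (h * i))) *
        (Real.exp (ε * |(k : ℝ)| + B * k - c / 4 * (Real.exp (2 * k) * (1 + (l : ℝ) ^ 2))) *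
        Real.exp (-(c / 4 * (Real.exp (2 * k) * (1 + (l : ℝ) ^ 2)))))) := by
        rw [mul_assoc]
        simp only [← Real.exp_add]
        congr 2; ring
    _ ≤ (1 + |(l : ℝ)|) ^ ε * (Real.exp K₁ * Real.exp (-((A - ε) * h * |(i : ℝ)|)) *
        (Real.exp (ε * |(k : ℝ)| + B * k - c / 4 * (Real.exp (2 * k) * (1 + (l : ℝ) ^ 2))) *
        (K₂ * (Real.exp (-(2 * (1 / 2 + ε) * k)) * (1 + |(l : ℝ)|) ^ (-(2 * (1 / 2 + ε))))))) := by
        gcongr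
    _ = ((1 + |(l : ℝ)|) ^ ε * (1 + |(l : ℝ)|) ^ (-(2 * (1 / 2 + ε)))) *
        (Real.exp K₁ * Real.exp (-((A - ε) * h * |(i : ℝ)|))) * K₂ *
        Real.exp (ε * |(k : ℝ)| + B * k - c / 4 * (Real.exp (2 * k) * (1 + (l : ℝ) ^ 2)) +
      -(2 * (1 / 2 + ε) * k)) := by
        rw [Real.exp_add (ε * |(k : ℝ)| + B * k - c / 4 * (Real.exp (2 * k) * (1 + (l : ℝ) ^ 2)))]
        ring
    _ ≤ (1 + |(l : ℝ)|) ^ (-(1 + ε)) *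
        (Real.exp K₁ * Real.exp (-((A - ε) * h * |(i : ℝ)|))) * K₂ *
        (Real.exp K₃ * Real.exp (-((B - 1 - 3 * ε) * |(k : ℝ)|))) := by
        rw [e3]; gcongr
    _ = _ := by ring

end ConeBergman

/-! ### Invariant integration on the triangular group -/

namespace ConeBergman

theorem continuous_gmul_uncurry : Continuous fun p : Par × Par => gmul p.1 p.2 := by
  unfold gmul; fun_prop

theorem lintegral_par {f : Par → ℝ≥0∞} (hf : Measurable f) :
    ∫⁻ g, f g = ∫⁻ α : ℝ, ∫⁻ β : ℝ, ∫⁻ τ : ℝ, f (α, τ, β) := by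
  have h : ∫⁻ g : Par, f g = ∫⁻ g, f g ∂((volume : Measure ℝ).prod (volume : Measure (ℝ × ℝ))) := rfl
  rw [h, lintegral_prod _ hf.aemeasurable]
  refine lintegral_congr fun α => ?_
  have h2 : ∫⁻ g : ℝ × ℝ, f (α, g) =
    ∫⁻ g, f (α, g) ∂((volume : Measure ℝ).prod (volume : Measure ℝ)) := rfl
  have hm : Measurable fun g : ℝ × ℝ => f (α, g) := hf.comp (measurable_const.prodMk measurable_id)
  rw [h2, lintegral_prod_symm' _ hm]

theorem lintegral_comp_add_mul (f : ℝ → ℝ≥0∞) (hf : Measurable f) (t : ℝ) {r : ℝ} (hr : 0 < r) :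
    ∫⁻ x, f (t + x * r) = ENNReal.ofReal r⁻¹ * ∫⁻ x, f x := by
  have h : ∫⁻ x, f (t + x * r) = ∫⁻ x, f (t + x) ∂(Measure.map (· * r) volume) := by
    have hm : Measurable fun x => f (t + x) := hf.comp (measurable_const_add t)
    rw [lintegral_map hm (measurable_mul_const r)]
  rw [h, Real.map_volume_mul_right hr.ne', lintegral_smul_measure, lintegral_add_left_eq_self,
    abs_of_pos (inv_pos.2 hr), smul_eq_mul]

theorem lintegral_gmul_left (g : Par) {f : Par → ℝ≥0∞} (hf : Measurable f) :
    ∫⁻ g', f (gmul g g') = ENNReal.ofReal (Real.exp (-(g.1 - g.2.2))) * ∫⁻ g', f g' := by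
  have hm : Measurable fun g' => f (gmul g g') :=
    hf.comp (continuous_gmul_uncurry.comp (Continuous.prodMk_right g)).measurable
  rw [lintegral_par hm, lintegral_par hf]
  simp only [gmul]
  have h1 : ∀ α β : ℝ, ∫⁻ τ : ℝ, f (g.1 + α, g.2.1 + τ * Real.exp (g.1 - g.2.2), g.2.2 + β) =
      ENNReal.ofReal (Real.exp (-(g.1 - g.2.2))) * ∫⁻ τ : ℝ, f (g.1 + α, τ, g.2.2 + β) := by
    intro α β
    rw [Real.exp_neg]
    exact lintegral_comp_add_mul (fun τ => f (g.1 + α, τ, g.2.2 + β))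
      (hf.comp (by fun_prop)) _ (Real.exp_pos _)
  simp only [h1, lintegral_const_mul' _ _ ENNReal.ofReal_ne_top]
  congr 1
  rw [← lintegral_add_left_eq_self (fun α => ∫⁻ β : ℝ, ∫⁻ τ : ℝ, f (α, τ, β)) g.1]
  refine lintegral_congr fun α => ?_
  rw [← lintegral_add_left_eq_self (fun β => ∫⁻ τ : ℝ, f (g.1 + α, τ, β)) g.2.2]

theorem lintegral_gmul_right (g : Par) {f : Par → ℝ≥0∞} (hf : Measurable f) :
    ∫⁻ γ, f (gmul γ g) = ∫⁻ γ, f γ := by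
  have hm : Measurable fun γ => f (gmul γ g) :=
    hf.comp (continuous_gmul_uncurry.comp (Continuous.prodMk_left g)).measurable
  rw [lintegral_par hm, lintegral_par hf]
  simp only [gmul]
  rw [← lintegral_add_right_eq_self (fun α => ∫⁻ β : ℝ, ∫⁻ τ : ℝ, f (α, τ, β)) g.1]
  refine lintegral_congr fun α => ?_
  rw [← lintegral_add_right_eq_self (fun β => ∫⁻ τ : ℝ, f (α + g.1, τ, β)) g.2.2]
  refine lintegral_congr fun β => ?_
  rw [← lintegral_add_right_eq_self (fun τ => f (α + g.1, τ, β + g.2.2))]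

/-- A character of the triangular group. -/
def wt (a b : ℝ) (g : Par) : ℝ≥0∞ := ENNReal.ofReal (Real.exp (a * g.1 + b * g.2.2))

theorem measurable_wt (a b : ℝ) : Measurable (wt a b) := by
  unfold wt; fun_prop

theorem wt_ne_top (a b : ℝ) (g : Par) : wt a b g ≠ ∞ := ENNReal.ofReal_ne_top

theorem wt_gmul (a b : ℝ) (g g' : Par) : wt a b (gmul g g') = wt a b g * wt a b g' := by
  simp only [wt, gmul]
  rw [← ENNReal.ofReal_mul (Real.exp_pos _).le, ← Real.exp_add]
  congr 2; ring

theorem wt_rpow (a b p : ℝ) (g : Par) : wt a b g ^ p = wt (a * p) (b * p) g := by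
  simp only [wt]
  rw [ENNReal.ofReal_rpow_of_pos (Real.exp_pos _), ← Real.exp_mul]
  congr 2; ring

theorem wt_mul_wt (a b a' b' : ℝ) (g : Par) :
    wt a b g * wt a' b' g = wt (a + a') (b + b') g := by
  simp only [wt]
  rw [← ENNReal.ofReal_mul (Real.exp_pos _).le, ← Real.exp_add]
  congr 2; ring

theorem wt_zero (g : Par) : wt 0 0 g = 1 := by simp [wt]

/-- The weighted measure on the triangular group. -/
def wMeas (a b : ℝ) : Measure Par := volume.withDensity (wt a b)

instance (a b : ℝ) : SFinite (wMeas a b) := by unfold wMeas; infer_instance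

theorem lintegral_wMeas (a b : ℝ) (f : Par → ℝ≥0∞) :
    ∫⁻ g, f g ∂(wMeas a b) = ∫⁻ g, f g * wt a b g := by
  rw [wMeas, lintegral_withDensity_eq_lintegral_mul_non_measurable _ (measurable_wt a b)
    (Filter.Eventually.of_forall fun g => (wt_ne_top a b g).lt_top)]
  simp [mul_comm]

theorem lintegral_wMeas_gmul_right (a b : ℝ) (g : Par) {f : Par → ℝ≥0∞} (hf : Measurable f) :
    ∫⁻ γ, f (gmul γ g) ∂(wMeas a b) = wt (-a) (-b) g * ∫⁻ γ, f γ ∂(wMeas a b) := by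
  have hm : Measurable fun γ => wt (-a) (-b) g * (f γ * wt a b γ) :=
    (hf.mul (measurable_wt a b)).const_mul _
  rw [lintegral_wMeas, lintegral_wMeas, ← lintegral_const_mul' _ _ (wt_ne_top _ _ _),
    ← lintegral_gmul_right g hm]
  refine lintegral_congr fun γ => ?_
  have : wt (-a) (-b) g * wt a b g = 1 := by rw [wt_mul_wt, neg_add_cancel, neg_add_cancel, wt_zero]
  rw [wt_gmul]
  calc _ = f (gmul γ g) * wt a b γ * (wt (-a) (-b) g * wt a b g) := by rw [this, mul_one]
    _ = _ := by ring

theorem lintegral_wMeas_gmul_left (a b : ℝ) (g : Par) {f : Par → ℝ≥0∞} (hf : Measurable f) :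
    ∫⁻ g', f (gmul g g') ∂(wMeas a b) = wt (-a - 1) (-b + 1) g * ∫⁻ γ, f γ ∂(wMeas a b) := by
  have hm : Measurable fun γ => f γ * wt a b γ := hf.mul (measurable_wt a b)
  rw [lintegral_wMeas, lintegral_wMeas]
  have e : wt (-a - 1) (-b + 1) g = ENNReal.ofReal (Real.exp (-(g.1 - g.2.2))) * wt (-a) (-b) g := by
    simp only [wt]
    rw [← ENNReal.ofReal_mul (Real.exp_pos _).le, ← Real.exp_add]
    congr 2; ring
  rw [e, mul_comm (ENNReal.ofReal _), mul_assoc, ← lintegral_gmul_left g hm,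
    ← lintegral_const_mul' _ _ (wt_ne_top _ _ _)]
  refine lintegral_congr fun γ => ?_
  have : wt (-a) (-b) g * wt a b g = 1 := by rw [wt_mul_wt, neg_add_cancel, neg_add_cancel, wt_zero]
  rw [wt_gmul]
  calc _ = f (gmul g γ) * wt a b γ * (wt (-a) (-b) g * wt a b g) := by rw [this, mul_one]
    _ = _ := by ring

end ConeBergman

/-! ### Averages over the cone -/

namespace ConeBergman

/-- The exponential weight on the triangular group. -/
def expW (c : ℝ) (g : Par) : ℝ≥0∞ := ENNReal.ofReal (Real.exp (-(c * act g e₀ 0)))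

theorem expW_ne_top (c : ℝ) (g : Par) : expW c g ≠ ∞ := ENNReal.ofReal_ne_top

theorem continuous_act_e₀ : Continuous fun g : Par => act g e₀ := by
  have h : Continuous fun g : Par => (g, e₀) := by fun_prop
  simpa only [Function.comp_def, Function.uncurry_apply_pair] using continuous_act_uncurry.comp h

theorem measurable_expW (c : ℝ) : Measurable (expW c) := by
  unfold expW
  have := (continuous_apply (0 : Fin 3)).comp continuous_act_e₀
  exact (Real.continuous_exp.comp (this.const_mul c).neg).measurable.ennreal_ofReal

theorem expW_rpow (c p : ℝ) (g : Par) : expW c g ^ p = expW (c * p) g := by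
  simp only [expW]
  rw [ENNReal.ofReal_rpow_of_pos (Real.exp_pos _), ← Real.exp_mul]
  congr 2; ring

theorem lintegral_expW_lt_top {c a b : ℝ} (hc : 0 < c) (ha : 0 < a) (hb : 1 < b) :
    ∫⁻ g, expW c g ∂(wMeas a b) < ∞ := by
  rw [lintegral_wMeas]
  refine lt_of_eq_of_lt (lintegral_congr fun g => ?_) (lintegral_par_lt_top hc ha hb)
  simp only [expW, wt]
  rw [← ENNReal.ofReal_mul (Real.exp_pos _).le, ← Real.exp_add]
  congr 2; ring

theorem coneAvg_eq (c s : ℝ) (φ : V → ℝ≥0∞) (g γ : Par) :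
    coneAvg c s φ g γ =
      2 * ∫⁻ g', expW c (gmul g g') * φ (act (gmul γ g') e₀) ∂(wMeas (2 * s - 1) (2 * s + 1)) := by
  rw [coneAvg, lintegral_cone_rpow, lintegral_wMeas]
  congr 1
  refine lintegral_congr fun g' => ?_
  simp only [expW, wt, act_gmul]
  congr 3; ring

theorem measurable_coneAvg (c s : ℝ) {φ : V → ℝ≥0∞} (hφ : Measurable φ) (g : Par) :
    Measurable (coneAvg c s φ g) := by
  have : coneAvg c s φ g = fun γ => 2 * ∫⁻ g', expW c (gmul g g') * φ (act (gmul γ g') e₀)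
      ∂(wMeas (2 * s - 1) (2 * s + 1)) := funext fun γ => coneAvg_eq c s φ g γ
  rw [this]
  refine Measurable.const_mul (Measurable.lintegral_prod_right' (f := fun p : Par × Par =>
    expW c (gmul g p.2) * φ (act (gmul p.1 p.2) e₀)) ?_) _
  exact ((measurable_expW c).comp (continuous_gmul_uncurry.comp
    (continuous_const.prodMk continuous_snd)).measurable).mul
    (hφ.comp (continuous_act_e₀.comp continuous_gmul_uncurry).measurable)

/-- Pointwise control of the averages over the cone. -/
theorem exists_coneAvg_le {c s q : ℝ} (hc : 0 < c) (hs : 1 / 2 < s) (hq : 1 < q)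
    {φ : V → ℝ≥0∞} (hφ : Measurable φ)
    (hN : ∫⁻ g, φ (act g e₀) ^ q ∂(wMeas (2 * s - 1) (2 * s + 1)) ≠ ∞) (γ : Par) :
    ∃ X : ℝ≥0∞, X ≠ ∞ ∧ ∀ g, coneAvg c s φ g γ ≤
      wt (-(2 * s * (1 - 1 / q))) (-(2 * s * (1 - 1 / q))) g * X := by
  have hpq : (q / (q - 1)).HolderConjugate q := (Real.HolderConjugate.conjExponent hq).symm
  have hq' : 1 / (q / (q - 1)) = 1 - 1 / q := by field_simp
  have hr : 0 < q / (q - 1) := div_pos (by linarith) (by linarith)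
  set r := q / (q - 1)
  set M := wMeas (2 * s - 1) (2 * s + 1)
  have hI := (lintegral_expW_lt_top (c := c * r) (a := 2 * s - 1) (b := 2 * s + 1)
    (by positivity) (by linarith) (by linarith)).ne
  have hφm : Measurable fun g => φ (act g e₀) := hφ.comp continuous_act_e₀.measurable
  refine ⟨2 * ((∫⁻ g, expW (c * r) g ∂M) ^ (1 / r) *
    (∫⁻ g', φ (act (gmul γ g') e₀) ^ q ∂M) ^ (1 / q)), ?_, fun g => ?_⟩
  · refine ENNReal.mul_ne_top (by norm_num) (ENNReal.mul_ne_top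
      (ENNReal.rpow_ne_top_of_nonneg (by positivity) hI)
      (ENNReal.rpow_ne_top_of_nonneg (by positivity) ?_))
    rw [lintegral_wMeas_gmul_left _ _ γ (hφm.pow_const q)]
    exact ENNReal.mul_ne_top (wt_ne_top _ _ _) hN
  · rw [coneAvg_eq, mul_left_comm, ← mul_assoc (wt _ _ g)]
    gcongr
    have hm1 : Measurable fun g' => expW c (gmul g g') := (measurable_expW c).comp
      (continuous_gmul_uncurry.comp (Continuous.prodMk_right g)).measurable
    have hm2 : Measurable fun g' => φ (act (gmul γ g') e₀) :=
      hφm.comp (continuous_gmul_uncurry.comp (Continuous.prodMk_right γ)).measurable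
    refine (ENNReal.lintegral_mul_le_Lp_mul_Lq M hpq hm1.aemeasurable hm2.aemeasurable).trans_eq ?_
    congr 1
    simp only [expW_rpow]
    rw [lintegral_wMeas_gmul_left _ _ g (measurable_expW (c * r)),
      ENNReal.mul_rpow_of_nonneg _ _ (by positivity), wt_rpow, hq']
    congr 2 <;> ring

/-- Weighted norm control of the averages over the cone. -/
theorem lintegral_coneAvg_rpow_le {c s q : ℝ} (hq : 1 ≤ q) {φ : V → ℝ≥0∞} (hφ : Measurable φ)
    (g : Par) :
    (∫⁻ γ, coneAvg c s φ g γ ^ q ∂(wMeas (2 * s - 1) (2 * s + 1))) ^ (1 / q) ≤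
      wt (-((2 * s - 1) * (1 - 1 / q)) - 1) (-((2 * s + 1) * (1 - 1 / q)) + 1) g *
        (2 * (∫⁻ g, expW c g ∂(wMeas ((2 * s - 1) * (1 - 1 / q)) ((2 * s + 1) * (1 - 1 / q)))) *
        (∫⁻ g, φ (act g e₀) ^ q ∂(wMeas (2 * s - 1) (2 * s + 1))) ^ (1 / q)) := by
  have hq0 : 0 < q := by linarith
  set M := wMeas (2 * s - 1) (2 * s + 1)
  set N := ∫⁻ g, φ (act g e₀) ^ q ∂M with hN
  have hφm : Measurable fun g => φ (act g e₀) := hφ.comp continuous_act_e₀.measurable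
  have hm : Measurable (Function.uncurry fun (γ g' : Par) =>
      expW c (gmul g g') * φ (act (gmul γ g') e₀)) :=
    ((measurable_expW c).comp (continuous_gmul_uncurry.comp
      (continuous_const.prodMk continuous_snd)).measurable).mul
      (hφ.comp (continuous_act_e₀.comp continuous_gmul_uncurry).measurable)
  have h1 : ∀ g', (∫⁻ γ, (expW c (gmul g g') * φ (act (gmul γ g') e₀)) ^ q ∂M) ^ (1 / q) =
      expW c (gmul g g') * (wt (-((2 * s - 1) / q)) (-((2 * s + 1) / q)) g' * N ^ (1 / q)) := by
    intro g'
    simp only [ENNReal.mul_rpow_of_nonneg _ _ hq0.le]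
    rw [lintegral_const_mul' _ _ (ENNReal.rpow_ne_top_of_nonneg hq0.le (expW_ne_top _ _)),
      lintegral_wMeas_gmul_right _ _ g' (hφm.pow_const q),
      ENNReal.mul_rpow_of_nonneg _ _ (by positivity),
      ENNReal.mul_rpow_of_nonneg _ _ (by positivity), ← ENNReal.rpow_mul,
      mul_one_div_cancel hq0.ne', ENNReal.rpow_one, wt_rpow]
    congr 3 <;> ring
  have h2 : ∫⁻ g', expW c (gmul g g') *
      (wt (-((2 * s - 1) / q)) (-((2 * s + 1) / q)) g' * N ^ (1 / q)) ∂M =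
      wt (-((2 * s - 1) * (1 - 1 / q)) - 1) (-((2 * s + 1) * (1 - 1 / q)) + 1) g *
      (∫⁻ g, expW c g ∂(wMeas ((2 * s - 1) * (1 - 1 / q)) ((2 * s + 1) * (1 - 1 / q)))) *
      N ^ (1 / q) := by
    rw [← lintegral_wMeas_gmul_left _ _ g (measurable_expW c)]
    have hm1 : Measurable fun g' => expW c (gmul g g') *
        wt ((2 * s - 1) * (1 - 1 / q)) ((2 * s + 1) * (1 - 1 / q)) g' :=
      ((measurable_expW c).comp
      (continuous_gmul_uncurry.comp (Continuous.prodMk_right g)).measurable).mul (measurable_wt _ _)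
    rw [lintegral_wMeas, lintegral_wMeas, ← lintegral_mul_const _ hm1]
    refine lintegral_congr fun g' => ?_
    have : wt (-((2 * s - 1) / q)) (-((2 * s + 1) / q)) g' * wt (2 * s - 1) (2 * s + 1) g' =
        wt ((2 * s - 1) * (1 - 1 / q)) ((2 * s + 1) * (1 - 1 / q)) g' := by
      rw [wt_mul_wt]; congr 1 <;> ring
    rw [← this]; ring
  simp only [coneAvg_eq, ENNReal.mul_rpow_of_nonneg _ _ hq0.le]
  rw [lintegral_const_mul' _ _ (ENNReal.rpow_ne_top_of_nonneg hq0.le (by norm_num)),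
    ENNReal.mul_rpow_of_nonneg _ _ (by positivity), ← ENNReal.rpow_mul,
    mul_one_div_cancel hq0.ne', ENNReal.rpow_one]
  have h3 := ENNReal.rpow_le_rpow (lintegral_lintegral_rpow_le (μ := M) (ρ := M) hm hq)
    (show 0 ≤ 1 / q by positivity)
  rw [← ENNReal.rpow_mul, mul_one_div_cancel hq0.ne', ENNReal.rpow_one] at h3
  simp only [h1] at h3
  rw [h2] at h3
  refine (mul_le_mul_right h3 2).trans_eq ?_
  ring

end ConeBergman

/-! ### Norms of the series -/

namespace ConeBergman

theorem mult_rpow_eq (g : Par) (r : ℝ) : mult g ^ r = Real.exp (r * g.1 + r * g.2.2) := by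
  rw [mult, ← Real.exp_add, ← Real.exp_mul]
  congr 1; ring

theorem tsum_ofReal_ne_top {ι : Type*} {f : ι → ℝ≥0∞} {g : ι → ℝ} (hg : Summable g)
    (hg0 : ∀ i, 0 ≤ g i) (h : ∀ i, f i ≤ ENNReal.ofReal (g i)) : ∑' i, f i ≠ ∞ := by
  refine ((ENNReal.tsum_le_tsum h).trans_lt ?_).ne
  rw [← ENNReal.ofReal_tsum_of_nonneg hg0 hg]
  exact ENNReal.ofReal_lt_top

theorem one_le_lossW {ε h : ℝ} (hε : 0 ≤ ε) (hh : 0 ≤ h) (j : ℤ × ℤ × ℤ) : 1 ≤ lossW ε h j := by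
  have h1 : (1 : ℝ) ≤ (1 + |(j.2.2 : ℝ)|) ^ ε :=
    Real.one_le_rpow (by linarith [abs_nonneg (j.2.2 : ℝ)]) hε
  have h2 : (1 : ℝ) ≤ Real.exp (ε * (h * |(j.1 : ℝ)| + |(j.2.1 : ℝ)|)) :=
    Real.one_le_exp (by positivity)
  exact one_le_mul_of_one_le_of_one_le h1 h2

theorem tsum_coefA_ne_top {h s c q : ℝ} (hh : 0 < h) (hc : 0 < c)
    (hsq : 2 / 5 < 2 * s / q) :
    ∑' j, ENNReal.ofReal (coefA h s c j) *
      wt (-(2 * s * (1 - 1 / q))) (-(2 * s * (1 - 1 / q))) (lat h j) ≠ ∞ := by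
  refine tsum_ofReal_ne_top (summable_lossW_mul_exp (ε := 1 / 100) (h := h) (c := c)
    (A := 2 * s / q + 3 / 4) (B := 2 * s / q + 3 / 4) (by norm_num) hh hc (by linarith)
    (by linarith)) (fun j => mul_nonneg (lossW_pos _ _ _).le (by positivity)) fun j => ?_
  simp only [wt]
  rw [← ENNReal.ofReal_mul (coefA_nonneg _ _ _ _)]
  refine ENNReal.ofReal_le_ofReal ?_
  refine le_trans (le_of_eq ?_) (le_mul_of_one_le_left (by positivity)
    (one_le_lossW (by norm_num) hh.le j))
  rw [coefA, mult_rpow_eq, ← Real.exp_add, ← Real.exp_add, ← Real.exp_add]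
  congr 1; ring

theorem tsum_coefB_ne_top {ε h s c q : ℝ} (hε : 0 < ε) (hh : 0 < h) (hc : 0 < c)
    (hA : ε < 2 * (2 * s - 1) / q) (hB : 1 + 3 * ε < 2 * (2 * s + 1) / q) :
    ∑' j, ENNReal.ofReal (coefB ε h s c j) *
      wt (-((2 * s - 1) * (1 - 1 / q)) - 1) (-((2 * s + 1) * (1 - 1 / q)) + 1) (lat h j) ^ 2 ≠ ∞ := by
  refine tsum_ofReal_ne_top (summable_lossW_mul_exp (h := h) (c := 2 * c)
    hε hh (by positivity) hA hB)
    (fun j => mul_nonneg (lossW_pos _ _ _).le (by positivity)) fun j => ?_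
  simp only [wt]
  rw [← ENNReal.ofReal_pow (Real.exp_pos _).le, ← ENNReal.ofReal_mul (coefB_nonneg _ _ _ _ _)]
  refine ENNReal.ofReal_le_ofReal (le_of_eq ?_)
  rw [coefB, mult_rpow_eq, mul_assoc]
  congr 1
  rw [← Real.exp_add, ← Real.exp_add, ← Real.exp_nat_mul, ← Real.exp_nat_mul, ← Real.exp_add]
  congr 1; push_cast; ring

theorem tsum_coefA_mul_coneAvg_ne_top {h s c q : ℝ} (hh : 0 < h) (hc : 0 < c) (hq : 1 < q)
    (hs : 1 / 2 < s) (hsq : 2 / 5 < 2 * s / q) {φ : V → ℝ≥0∞} (hφ : Measurable φ)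
    (hN : ∫⁻ g, φ (act g e₀) ^ q ∂(wMeas (2 * s - 1) (2 * s + 1)) ≠ ∞) (γ : Par) :
    ∑' j, ENNReal.ofReal (coefA h s c j) * coneAvg c s φ (lat h j) γ ≠ ∞ := by
  obtain ⟨X, hX, hle⟩ := exists_coneAvg_le hc hs hq hφ hN γ
  refine ((ENNReal.tsum_le_tsum fun j => mul_le_mul_right (hle (lat h j)) _).trans_lt ?_).ne
  simp only [← mul_assoc]
  rw [ENNReal.tsum_mul_right]
  exact ENNReal.mul_lt_top (tsum_coefA_ne_top hh hc hsq).lt_top hX.lt_top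

/-- The weighted norm of the square function series. -/
theorem exists_lintegral_tsum_coefB_le {ε h s c q : ℝ} (hε : 0 < ε) (hh : 0 < h) (hc : 0 < c)
    (hq : 2 ≤ q) (hs : 1 / 2 < s)
    (hA : ε < 2 * (2 * s - 1) / q) (hB : 1 + 3 * ε < 2 * (2 * s + 1) / q) :
    ∃ K : ℝ≥0∞, K ≠ ∞ ∧ ∀ φ : V → ℝ≥0∞, Measurable φ →
      ∫⁻ γ, (∑' j, ENNReal.ofReal (coefB ε h s c j) * coneAvg c s φ (lat h j) γ ^ 2) ^ (q / 2)
        ∂(wMeas (2 * s - 1) (2 * s + 1)) ≤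
      K * ∫⁻ g, φ (act g e₀) ^ q ∂(wMeas (2 * s - 1) (2 * s + 1)) := by
  have hq0 : 0 < q := by linarith
  have hq1 : 1 / q ≤ 1 / 2 := one_div_le_one_div_of_le (by norm_num) hq
  have hS := tsum_coefB_ne_top hε hh hc hA hB
  set W : Par → ℝ≥0∞ :=
    wt (-((2 * s - 1) * (1 - 1 / q)) - 1) (-((2 * s + 1) * (1 - 1 / q)) + 1) with hW
  set S := ∑' j, ENNReal.ofReal (coefB ε h s c j) * W (lat h j) ^ 2 with hSd
  have hJ : ∫⁻ g, expW c g ∂(wMeas ((2 * s - 1) * (1 - 1 / q)) ((2 * s + 1) * (1 - 1 / q))) ≠ ∞ :=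
    (lintegral_expW_lt_top hc (mul_pos (by linarith) (by linarith)) (by
      have : (0 : ℝ) ≤ (1 / 2 - 1 / q) * (2 * s + 1) := mul_nonneg (by linarith) (by linarith)
      nlinarith)).ne
  set J := ∫⁻ g, expW c g ∂(wMeas ((2 * s - 1) * (1 - 1 / q)) ((2 * s + 1) * (1 - 1 / q))) with hJd
  refine ⟨(S * (2 * J) ^ 2) ^ (q / 2), ENNReal.rpow_ne_top_of_nonneg (by positivity)
    (ENNReal.mul_ne_top hS (ENNReal.pow_ne_top (ENNReal.mul_ne_top (by norm_num) hJ))),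
    fun φ hφ => ?_⟩
  set M := wMeas (2 * s - 1) (2 * s + 1) with hM
  set N := ∫⁻ g, φ (act g e₀) ^ q ∂M with hN
  have hm : Measurable (Function.uncurry fun (γ : Par) (j : ℤ × ℤ × ℤ) =>
      ENNReal.ofReal (coefB ε h s c j) * coneAvg c s φ (lat h j) γ ^ 2) :=
    measurable_from_prod_countable_left fun j => by
      simpa only [Function.uncurry_apply_pair] using
        ((measurable_coneAvg c s hφ (lat h j)).pow_const 2).const_mul _
  have h1 := lintegral_lintegral_rpow_le (μ := M) (ρ := Measure.count) hm
    (show 1 ≤ q / 2 by linarith)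
  simp only [lintegral_count] at h1
  refine h1.trans ?_
  have h2 : ∀ j : ℤ × ℤ × ℤ, (∫⁻ γ, (ENNReal.ofReal (coefB ε h s c j) *
      coneAvg c s φ (lat h j) γ ^ 2) ^ (q / 2) ∂M) ^ (1 / (q / 2)) ≤
      ENNReal.ofReal (coefB ε h s c j) * W (lat h j) ^ 2 * (2 * J * N ^ (1 / q)) ^ 2 := by
    intro j
    have e : ∀ γ, (ENNReal.ofReal (coefB ε h s c j) * coneAvg c s φ (lat h j) γ ^ 2) ^ (q / 2) =
        ENNReal.ofReal (coefB ε h s c j) ^ (q / 2) * coneAvg c s φ (lat h j) γ ^ q := by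
      intro γ
      rw [ENNReal.mul_rpow_of_nonneg _ _ (by positivity), ← ENNReal.rpow_natCast,
        ← ENNReal.rpow_mul]
      congr 2; push_cast; ring
    simp only [e]
    rw [lintegral_const_mul' _ _ (ENNReal.rpow_ne_top_of_nonneg (by positivity)
      ENNReal.ofReal_ne_top), ENNReal.mul_rpow_of_nonneg _ _ (by positivity), ← ENNReal.rpow_mul,
      mul_one_div_cancel (by positivity), ENNReal.rpow_one, mul_assoc, ← mul_pow]
    gcongr
    rw [show 1 / (q / 2) = 1 / q * (2 : ℕ) by push_cast; field_simp, ENNReal.rpow_mul,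
      ENNReal.rpow_natCast]
    gcongr
    exact lintegral_coneAvg_rpow_le (by linarith) hφ (lat h j)
  calc _ ≤ (∑' j, ENNReal.ofReal (coefB ε h s c j) * W (lat h j) ^ 2 *
        (2 * J * N ^ (1 / q)) ^ 2) ^ (q / 2) := by
        gcongr with j; exact h2 j
    _ = _ := by
        rw [ENNReal.tsum_mul_right, mul_pow, ← mul_assoc,
          ENNReal.mul_rpow_of_nonneg _ _ (by positivity)]
        congr 1
        rw [← ENNReal.rpow_natCast, ← ENNReal.rpow_mul, ← ENNReal.rpow_mul]
        rw [show 1 / q * ((2 : ℕ) * (q / 2)) = 1 by push_cast; field_simp, ENNReal.rpow_one]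

end ConeBergman

/-! ### Boundedness of the Bergman-type operator -/

namespace ConeBergman

/-- The weighted density of the Bergman-type operator. -/
def dens (ν : ℝ) (F : (Fin 3 → ℂ) → ℂ) (w : V × V) : ℂ :=
  (lightCone 3).indicator
    (fun v => F (tubePt 3 w.1 v) * ((lorentzQ 3 v ^ (ν - 3 / 2) : ℝ) : ℂ)) w.2

/-- The `L⁴` norm of a function on a horizontal slice of the tube. -/
def prof (F : (Fin 3 → ℂ) → ℂ) (v : V) : ℝ≥0∞ :=
  (∫⁻ u, ‖F (tubePt 3 u v)‖ₑ ^ (4 : ℝ)) ^ (1 / (4 : ℝ))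

theorem measurable_tubePt : Measurable fun w : V × V => tubePt 3 w.1 w.2 := by
  unfold tubePt; fun_prop

theorem measurable_prof {F : (Fin 3 → ℂ) → ℂ} (hF : Measurable F) : Measurable (prof F) := by
  unfold prof
  refine Measurable.pow_const ?_ _
  refine Measurable.lintegral_prod_right'
    (f := fun w : V × V => ‖F (tubePt 3 w.2 w.1)‖ₑ ^ (4 : ℝ)) ?_
  exact (hF.comp (measurable_tubePt.comp measurable_swap)).enorm.pow_const _

theorem measurable_dens (ν : ℝ) {F : (Fin 3 → ℂ) → ℂ} (hF : Measurable F) :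
    Measurable (dens ν F) := by
  have h : dens ν F = (Prod.snd ⁻¹' lightCone 3).indicator
      (fun w : V × V => F (tubePt 3 w.1 w.2) * ((lorentzQ 3 w.2 ^ (ν - 3 / 2) : ℝ) : ℂ)) := by
    ext w; rfl
  rw [h]
  refine Measurable.indicator ((hF.comp measurable_tubePt).mul ?_)
    (measurableSet_cone.preimage measurable_snd)
  exact Complex.measurable_ofReal.comp
    ((continuous_lorentzQ.measurable.comp measurable_snd).pow_const _)

theorem dens_eq_zero (ν : ℝ) (F : (Fin 3 → ℂ) → ℂ) (u : V) {v : V} (hv : v ∉ lightCone 3) :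
    dens ν F (u, v) = 0 := indicator_of_notMem hv _

theorem sl_dens (ν : ℝ) (F : (Fin 3 → ℂ) → ℂ) {v : V} (hv : v ∈ lightCone 3) :
    sl (dens ν F) v = prof F v * ENNReal.ofReal (lorentzQ 3 v ^ (ν - 3 / 2)) := by
  have hQ : 0 ≤ lorentzQ 3 v ^ (ν - 3 / 2) := Real.rpow_nonneg hv.2.le _
  have e : ∀ u, ‖dens ν F (u, v)‖ₑ ^ (4 : ℝ) = ‖F (tubePt 3 u v)‖ₑ ^ (4 : ℝ) *
      ENNReal.ofReal (lorentzQ 3 v ^ (ν - 3 / 2)) ^ (4 : ℝ) := by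
    intro u
    rw [dens, indicator_of_mem hv, enorm_mul, ENNReal.mul_rpow_of_nonneg _ _ (by norm_num)]
    congr 2
    rw [← ofReal_norm, Complex.norm_real, Real.norm_of_nonneg hQ]
  rw [sl, prof]
  simp only [e]
  rw [lintegral_mul_const' _ _ (ENNReal.rpow_ne_top_of_nonneg (by norm_num) ENNReal.ofReal_ne_top),
    ENNReal.mul_rpow_of_nonneg _ _ (by norm_num), ← ENNReal.rpow_mul]
  norm_num

theorem mixedNorm_eq {q : ℝ} (ν : ℝ) (F : (Fin 3 → ℂ) → ℂ) :
    mixedNorm 3 4 q ν F =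
      (2 * ∫⁻ g, prof F (act g e₀) ^ q ∂(wMeas (2 * ν - 1) (2 * ν + 1))) ^ (1 / q) := by
  rw [mixedNorm]
  congr 1
  have e : ∀ y : V, (∫⁻ x : V, (‖F (tubePt 3 x y)‖₊ : ℝ≥0∞) ^ (4 : ℝ)) ^ (q / 4) *
      ENNReal.ofReal (lorentzQ 3 y ^ (ν - ((3 : ℕ) : ℝ) / 2)) =
      prof F y ^ q * ENNReal.ofReal (lorentzQ 3 y ^ (ν - 3 / 2)) := by
    intro y
    rw [prof, ← ENNReal.rpow_mul, one_div_mul_eq_div]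
    rfl
  refine (lintegral_congr e).trans ?_
  rw [lintegral_cone_rpow, lintegral_wMeas]
  congr 1
  refine lintegral_congr fun g => ?_
  rw [wt]
  congr 3; ring

theorem cpt_eq (x y u v : V) :
    (fun k => (tubePt 3 x y k - ((u k : ℂ) - (v k : ℂ) * I)) / I) = cpt (y + v) (x - u) := by
  ext k
  simp only [tubePt, cpt, Pi.add_apply, Pi.sub_apply, ofReal_add, ofReal_sub]
  rw [div_I]
  ring_nf
  rw [I_sq]; ring

theorem bergmanIntegrand_eq (ν : ℝ) (F : (Fin 3 → ℂ) → ℂ) (x y : V) :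
    (univ ×ˢ lightCone 3 : Set (V × V)).indicator (bergmanIntegrand 3 ν F (tubePt 3 x y)) =
      fun w => bker ν (y + w.2) (x - w.1) * dens ν F w := by
  ext ⟨u, v⟩
  by_cases hv : v ∈ lightCone 3
  · rw [indicator_of_mem (by simpa using hv), dens, indicator_of_mem hv, bergmanIntegrand, cpt_eq,
      bker, mul_assoc]
    norm_num
  · rw [indicator_of_notMem (by simpa using hv), dens_eq_zero ν F u hv, mul_zero]

theorem measurableSet_univ_prod_cone : MeasurableSet (univ ×ˢ lightCone 3 : Set (V × V)) :=
  MeasurableSet.univ.prod measurableSet_cone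

theorem bergmanOp_tubePt (ν : ℝ) (F : (Fin 3 → ℂ) → ℂ) (x y : V) :
    bergmanOp 3 ν F (tubePt 3 x y) = opY ν (dens ν F) y x := by
  rw [bergmanOp, opY, ← bergmanIntegrand_eq, integral_indicator measurableSet_univ_prod_cone]

theorem tubePt_re_im (z : Fin 3 → ℂ) :
    tubePt 3 (fun k => (z k).re) (fun k => (z k).im) = z := by
  ext k
  exact re_add_im (z k)

/-- Boundedness of the Bergman-type operator, given the numerology of the exponents. -/
theorem exists_mixedNorm_le {ε ν q : ℝ} (hε : 0 < ε) (hν : 1 / 2 < ν) (hq : 2 ≤ q)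
    (hsq : 2 / 5 < 2 * ν / q) (hA : ε < 2 * (2 * ν - 1) / q)
    (hB : 1 + 3 * ε < 2 * (2 * ν + 1) / q) :
    ∃ C : ℝ, 0 < C ∧ ∀ F : (Fin 3 → ℂ) → ℂ, Measurable F → mixedNorm 3 4 q ν F < ∞ →
      (∀ z : Fin 3 → ℂ, inTube 3 z →
        IntegrableOn (bergmanIntegrand 3 ν F z) (univ ×ˢ lightCone 3)) ∧
      mixedNorm 3 4 q ν (bergmanOp 3 ν F) ≤ ENNReal.ofReal C * mixedNorm 3 4 q ν F := by
  have hq0 : 0 < q := by linarith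
  obtain ⟨h, hh, D, hD, hDec⟩ := exists_decoupling hε
  obtain ⟨C, hC, c, hc, hK⟩ := exists_lintegral_ker_le hh ν
  obtain ⟨K, hKtop, hKle⟩ := exists_lintegral_tsum_coefB_le hε hh hc hq hν hA hB
  have hL : ENNReal.ofReal (lapC ν) ≠ 0 := by
    simpa using lapC_pos (show -1 < ν by linarith)
  set L := ENNReal.ofReal (lapC ν)
  set R := L⁻¹ ^ q * (ENNReal.ofReal (D * C ^ 2) ^ (q / 2) * K) with hR
  have hRtop : R ≠ ∞ := ENNReal.mul_ne_top
    (ENNReal.rpow_ne_top_of_nonneg hq0.le (ENNReal.inv_ne_top.2 hL)) (ENNReal.mul_ne_top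
    (ENNReal.rpow_ne_top_of_nonneg (by positivity) ENNReal.ofReal_ne_top) hKtop)
  have hR' : R ^ (1 / q) ≠ ∞ := ENNReal.rpow_ne_top_of_nonneg (by positivity) hRtop
  refine ⟨(R ^ (1 / q)).toReal + 1, by positivity, fun F hF hfin => ?_⟩
  set M := wMeas (2 * ν - 1) (2 * ν + 1) with hM
  have hN : ∫⁻ g, prof F (act g e₀) ^ q ∂M ≠ ∞ := by
    intro htop
    rw [mixedNorm_eq, htop, ENNReal.mul_top (by norm_num),
      ENNReal.top_rpow_of_pos (by positivity)] at hfin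
    exact lt_irrefl _ hfin
  have hb := fun γ => opY_bound hh (show -1 < ν by linarith) hDec hD hK hC hc
    (measurable_dens ν hF) (fun u v hv => dens_eq_zero ν F u hv) (fun v hv => sl_dens ν F hv) γ
    (tsum_coefA_mul_coneAvg_ne_top hh hc (by linarith) hν hsq (measurable_prof hF) hN γ)
  constructor
  · intro z hz
    obtain ⟨γ, hγ⟩ := exists_act_e₀ hz
    rw [← integrable_indicator_iff measurableSet_univ_prod_cone, ← tubePt_re_im z, ← hγ,
      bergmanIntegrand_eq]
    exact (hb γ).1 _
  · have hpt : ∀ γ, prof (bergmanOp 3 ν F) (act γ e₀) ^ q ≤ L⁻¹ ^ q *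
        (ENNReal.ofReal (D * C ^ 2) ^ (q / 2) * (∑' j, ENNReal.ofReal (coefB ε h ν c j) *
          coneAvg c ν (prof F) (lat h j) γ ^ 2) ^ (q / 2)) := by
      intro γ
      have h2 := ENNReal.rpow_le_rpow (hb γ).2 (show 0 ≤ q / 2 by positivity)
      rw [← ENNReal.rpow_natCast, ← ENNReal.rpow_mul,
        show ((2 : ℕ) : ℝ) * (q / 2) = q by push_cast; ring,
        ENNReal.mul_rpow_of_nonneg _ _ hq0.le, ENNReal.mul_rpow_of_nonneg _ _ (by positivity)] at h2
      simp only [prof, bergmanOp_tubePt]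
      rw [ENNReal.inv_rpow]
      refine le_trans ?_ (mul_le_mul_right h2 _)
      rw [← mul_assoc, ENNReal.inv_mul_cancel (ENNReal.rpow_pos
        (pos_iff_ne_zero.2 hL) ENNReal.ofReal_ne_top).ne' (ENNReal.rpow_ne_top_of_nonneg
        hq0.le ENNReal.ofReal_ne_top), one_mul]
    have h_int : ∫⁻ γ, prof (bergmanOp 3 ν F) (act γ e₀) ^ q ∂M ≤
        R * ∫⁻ g, prof F (act g e₀) ^ q ∂M := by
      refine (lintegral_mono hpt).trans ?_
      rw [lintegral_const_mul' _ _ (ENNReal.rpow_ne_top_of_nonneg hq0.le (ENNReal.inv_ne_top.2 hL)),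
        lintegral_const_mul' _ _ (ENNReal.rpow_ne_top_of_nonneg (by positivity)
        ENNReal.ofReal_ne_top), hR, mul_assoc, mul_assoc]
      gcongr
      exact hKle (prof F) (measurable_prof hF)
    rw [mixedNorm_eq, mixedNorm_eq]
    calc _ ≤ (R * (2 * ∫⁻ g, prof F (act g e₀) ^ q ∂M)) ^ (1 / q) := by
          rw [mul_left_comm]; gcongr
      _ = R ^ (1 / q) * (2 * ∫⁻ g, prof F (act g e₀) ^ q ∂M) ^ (1 / q) :=
          ENNReal.mul_rpow_of_nonneg _ _ (by positivity)
      _ ≤ _ := by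
          gcongr
          rw [← ENNReal.ofReal_toReal hR']
          exact ENNReal.ofReal_le_ofReal (by simp)

end ConeBergman

/-- In dimension `n = 3`, for `ν > 1/2 + 5/11`, `p = 4` and
`2 ≤ q < (4/3 + 1/24)·q_ν` with `q_ν = 2ν + 1`, the Bergman-type operator `T_ν`
is bounded on `L^{4,q}_ν(T_{Λ₃})`, and its defining integral converges absolutely
at every point of the tube. -/
theorem statement3 (ν q : ℝ) (hν : 1 / 2 + 5 / 11 < ν)
    (hq1 : 2 ≤ q) (hq2 : q < (4 / 3 + 1 / 24) * (2 * ν + 1)) :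
    ∃ C : ℝ, 0 < C ∧
      ∀ F : (Fin 3 → ℂ) → ℂ, Measurable F → mixedNorm 3 4 q ν F < ∞ →
        (∀ z : Fin 3 → ℂ, inTube 3 z →
            IntegrableOn (bergmanIntegrand 3 ν F z) (univ ×ˢ lightCone 3)) ∧
        mixedNorm 3 4 q ν (bergmanOp 3 ν F) ≤ ENNReal.ofReal C * mixedNorm 3 4 q ν F := by
  have hq0 : 0 < q := by linarith
  refine ConeBergman.exists_mixedNorm_le (ε := 1 / 10) (by norm_num) (by linarith) hq1 ?_ ?_ ?_ <;>
  · rw [lt_div_iff₀ hq0]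
    linarith
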